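/- Suppose the central arrangement A defined by l_1,…,l_p is free, i.e. D(A) is a free R-module. Then the Bernstein ideal B(A) ⊆ ℂ[s_1,…,s_p] is the principal ideal generated by the polynomial b_A(s_1,…,s_p) = ∏_{X ∈ L'(A)} ∏_{j=0}^{2(card J(X) − r(X))} ( (∑_{i ∈ J(X)} s_i) + r(X) + j ). -/

import Mathlib

open MvPolynomial

namespace Arrangement

variable {n : ℕ} {ι : Type} [Fintype ι]

/-- The module `D(A)` of logarithmic derivations of the arrangement defined by
the forms `l i`. -/
noncomputable def DA (l : ι → MvPolynomial (Fin n) ℂ) :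
    Submodule (MvPolynomial (Fin n) ℂ)
      (Derivation ℂ (MvPolynomial (Fin n) ℂ) (MvPolynomial (Fin n) ℂ)) where
  carrier := {χ | ∀ i, χ (l i) ∈ Ideal.span {l i}}
  add_mem' := fun hx hy i => by
    simpa using add_mem (hx i) (hy i)
  zero_mem' := fun i => by simp
  smul_mem' := fun r χ hχ i => by
    simpa using Ideal.mul_mem_left _ r (hχ i)

open Classical in
/-- The property characterizing the family of twisted derivatives
`D i = ∂/∂xᵢ + ∑ⱼ sⱼ (∂lⱼ/∂xᵢ)/lⱼ` acting on the localization
`M = ℂ[x,s,1/F]·l^s`. -/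
def IsTwisted (l : ι → MvPolynomial (Fin n) ℂ)
    (D : Fin n → Module.End ℂ
      (Localization.Away (rename Sum.inl (∏ i, l i) : MvPolynomial (Fin n ⊕ ι) ℂ))) : Prop :=
  (∀ (i : Fin n) (r : MvPolynomial (Fin n ⊕ ι) ℂ)
      (m : Localization.Away (rename Sum.inl (∏ i, l i) : MvPolynomial (Fin n ⊕ ι) ℂ)),
      D i (algebraMap _ _ r * m)
        = algebraMap _ _ (pderiv (Sum.inl i) r) * m + algebraMap _ _ r * D i m) ∧
  (∀ i : Fin n,
      algebraMap (MvPolynomial (Fin n ⊕ ι) ℂ) _ (rename Sum.inl (∏ j, l j)) * D i 1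
        = algebraMap _ _ (∑ j, X (Sum.inr j) *
            rename Sum.inl (pderiv i (l j) * ∏ k ∈ Finset.univ.erase j, l k)))

/-- The algebra `W` of operators on `M`, image of the Weyl algebra
`Aₙ(ℂ)[s₁,…,s_p]` acting on `ℂ[x,s,1/F]·l^s`. -/
noncomputable def Wa (l : ι → MvPolynomial (Fin n) ℂ)
    (D : Fin n → Module.End ℂ
      (Localization.Away (rename Sum.inl (∏ i, l i) : MvPolynomial (Fin n ⊕ ι) ℂ))) :
    Subalgebra ℂ (Module.End ℂ
      (Localization.Away (rename Sum.inl (∏ i, l i) : MvPolynomial (Fin n ⊕ ι) ℂ))) :=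
  Algebra.adjoin ℂ
    ((Set.range fun i : Fin n =>
        LinearMap.mulLeft ℂ (algebraMap _ _ (X (Sum.inl i) : MvPolynomial (Fin n ⊕ ι) ℂ))) ∪
     (Set.range fun j : ι =>
        LinearMap.mulLeft ℂ (algebraMap _ _ (X (Sum.inr j) : MvPolynomial (Fin n ⊕ ι) ℂ))) ∪
     Set.range D)

/-- The Bernstein ideal `B(A)`, as the set of polynomials `b(s₁,…,s_p)` such that
`b · l^s = P · l^{s+1}` for some operator `P` in the Weyl algebra. -/
noncomputable def Bideal (l : ι → MvPolynomial (Fin n) ℂ)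
    (D : Fin n → Module.End ℂ
      (Localization.Away (rename Sum.inl (∏ i, l i) : MvPolynomial (Fin n ⊕ ι) ℂ))) :
    Set (MvPolynomial ι ℂ) :=
  {b | ∃ P ∈ Wa l D,
    algebraMap (MvPolynomial (Fin n ⊕ ι) ℂ) _ ((rename Sum.inr b : MvPolynomial (Fin n ⊕ ι) ℂ))
      = P (algebraMap _ _ (rename Sum.inl (∏ i, l i) : MvPolynomial (Fin n ⊕ ι) ℂ))}

/-- The linear functional on `ℂⁿ` associated to a linear form. -/
noncomputable def toLin (f : MvPolynomial (Fin n) ℂ) : (Fin n → ℂ) →ₗ[ℂ] ℂ :=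
  ∑ i, f.coeff (Finsupp.single i 1) • LinearMap.proj i

/-- The hyperplane `ker lᵢ ⊆ ℂⁿ`. -/
noncomputable def hyp (l : ι → MvPolynomial (Fin n) ℂ) (i : ι) : Submodule ℂ (Fin n → ℂ) :=
  LinearMap.ker (toLin (l i))

open Classical in
/-- The intersection lattice `L(A)`: all intersections of nonempty subfamilies. -/
noncomputable def LA (l : ι → MvPolynomial (Fin n) ℂ) : Finset (Submodule ℂ (Fin n → ℂ)) :=
  (Finset.univ.powerset.filter Finset.Nonempty).image fun I : Finset ι => ⨅ i ∈ I, hyp l i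

open Classical in
/-- `J(X) = {i : X ⊆ ker lᵢ}`. -/
noncomputable def JX (l : ι → MvPolynomial (Fin n) ℂ) (Y : Submodule ℂ (Fin n → ℂ)) :
    Finset ι :=
  Finset.univ.filter fun i => Y ≤ hyp l i

/-- `r(X) = n - dim X`, the codimension. -/
noncomputable def rX (Y : Submodule ℂ (Fin n → ℂ)) : ℕ :=
  n - Module.finrank ℂ Y

/-- Irreducibility of the subarrangement with hyperplanes indexed by `J`. -/
def IrredOn (l : ι → MvPolynomial (Fin n) ℂ) (J : Finset ι) : Prop :=
  ¬ ∃ V₁ V₂ : Submodule ℂ (Fin n → ℂ), IsCompl V₁ V₂ ∧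
      (∀ i ∈ J, V₁ ≤ hyp l i ∨ V₂ ≤ hyp l i) ∧
      (∃ i ∈ J, V₁ ≤ hyp l i) ∧ (∃ i ∈ J, V₂ ≤ hyp l i)

open Classical in
/-- `L'(A) = {X ∈ L(A) : A_X irreducible}`. -/
noncomputable def Lprime (l : ι → MvPolynomial (Fin n) ℂ) :
    Finset (Submodule ℂ (Fin n → ℂ)) :=
  (LA l).filter fun Y => IrredOn l (JX l Y)

/-- The polynomial
`b_A = ∏_{X ∈ L'(A)} ∏_{j=0}^{2(card J(X) − r(X))} ((∑_{i ∈ J(X)} sᵢ) + r(X) + j)`. -/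
noncomputable def bGen (l : ι → MvPolynomial (Fin n) ℂ) : MvPolynomial ι ℂ :=
  ∏ Y ∈ Lprime l, ∏ j ∈ Finset.range (2 * ((JX l Y).card - rX (n := n) Y) + 1),
    ((∑ i ∈ JX l Y, X i) + C ((rX (n := n) Y : ℂ) + (j : ℂ)))

end Arrangement

namespace Arrangement

section
variable {σ R : Type} [CommRing R] (w : σ → ℕ)

theorem sum_range_weightedHomogeneousComponent (p : MvPolynomial σ R) :
    ∃ N, ∀ M ≥ N, p = ∑ d ∈ Finset.range M, weightedHomogeneousComponent w d p := by
  have h : (Function.support fun m => weightedHomogeneousComponent w m p).Finite :=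
    weightedHomogeneousComponent_finsupp p
  obtain ⟨N, hN⟩ := h.bddAbove
  refine ⟨N + 1, fun M hM => ?_⟩
  conv_lhs => rw [← sum_weightedHomogeneousComponent (w := w) p]
  refine finsum_eq_sum_of_support_subset _ fun d hd => ?_
  have := hN hd
  simp only [Finset.coe_range, Set.mem_Iio]
  omega

theorem mem_of_weightedHomogeneousComponent_mem {I : Submodule R (MvPolynomial σ R)}
    {p : MvPolynomial σ R} (h : ∀ d, weightedHomogeneousComponent w d p ∈ I) : p ∈ I := by
  obtain ⟨N, hN⟩ := sum_range_weightedHomogeneousComponent w p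
  rw [hN N le_rfl]
  exact Submodule.sum_mem _ fun d _ => h d

theorem weightedHomogeneousComponent_mul_of_isWeightedHomogeneous (p : MvPolynomial σ R)
    {g : MvPolynomial σ R} {e : ℕ} (hg : IsWeightedHomogeneous w g e) (d : ℕ) :
    weightedHomogeneousComponent w d (p * g) =
      if e ≤ d then weightedHomogeneousComponent w (d - e) p * g else 0 := by
  induction p using MvPolynomial.induction_on' with
  | monomial a b =>
    have hm : IsWeightedHomogeneous w (monomial a b) (Finsupp.weight w a) :=
      isWeightedHomogeneous_monomial w a b rfl
    have hmg := hm.mul hg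
    by_cases h : d = Finsupp.weight w a + e
    · rw [h, hmg.weightedHomogeneousComponent_same, if_pos (by omega), Nat.add_sub_cancel,
        hm.weightedHomogeneousComponent_same]
    · rw [hmg.weightedHomogeneousComponent_ne _ h]
      split_ifs with h'
      · rw [hm.weightedHomogeneousComponent_ne _ (by omega), zero_mul]
      · rfl
  | add p q hp hq =>
    rw [add_mul, map_add, hp, hq]
    split_ifs
    · rw [map_add, add_mul]
    · simp

/-- The property of containing the homogeneous components of one's elements. -/
def HasComponents (I : Ideal (MvPolynomial σ R)) : Prop :=
  ∀ p ∈ I, ∀ d, weightedHomogeneousComponent w d p ∈ I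

theorem hasComponents_span {s : Set (MvPolynomial σ R)}
    (hs : ∀ g ∈ s, ∃ e, IsWeightedHomogeneous w g e) : HasComponents w (Ideal.span s) := by
  intro p hp d
  induction hp using Submodule.span_induction generalizing d with
  | mem g hg =>
    obtain ⟨e, he⟩ := hs g hg
    by_cases h : d = e
    · rw [h, he.weightedHomogeneousComponent_same]
      exact Ideal.subset_span hg
    · rw [he.weightedHomogeneousComponent_ne _ h]
      exact zero_mem _
  | zero => simp
  | add x y _ _ hx hy => rw [map_add]; exact add_mem (hx d) (hy d)
  | smul a x _ hx =>
    obtain ⟨N, hN⟩ := sum_range_weightedHomogeneousComponent w a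
    rw [hN N le_rfl, Finset.sum_smul, map_sum]
    refine sum_mem fun i _ => ?_
    rw [smul_eq_mul, mul_comm, weightedHomogeneousComponent_mul_of_isWeightedHomogeneous w x
      (weightedHomogeneousComponent_isWeightedHomogeneous i a)]
    split_ifs
    · exact Ideal.mul_mem_right _ _ (hx _)
    · exact zero_mem _

theorem weightedHomogeneousComponent_zero_eq_C (hw : ∀ i, w i ≠ 0) (u : MvPolynomial σ R) :
    weightedHomogeneousComponent w 0 u = C (coeff 0 u) := by
  rw [weightedHomogeneousComponent_zero (w := w) u hw]

/-- An ideal with homogeneous components for positive weights is contracted from the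
localization at the origin. -/
theorem HasComponents.mem_of_mul_mem {K : Type} [Field K] {I : Ideal (MvPolynomial σ K)}
    (hI : HasComponents w I) (hw : ∀ i, w i ≠ 0) {u v : MvPolynomial σ K}
    (hu : coeff 0 u ≠ 0) (huv : u * v ∈ I) : v ∈ I := by
  refine mem_of_weightedHomogeneousComponent_mem w (I := I.restrictScalars K) fun d => ?_
  rw [Submodule.restrictScalars_mem]
  induction d using Nat.strong_induction_on with
  | _ d ih =>
    have h1 := hI _ huv d
    obtain ⟨N, hN⟩ := sum_range_weightedHomogeneousComponent w v
    have h0 : weightedHomogeneousComponent w d (u * v) = ∑ j ∈ Finset.range (N + d + 1),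
        weightedHomogeneousComponent w d (u * weightedHomogeneousComponent w j v) := by
      conv_lhs => rw [hN (N + d + 1) (by omega)]
      rw [Finset.mul_sum, map_sum]
    have h2 : weightedHomogeneousComponent w d (u * v) - C (coeff 0 u) *
        weightedHomogeneousComponent w d v ∈ I := by
      rw [h0, ← Finset.add_sum_erase _ _ (a := d) (by simp),
        weightedHomogeneousComponent_mul_of_isWeightedHomogeneous w u
        (weightedHomogeneousComponent_isWeightedHomogeneous d v), if_pos le_rfl, Nat.sub_self,
        weightedHomogeneousComponent_zero_eq_C w hw, add_sub_cancel_left]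
      refine sum_mem fun j hj => ?_
      rw [weightedHomogeneousComponent_mul_of_isWeightedHomogeneous w u
        (weightedHomogeneousComponent_isWeightedHomogeneous j v)]
      split_ifs with h
      · refine Ideal.mul_mem_left _ _ (ih j ?_)
        have := Finset.ne_of_mem_erase hj
        omega
      · exact zero_mem _
    have h3 : C (coeff 0 u) * weightedHomogeneousComponent w d v ∈ I := by
      have := sub_mem h1 h2
      rwa [sub_sub_cancel] at this
    have h4 := Ideal.mul_mem_left I (C (coeff 0 u)⁻¹) h3
    rwa [← mul_assoc, ← C_mul, inv_mul_cancel₀ hu, C_1, one_mul] at h4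

end

section
open RingTheory.Sequence Ideal CategoryTheory Abelian Limits Pointwise IsSMulRegular

/-- Vanishing of `Ext^i(A/a, M)` for `i < d`. -/
def ExtVanish {A : Type} [CommRing A] (a : Ideal A) (M : Type) [AddCommGroup M] [Module A M]
    (d : ℕ) : Prop :=
  ∀ i < d, Subsingleton (Ext (ModuleCat.of A (A ⧸ a)) (ModuleCat.of A M) i)

section
variable {A : Type} [CommRing A] {a : Ideal A} {M : Type} [AddCommGroup M] [Module A M] {d : ℕ}

theorem ExtVanish.eq_zero (h : ExtVanish a M (d + 1)) {v : M} (hv : ∀ x ∈ a, x • v = 0) :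
    v = 0 := by
  have h0 := h 0 (Nat.succ_pos d)
  have h1 : Subsingleton (ModuleCat.of A (A ⧸ a) ⟶ ModuleCat.of A M) :=
    Ext.addEquiv₀.subsingleton_congr.mp h0
  have h2 : Subsingleton ((A ⧸ a) →ₗ[A] M) := (ModuleCat.homAddEquiv
    (M := ModuleCat.of A (A ⧸ a)) (N := ModuleCat.of A M)).symm.subsingleton
  have h3 : a ≤ LinearMap.ker (LinearMap.toSpanSingleton A M v) := fun x hx => by
    simpa using hv x hx
  have := LinearMap.congr_fun (Subsingleton.elim (Submodule.liftQ a _ h3) 0)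
    (Submodule.Quotient.mk 1)
  rw [Submodule.liftQ_apply] at this
  simpa using this

theorem ExtVanish.quotSMulTop (h : ExtVanish a M (d + 1)) {x : A} (hx : IsSMulRegular M x) :
    ExtVanish a (QuotSMulTop x M) d := by
  intro i hi
  have zero1 := AddCommGrpCat.isZero_of_iff_subsingleton.mpr (h i (by omega))
  have zero2 := AddCommGrpCat.isZero_of_iff_subsingleton.mpr (h (i + 1) (by omega))
  have hx' : IsSMulRegular (ModuleCat.of A M) x := hx
  exact AddCommGrpCat.subsingleton_of_isZero <| ShortComplex.Exact.isZero_of_both_zeros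
    ((Ext.covariant_sequence_exact₃' (ModuleCat.of A (A ⧸ a)) hx'.smulShortComplex_shortExact)
      i (i + 1) rfl)
    (zero1.eq_zero_of_src _) (zero2.eq_zero_of_tgt _)

theorem ExtVanish.mono (h : ExtVanish a M d) {e : ℕ} (he : e ≤ d) : ExtVanish a M e :=
  fun i hi => h i (hi.trans_le he)

end

section
variable {A : Type} [CommRing A] [IsLocalRing A] [IsNoetherianRing A] {a : Ideal A}
  {M : Type} [AddCommGroup M] [Module A M] [Module.Finite A M] {d : ℕ}

theorem smul_top_lt_top [Nontrivial M] (ha : a ≤ IsLocalRing.maximalIdeal A) :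
    a • (⊤ : Submodule A M) < ⊤ := by
  refine lt_top_iff_ne_top.mpr (Ne.symm ?_)
  refine Submodule.top_ne_ideal_smul_of_le_jacobson_annihilator ?_
  exact ha.trans (IsLocalRing.maximalIdeal_le_jacobson _)

theorem extVanish_iff [Nontrivial M] (ha : a ≤ IsLocalRing.maximalIdeal A) :
    ExtVanish a M d ↔ ∃ rs : List A, rs.length = d ∧ (∀ r ∈ rs, r ∈ a) ∧ IsRegular M rs := by
  have suppQ : Module.support A (A ⧸ a) = PrimeSpectrum.zeroLocus a := by
    rw [Module.support_eq_zeroLocus, annihilator_quotient]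
  constructor
  · intro h
    exact ModuleCat.exists_isRegular_of_exists_subsingleton_ext a d (ModuleCat.of A M)
      (smul_top_lt_top ha) (ModuleCat.of A (A ⧸ a)) suppQ h
  · rintro ⟨rs, rfl, mem, reg⟩
    exact ModuleCat.subsingleton_ext_of_exists_isRegular a (ModuleCat.of A (A ⧸ a)) suppQ.subset
      (ModuleCat.of A M) (smul_top_lt_top ha) rs mem reg

theorem nontrivial_quotSMulTop [Nontrivial M] {x : A} (hx : x ∈ IsLocalRing.maximalIdeal A) :
    Nontrivial (QuotSMulTop x M) := by
  have h : (Ideal.span {x}) • (⊤ : Submodule A M) < ⊤ :=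
    smul_top_lt_top ((Ideal.span_singleton_le_iff_mem _).mpr hx)
  rw [Submodule.ideal_span_singleton_smul] at h
  exact Submodule.Quotient.nontrivial_iff.mpr h.ne

theorem ExtVanish.of_quotSMulTop [Nontrivial M] (ha : a ≤ IsLocalRing.maximalIdeal A) {x : A}
    (hxa : x ∈ a) (hx : IsSMulRegular M x) (h : ExtVanish a (QuotSMulTop x M) d) :
    ExtVanish a M (d + 1) := by
  have := nontrivial_quotSMulTop (M := M) (ha hxa)
  obtain ⟨rs, hl, hm, hr⟩ := (extVanish_iff ha).mp h
  exact (extVanish_iff ha).mpr ⟨x :: rs, by simp [hl], by simpa [hxa] using hm,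
    (isRegular_cons_iff M x rs).mpr ⟨hx, hr⟩⟩

/-- Adding one element of the maximal ideal raises the grade by at most one. -/
theorem ExtVanish.of_sup_span_singleton (ha : a ≤ IsLocalRing.maximalIdeal A) {h : A}
    (hh : h ∈ IsLocalRing.maximalIdeal A) [Nontrivial M]
    (H : ExtVanish (a ⊔ Ideal.span {h}) M (d + 1)) : ExtVanish a M d := by
  have hah : a ⊔ Ideal.span {h} ≤ IsLocalRing.maximalIdeal A :=
    sup_le ha ((Ideal.span_singleton_le_iff_mem _).mpr hh)
  induction d generalizing M with
  | zero => intro i hi; omega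
  | succ d ih =>
    -- the submodule killed by `a` vanishes
    let N : Submodule A M := ⨅ x ∈ a, LinearMap.ker (LinearMap.lsmul A M x)
    have hN : ∀ v, v ∈ N ↔ ∀ x ∈ a, x • v = 0 := fun v => by simp [N]
    obtain ⟨rs, hl, hm, hr⟩ := (extVanish_iff hah).mp H
    obtain ⟨x, rs', rfl⟩ : ∃ x rs', rs = x :: rs' := by
      cases rs with
      | nil => simp at hl
      | cons x t => exact ⟨x, t, rfl⟩
    have hx : IsSMulRegular M x := ((isRegular_cons_iff M x rs').mp hr).1
    have hxm : x ∈ a ⊔ Ideal.span {h} := hm x (by simp)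
    have Hx : ExtVanish (a ⊔ Ideal.span {h}) (QuotSMulTop x M) (d + 1) := H.quotSMulTop hx
    obtain ⟨α, hα, y, hy, hxe⟩ := Submodule.mem_sup.mp hxm
    obtain ⟨c, rfl⟩ := Ideal.mem_span_singleton'.mp hy
    have key : N ≤ (Ideal.span {h}) • N := by
      intro v hv
      rw [hN] at hv
      have hxv : x • v = h • (c • v) := by
        rw [← hxe, add_smul, hv α hα, zero_add, mul_comm, mul_smul]
      have hcv : (Submodule.Quotient.mk (c • v) : QuotSMulTop x M) = 0 := by
        refine Hx.eq_zero ?_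
        intro z hz
        obtain ⟨β, hβ, w, hw, rfl⟩ := Submodule.mem_sup.mp hz
        obtain ⟨e, rfl⟩ := Ideal.mem_span_singleton'.mp hw
        rw [← Submodule.Quotient.mk_smul, Submodule.Quotient.mk_eq_zero, add_smul,
          smul_comm β c, hv β hβ, smul_zero, zero_add, mul_smul, ← hxv]
        exact Submodule.smul_mem _ _ (Submodule.smul_mem_pointwise_smul _ _ _ trivial)
      rw [Submodule.Quotient.mk_eq_zero] at hcv
      obtain ⟨u, -, hu⟩ := Submodule.mem_smul_pointwise_iff_exists _ _ _ |>.mp hcv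
      have huN : u ∈ N := by
        rw [hN]
        intro β hβ
        apply hx
        change x • β • u = x • (0 : M)
        rw [smul_comm, hu, smul_comm, hv β hβ]; simp
      have : v = h • u := by
        apply hx
        change x • v = x • h • u
        rw [hxv, ← hu, smul_comm]
      rw [this]
      exact Submodule.smul_mem_smul (Ideal.mem_span_singleton_self h) huN
    have hN0 : N = ⊥ := Submodule.eq_bot_of_le_smul_of_le_jacobson_bot _ N
      (IsNoetherian.noetherian N) key
      (((Ideal.span_singleton_le_iff_mem _).mpr hh).trans (IsLocalRing.maximalIdeal_le_jacobson _))
    have h1 : ExtVanish a M 1 := by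
      intro i hi
      obtain rfl : i = 0 := by omega
      have : Subsingleton ((A ⧸ a) →ₗ[A] M) := by
        refine ⟨fun f g => ?_⟩
        rw [← sub_eq_zero]
        apply Submodule.linearMap_qext
        apply LinearMap.ext_ring
        have : (f - g) (Submodule.Quotient.mk 1) ∈ N := by
          rw [hN]
          intro z hz
          rw [← map_smul, ← Submodule.Quotient.mk_smul, smul_eq_mul, mul_one,
            (Submodule.Quotient.mk_eq_zero a).mpr hz, map_zero]
        rw [hN0] at this
        simpa using this
      exact (Ext.addEquiv₀.trans ModuleCat.homAddEquiv).subsingleton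
    obtain ⟨fs, hfl, hfm, hfr⟩ := (extVanish_iff ha).mp h1
    obtain ⟨f, rfl⟩ := List.length_eq_one_iff.mp hfl
    have hf : IsSMulRegular M f := ((isRegular_cons_iff M f []).mp hfr).1
    have hfa : f ∈ a := hfm f (by simp)
    have := nontrivial_quotSMulTop (M := M) (ha hfa)
    exact (ih (M := QuotSMulTop f M) (H.quotSMulTop hf)).of_quotSMulTop ha hfa hf

end

/-- If `g` is `M`-regular and `a` has large grade then nothing outside `g M` is sent by `a`
into `g M`. -/
theorem ExtVanish.mem_smul_top {A : Type} [CommRing A] {a : Ideal A} {M : Type} [AddCommGroup M]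
    [Module A M] (rs : List A) (hr : IsWeaklyRegular M rs) {d : ℕ} (hd : rs.length < d)
    (h : ExtVanish a M d) (v : M)
    (hv : ∀ x ∈ a, x • v ∈ Ideal.ofList rs • (⊤ : Submodule A M)) :
    v ∈ Ideal.ofList rs • (⊤ : Submodule A M) := by
  induction rs generalizing M d with
  | nil =>
    simp only [Ideal.ofList_nil, Submodule.bot_smul, Submodule.mem_bot] at hv ⊢
    obtain ⟨d, rfl⟩ : ∃ e, d = e + 1 := ⟨d - 1, by simp at hd; omega⟩
    exact h.eq_zero hv
  | cons r rs ih =>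
    obtain ⟨d, rfl⟩ : ∃ e, d = e + 1 := ⟨d - 1, by simp at hd; omega⟩
    rw [isWeaklyRegular_cons_iff] at hr
    have hmem : ∀ w : M, w ∈ Ideal.ofList (r :: rs) • (⊤ : Submodule A M) ↔
        (Submodule.Quotient.mk w : QuotSMulTop r M) ∈
          Ideal.ofList rs • (⊤ : Submodule A (QuotSMulTop r M)) := by
      intro w
      have e1 : Submodule.comap (Submodule.mkQ (r • (⊤ : Submodule A M)))
          (Ideal.ofList rs • (⊤ : Submodule A (QuotSMulTop r M))) =
          Ideal.ofList (r :: rs) • (⊤ : Submodule A M) := by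
        rw [Submodule.comap_smul_top_of_surjective _ _ (Submodule.mkQ_surjective _),
          Submodule.ker_mkQ, Ideal.ofList_cons_smul, sup_comm]
      rw [← e1]; rfl
    rw [hmem]
    refine ih hr.2 (d := d) (by simpa using hd) (h.quotSMulTop hr.1) _ ?_
    intro x hx
    rw [← Submodule.Quotient.mk_smul, ← hmem]
    exact hv x hx

end

section
open RingTheory.Sequence

section
variable {σ : Type} [Fintype σ]

/-- The maximal ideal of the origin. -/
noncomputable def originIdeal (σ : Type) : Ideal (MvPolynomial σ ℂ) :=
  RingHom.ker (constantCoeff : MvPolynomial σ ℂ →+* ℂ)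

theorem mem_originIdeal {p : MvPolynomial σ ℂ} : p ∈ originIdeal σ ↔ coeff 0 p = 0 := Iff.rfl

instance : (originIdeal σ).IsMaximal :=
  RingHom.ker_isMaximal_of_surjective _ fun c => ⟨C c, by simp⟩

theorem mem_originIdeal_iff_eval {p : MvPolynomial σ ℂ} :
    p ∈ originIdeal σ ↔ eval 0 p = 0 := by
  rw [mem_originIdeal, ← constantCoeff_eq, ← eval_zero']
  rfl

theorem isWeaklyRegular_map_X (is : List σ) (h : is.Nodup) :
    IsWeaklyRegular (MvPolynomial σ ℂ) (is.map (X : σ → MvPolynomial σ ℂ)) := by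
  constructor
  intro i hi
  rw [isSMulRegular_iff_right_eq_zero_of_smul]
  rw [List.length_map] at hi
  have hI : Ideal.ofList (List.take i (is.map (X : σ → MvPolynomial σ ℂ))) • (⊤ : Submodule (MvPolynomial σ ℂ) (MvPolynomial σ ℂ)) =
      Ideal.span (X '' {j | j ∈ is.take i}) := by
    rw [smul_eq_mul, Ideal.mul_top, Ideal.ofList, ← List.map_take]
    congr 1
    ext x
    rw [Set.mem_ofPred_eq, List.mem_map]
    rfl
  intro v hv
  obtain ⟨v, rfl⟩ := Submodule.Quotient.mk_surjective _ v
  rw [← Submodule.Quotient.mk_smul, Submodule.Quotient.mk_eq_zero, hI,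
    mem_ideal_span_X_image] at hv
  rw [Submodule.Quotient.mk_eq_zero, hI, mem_ideal_span_X_image]
  intro m hm
  have hm' : Finsupp.single is[i] 1 + m ∈ ((is.map X)[i] • v).support := by
    rw [List.getElem_map, smul_eq_mul, mem_support_iff, coeff_X_mul]
    exact mem_support_iff.mp hm
  obtain ⟨j, hj, hj'⟩ := hv _ hm'
  refine ⟨j, hj, ?_⟩
  have hne : is[i] ≠ j := by
    rintro rfl
    obtain ⟨k, hk, hk'⟩ := List.getElem_of_mem hj
    rw [List.getElem_take] at hk'
    rw [List.length_take] at hk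
    have := (List.Nodup.getElem_inj_iff h).mp hk'
    omega
  simpa [Finsupp.single_apply, hne] using hj'

/-- The local ring at the origin. -/
abbrev OriginLoc (σ : Type) [Fintype σ] := Localization.AtPrime (originIdeal σ)

theorem exists_isRegular_origin :
    ∃ rs : List (OriginLoc σ), rs.length = Fintype.card σ ∧
      (∀ r ∈ rs, r ∈ IsLocalRing.maximalIdeal (OriginLoc σ)) ∧ IsRegular (OriginLoc σ) rs := by
  have hm : ∀ i : σ, (X i : MvPolynomial σ ℂ) ∈ originIdeal σ := fun i => by
    rw [mem_originIdeal_iff_eval]; simp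
  refine ⟨((Finset.univ.toList : List σ).map (X : σ → MvPolynomial σ ℂ)).map (algebraMap _ (OriginLoc σ)), by simp, ?_, ?_⟩
  · intro r hr
    simp only [List.mem_map, Finset.mem_toList, Finset.mem_univ, true_and] at hr
    obtain ⟨_, ⟨i, rfl⟩, rfl⟩ := hr
    rw [← Localization.AtPrime.map_eq_maximalIdeal]
    exact Ideal.mem_map_of_mem _ (hm i)
  · refine IsWeaklyRegular.isRegular_of_isLocalization_of_mem (OriginLoc σ) (originIdeal σ)
      (isWeaklyRegular_map_X _ (Finset.nodup_toList _)) ?_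
    intro r hr
    obtain ⟨i, -, rfl⟩ := List.mem_map.mp hr
    exact hm i

theorem extVanish_of_le_radical {I : Ideal (MvPolynomial σ ℂ)} (h : originIdeal σ ≤ I.radical) :
    ExtVanish (I.map (algebraMap _ (OriginLoc σ))) (OriginLoc σ) (Fintype.card σ) := by
  obtain ⟨rs, hl, hm, hr⟩ := exists_isRegular_origin (σ := σ)
  rw [← hl]
  have key : IsLocalRing.maximalIdeal (OriginLoc σ) ≤
      (I.map (algebraMap _ (OriginLoc σ))).radical := by
    rw [← Localization.AtPrime.map_eq_maximalIdeal]
    exact (Ideal.map_mono h).trans (Ideal.map_radical_le _)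
  refine ModuleCat.subsingleton_ext_of_exists_isRegular (IsLocalRing.maximalIdeal (OriginLoc σ))
    (ModuleCat.of _ _) ?_ (ModuleCat.of _ (OriginLoc σ)) (smul_top_lt_top le_rfl) rs hm hr
  change Module.support _ (OriginLoc σ ⧸ (I.map (algebraMap _ (OriginLoc σ)))) ⊆ _
  rw [Module.support_eq_zeroLocus, Ideal.annihilator_quotient,
    PrimeSpectrum.zeroLocus_subset_zeroLocus_iff]
  exact key

theorem originIdeal_le_radical {I : Ideal (MvPolynomial σ ℂ)}
    (h : ∀ z : σ → ℂ, (∀ p ∈ I, eval z p = 0) → z = 0) : originIdeal σ ≤ I.radical := by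
  rw [← vanishingIdeal_zeroLocus_eq_radical (K := ℂ)]
  intro p hp z hz
  have : z = 0 := h z fun q hq => by simpa [aeval_eq_eval] using hz q hq
  subst this
  simpa [aeval_eq_eval] using mem_originIdeal_iff_eval.mp hp

theorem ExtVanish.of_sup_ofList {A : Type} [CommRing A] [IsLocalRing A] [IsNoetherianRing A]
    {a : Ideal A} (ha : a ≤ IsLocalRing.maximalIdeal A) (hs : List A)
    (hhs : ∀ h ∈ hs, h ∈ IsLocalRing.maximalIdeal A) {d : ℕ}
    (H : ExtVanish (a ⊔ Ideal.ofList hs) A (d + hs.length)) : ExtVanish a A d := by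
  induction hs generalizing a d with
  | nil => simpa using H
  | cons h hs ih =>
    have h1 : a ⊔ Ideal.span {h} ≤ IsLocalRing.maximalIdeal A :=
      sup_le ha ((Ideal.span_singleton_le_iff_mem _).mpr (hhs h (by simp)))
    refine ExtVanish.of_sup_span_singleton ha (hhs h (by simp)) ?_
    refine ih h1 (fun x hx => hhs x (by simp [hx])) ?_
    rw [sup_assoc, ← Ideal.ofList_cons]
    refine H.mono ?_
    simp; omega

/-- Grade estimate at the origin from a zero locus. -/
theorem extVanish_of_zeros {I : Ideal (MvPolynomial σ ℂ)} (hI : I ≤ originIdeal σ)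
    (hs : List (MvPolynomial σ ℂ)) (hhs : ∀ h ∈ hs, eval 0 h = 0)
    (h : ∀ z : σ → ℂ, (∀ p ∈ I, eval z p = 0) → (∀ p ∈ hs, eval z p = 0) → z = 0) {d : ℕ}
    (hd : d + hs.length ≤ Fintype.card σ) :
    ExtVanish (I.map (algebraMap _ (OriginLoc σ))) (OriginLoc σ) d := by
  refine ExtVanish.of_sup_ofList (hs := hs.map (algebraMap _ (OriginLoc σ))) ?_ ?_ ?_
  · rw [← Localization.AtPrime.map_eq_maximalIdeal]
    exact Ideal.map_mono hI
  · intro x hx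
    obtain ⟨y, hy, rfl⟩ := List.mem_map.mp hx
    rw [← Localization.AtPrime.map_eq_maximalIdeal]
    exact Ideal.mem_map_of_mem _ (mem_originIdeal_iff_eval.mpr (hhs y hy))
  · rw [← Ideal.map_ofList, ← Ideal.map_sup, List.length_map]
    refine (extVanish_of_le_radical (originIdeal_le_radical fun z hz => ?_)).mono hd
    exact h z (fun p hp => hz p (Ideal.mem_sup_left hp))
      fun p hp => hz p (Ideal.mem_sup_right (Ideal.subset_span hp))

theorem mem_of_algebraMap_mem {I : Ideal (MvPolynomial σ ℂ)} {w : σ → ℕ} (hw : ∀ i, w i ≠ 0)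
    (hI : HasComponents w I) {v : MvPolynomial σ ℂ}
    (hv : algebraMap _ (OriginLoc σ) v ∈ I.map (algebraMap _ (OriginLoc σ))) : v ∈ I := by
  obtain ⟨u, hu, huv⟩ := (IsLocalization.algebraMap_mem_map_algebraMap_iff
    (originIdeal σ).primeCompl _ _ _).mp hv
  exact hI.mem_of_mul_mem w hw (u := u) hu huv

/-- A homogeneous system of parameters is a regular sequence, locally at the origin. -/
theorem isWeaklyRegular_of_zeros (gs hs : List (MvPolynomial σ ℂ))
    (hgs : ∀ g ∈ gs, eval 0 g = 0) (hhs : ∀ h ∈ hs, eval 0 h = 0)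
    (h : ∀ z : σ → ℂ, (∀ p ∈ gs, eval z p = 0) → (∀ p ∈ hs, eval z p = 0) → z = 0)
    (hd : gs.length + hs.length = Fintype.card σ) :
    IsWeaklyRegular (OriginLoc σ) (gs.map (algebraMap _ (OriginLoc σ))) := by
  induction gs using List.reverseRecOn generalizing hs with
  | nil => simp
  | append_singleton gs b ih =>
    have h1 := ih (b :: hs) (fun g hg => hgs g (by simp [hg]))
      (List.forall_mem_cons.mpr ⟨hgs b (by simp), hhs⟩) (fun z h1 h2 => h z
        (by
          intro p hp
          rcases List.mem_append.mp hp with hp | hp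
          · exact h1 p hp
          · exact h2 p (by simp at hp; simp [hp]))
        fun p hp => h2 p (by simp [hp])) (by simp at hd ⊢; omega)
    rw [List.map_append, isWeaklyRegular_append_iff, List.map_singleton,
      isWeaklyRegular_singleton_iff]
    refine ⟨h1, ?_⟩
    have hE : ExtVanish ((Ideal.ofList (gs ++ [b])).map (algebraMap _ (OriginLoc σ)))
        (OriginLoc σ) (gs.length + 1) := by
      refine extVanish_of_zeros ?_ hs hhs (fun z h1 h2 => h z (fun p hp => h1 p
        (Ideal.subset_span hp)) h2) (by simp at hd ⊢; omega)
      exact Ideal.span_le.mpr fun g hg => mem_originIdeal_iff_eval.mpr (hgs g hg)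
    rw [isSMulRegular_iff_right_eq_zero_of_smul]
    intro v hv
    obtain ⟨v, rfl⟩ := Submodule.Quotient.mk_surjective _ v
    rw [← Submodule.Quotient.mk_smul, Submodule.Quotient.mk_eq_zero] at hv
    rw [Submodule.Quotient.mk_eq_zero]
    refine hE.mem_smul_top _ h1 (by simp) v ?_
    intro x hx
    rw [Ideal.map_ofList, List.map_append, Ideal.ofList_append] at hx
    obtain ⟨y, hy, z, hz, rfl⟩ := Submodule.mem_sup.mp hx
    rw [List.map_singleton, Ideal.ofList_singleton] at hz
    obtain ⟨c, rfl⟩ := Ideal.mem_span_singleton'.mp hz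
    rw [add_smul, mul_smul]
    exact add_mem (Submodule.smul_mem_smul hy trivial) (Submodule.smul_mem _ _ hv)

/-- If a homogeneous ideal generated by part of a system of parameters contains `x v` for all `x`
in an ideal of larger grade, then it contains `v`. -/
theorem mem_ofList_of_zeros {w : σ → ℕ} (hw : ∀ i, w i ≠ 0) (gs hs : List (MvPolynomial σ ℂ))
    (hgw : ∀ g ∈ gs, ∃ e, IsWeightedHomogeneous w g e)
    (hgs : ∀ g ∈ gs, eval 0 g = 0) (hhs : ∀ h ∈ hs, eval 0 h = 0)
    (h : ∀ z : σ → ℂ, (∀ p ∈ gs, eval z p = 0) → (∀ p ∈ hs, eval z p = 0) → z = 0)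
    (hd : gs.length + hs.length = Fintype.card σ)
    (I : Ideal (MvPolynomial σ ℂ)) (hs' : List (MvPolynomial σ ℂ))
    (hhs' : ∀ h ∈ hs', eval 0 h = 0)
    (h' : ∀ z : σ → ℂ, (∀ p ∈ I, eval z p = 0) → (∀ p ∈ hs', eval z p = 0) → z = 0)
    (hd' : gs.length + hs'.length < Fintype.card σ) (v : MvPolynomial σ ℂ)
    (hv : ∀ x ∈ I, x * v ∈ Ideal.ofList gs) : v ∈ Ideal.ofList gs := by
  refine mem_of_algebraMap_mem hw (hasComponents_span w hgw) ?_
  have hv' : ∀ x ∈ I.map (algebraMap _ (OriginLoc σ)), x * algebraMap _ (OriginLoc σ) v ∈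
      (Ideal.ofList gs).map (algebraMap _ (OriginLoc σ)) := by
    intro x hx
    induction hx using Submodule.span_induction with
    | mem x hx =>
      obtain ⟨y, hy, rfl⟩ := hx
      rw [← map_mul]
      exact Ideal.mem_map_of_mem _ (hv y hy)
    | zero => simp
    | add x y _ _ hx hy => rw [add_mul]; exact add_mem hx hy
    | smul a x _ hx => rw [smul_eq_mul, mul_assoc]; exact Ideal.mul_mem_left _ _ hx
  by_cases hI : I ≤ originIdeal σ
  · have hE := extVanish_of_zeros hI hs' hhs' h' (d := gs.length + 1) (by omega)
    have h1 := isWeaklyRegular_of_zeros gs hs hgs hhs h hd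
    have := hE.mem_smul_top _ h1 (by simp) (algebraMap _ (OriginLoc σ) v) (by
      intro x hx
      rw [← Ideal.map_ofList, smul_eq_mul, Ideal.mul_top]
      exact hv' x hx)
    rw [← Ideal.map_ofList, smul_eq_mul, Ideal.mul_top] at this
    exact this
  · obtain ⟨x, hx, hx'⟩ := Set.not_subset.mp hI
    have hu : IsUnit (algebraMap _ (OriginLoc σ) x) :=
      IsLocalization.map_units (OriginLoc σ) (⟨x, hx'⟩ : (originIdeal σ).primeCompl)
    have := hv' _ (Ideal.mem_map_of_mem _ hx)
    exact (Ideal.unit_mul_mem_iff_mem _ hu).mp this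

/-- Part of a homogeneous system of parameters is a regular sequence. -/
theorem mem_ofList_of_mul_mem {w : σ → ℕ} (hw : ∀ i, w i ≠ 0) (gs hs : List (MvPolynomial σ ℂ))
    (b : MvPolynomial σ ℂ)
    (hgw : ∀ g ∈ gs, ∃ e, IsWeightedHomogeneous w g e)
    (hgs : ∀ g ∈ gs, eval 0 g = 0) (hb : eval 0 b = 0) (hhs : ∀ h ∈ hs, eval 0 h = 0)
    (h : ∀ z : σ → ℂ, (∀ p ∈ gs, eval z p = 0) → eval z b = 0 → (∀ p ∈ hs, eval z p = 0) → z = 0)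
    (hd : gs.length + 1 + hs.length = Fintype.card σ) (v : MvPolynomial σ ℂ)
    (hv : b * v ∈ Ideal.ofList gs) : v ∈ Ideal.ofList gs := by
  refine mem_ofList_of_zeros hw gs (b :: hs) hgw hgs (List.forall_mem_cons.mpr ⟨hb, hhs⟩)
    (fun z h1 h2 => h z h1 (h2 b (by simp)) fun p hp => h2 p (by simp [hp]))
    (by simp; omega) (Ideal.ofList (gs ++ [b])) hs hhs
    (fun z h1 h2 => h z (fun p hp => h1 p (Ideal.subset_span (by simp [hp])))
      (h1 b (Ideal.subset_span (by simp))) h2) (by omega) v ?_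
  intro x hx
  rw [Ideal.ofList_append, Ideal.ofList_singleton] at hx
  obtain ⟨y, hy, z, hz, rfl⟩ := Submodule.mem_sup.mp hx
  obtain ⟨c, rfl⟩ := Ideal.mem_span_singleton'.mp hz
  rw [add_mul, mul_assoc]
  exact add_mem (Ideal.mul_mem_right _ _ hy) (Ideal.mul_mem_left _ _ hv)

end

end

section
open RingTheory.Sequence

section
variable {σ : Type} [Fintype σ]

instance (d : ℕ) : Module.Finite ℂ (homogeneousSubmodule σ ℂ d) :=
  Module.Finite.of_fg (homogeneousSubmodule_fg (R := ℂ) (σ := σ) d)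

/-- The homogeneous part of an ideal. -/
noncomputable def homPart (I : Ideal (MvPolynomial σ ℂ)) (d : ℕ) :
    Submodule ℂ (MvPolynomial σ ℂ) :=
  I.restrictScalars ℂ ⊓ homogeneousSubmodule σ ℂ d

instance (I : Ideal (MvPolynomial σ ℂ)) (d : ℕ) : Module.Finite ℂ (homPart I d) :=
  Submodule.finiteDimensional_of_le (S₂ := homogeneousSubmodule σ ℂ d) inf_le_right

theorem homPart_sup_of_lt {I : Ideal (MvPolynomial σ ℂ)}
    (hI : HasComponents (1 : σ → ℕ) I) {g : MvPolynomial σ ℂ} {e : ℕ} (hg : g.IsHomogeneous e)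
    {d : ℕ} (hd : d < e) : homPart (I ⊔ Ideal.span {g}) d = homPart I d := by
  refine le_antisymm (fun f hf => ?_) (inf_le_inf_right _ fun f hf => Ideal.mem_sup_left hf)
  obtain ⟨hf, hfd⟩ := hf
  obtain ⟨y, hy, z, hz, rfl⟩ := Submodule.mem_sup.mp hf
  obtain ⟨p, rfl⟩ := Ideal.mem_span_singleton'.mp hz
  refine ⟨?_, hfd⟩
  have h1 := IsWeightedHomogeneous.weightedHomogeneousComponent_same hfd
  rw [map_add, weightedHomogeneousComponent_mul_of_isWeightedHomogeneous _ p hg,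
    if_neg (by omega), add_zero] at h1
  rw [← h1]
  exact hI _ hy d

theorem homPart_sup_of_le {I : Ideal (MvPolynomial σ ℂ)}
    (hI : HasComponents (1 : σ → ℕ) I) {g : MvPolynomial σ ℂ} {e : ℕ} (hg : g.IsHomogeneous e)
    {d : ℕ} (hd : e ≤ d) : homPart (I ⊔ Ideal.span {g}) d =
      homPart I d ⊔ (homogeneousSubmodule σ ℂ (d - e)).map (LinearMap.mulRight ℂ g) := by
  refine le_antisymm (fun f hf => ?_) (sup_le (inf_le_inf_right _ fun f hf => Ideal.mem_sup_left hf)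
    ?_)
  · obtain ⟨hf, hfd⟩ := hf
    obtain ⟨y, hy, z, hz, rfl⟩ := Submodule.mem_sup.mp hf
    obtain ⟨p, rfl⟩ := Ideal.mem_span_singleton'.mp hz
    have h1 := IsWeightedHomogeneous.weightedHomogeneousComponent_same hfd
    rw [map_add, weightedHomogeneousComponent_mul_of_isWeightedHomogeneous _ p hg,
      if_pos hd] at h1
    rw [← h1]
    refine Submodule.add_mem_sup ⟨hI _ hy d, weightedHomogeneousComponent_mem _ _ _⟩ ⟨_, ?_, rfl⟩
    exact weightedHomogeneousComponent_mem _ _ _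
  · rintro _ ⟨p, hp, rfl⟩
    refine ⟨Ideal.mem_sup_right (Ideal.mul_mem_left _ _ (Ideal.mem_span_singleton_self g)), ?_⟩
    have : (p * g).IsHomogeneous (d - e + e) := IsHomogeneous.mul hp hg
    rwa [Nat.sub_add_cancel hd] at this

theorem homPart_inf_map {I : Ideal (MvPolynomial σ ℂ)}
    {g : MvPolynomial σ ℂ} {e : ℕ} (hg : g.IsHomogeneous e) (hreg : ∀ v, g * v ∈ I → v ∈ I)
    {d : ℕ} (hd : e ≤ d) :
    homPart I d ⊓ (homogeneousSubmodule σ ℂ (d - e)).map (LinearMap.mulRight ℂ g) =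
      (homPart I (d - e)).map (LinearMap.mulRight ℂ g) := by
  refine le_antisymm ?_ ?_
  · rintro _ ⟨h1, p, hp, rfl⟩
    refine ⟨p, ⟨hreg p ?_, hp⟩, rfl⟩
    rw [mul_comm]
    exact h1.1
  · rintro _ ⟨p, ⟨hp, hp'⟩, rfl⟩
    refine ⟨⟨Ideal.mul_mem_right _ _ hp, ?_⟩, p, hp', rfl⟩
    have : (p * g).IsHomogeneous (d - e + e) := IsHomogeneous.mul hp' hg
    rwa [Nat.sub_add_cancel hd] at this

theorem finrank_homPart_sup {I : Ideal (MvPolynomial σ ℂ)}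
    (hI : HasComponents (1 : σ → ℕ) I) {g : MvPolynomial σ ℂ} {e : ℕ} (hg : g.IsHomogeneous e)
    (hg0 : g ≠ 0) (hreg : ∀ v, g * v ∈ I → v ∈ I) {d : ℕ} (hd : e ≤ d) :
    Module.finrank ℂ (homPart (I ⊔ Ideal.span {g}) d) + Module.finrank ℂ (homPart I (d - e)) =
      Module.finrank ℂ (homPart I d) + Module.finrank ℂ (homogeneousSubmodule σ ℂ (d - e)) := by
  have hinj : Function.Injective (LinearMap.mulRight ℂ g) := fun x y h => mul_right_cancel₀ hg0 h
  have hmap : ∀ p : Submodule ℂ (MvPolynomial σ ℂ),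
      Module.finrank ℂ (p.map (LinearMap.mulRight ℂ g)) = Module.finrank ℂ p := fun p =>
    (LinearEquiv.finrank_eq (Submodule.equivMapOfInjective _ hinj p)).symm
  have h1 := Submodule.finrank_sup_add_finrank_inf_eq (homPart I d)
    ((homogeneousSubmodule σ ℂ (d - e)).map (LinearMap.mulRight ℂ g))
  rwa [← homPart_sup_of_le hI hg hd, homPart_inf_map hg hreg hd,
    hmap, hmap]
    at h1

/-- Homogeneous regular sequences with equal degrees have equal Hilbert functions. -/
theorem finrank_homPart_eq (L L' : List (MvPolynomial σ ℂ × ℕ))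
    (hL : L.map Prod.snd = L'.map Prod.snd)
    (h1 : ∀ p ∈ L, p.1.IsHomogeneous p.2 ∧ p.1 ≠ 0)
    (h1' : ∀ p ∈ L', p.1.IsHomogeneous p.2 ∧ p.1 ≠ 0)
    (h2 : ∀ L₁ p L₂, L = L₁ ++ p :: L₂ → ∀ v, p.1 * v ∈ Ideal.ofList (L₁.map Prod.fst) →
      v ∈ Ideal.ofList (L₁.map Prod.fst))
    (h2' : ∀ L₁ p L₂, L' = L₁ ++ p :: L₂ → ∀ v, p.1 * v ∈ Ideal.ofList (L₁.map Prod.fst) →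
      v ∈ Ideal.ofList (L₁.map Prod.fst)) (d : ℕ) :
    Module.finrank ℂ (homPart (Ideal.ofList (L.map Prod.fst)) d) =
      Module.finrank ℂ (homPart (Ideal.ofList (L'.map Prod.fst)) d) := by
  have hcomp : ∀ L : List (MvPolynomial σ ℂ × ℕ), (∀ p ∈ L, p.1.IsHomogeneous p.2 ∧ p.1 ≠ 0) →
      HasComponents (1 : σ → ℕ) (Ideal.ofList (L.map Prod.fst)) := fun L h =>
    hasComponents_span _ fun g hg => by
      obtain ⟨p, hp, rfl⟩ := List.mem_map.mp hg
      exact ⟨_, (h p hp).1⟩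
  induction L using List.reverseRecOn generalizing L' d with
  | nil =>
    obtain rfl : L' = [] := by simpa using hL.symm
    rfl
  | append_singleton L p ih =>
    obtain rfl | ⟨M, p', rfl⟩ := L'.eq_nil_or_concat'
    · simp at hL
    rw [List.map_append, List.map_append] at hL
    obtain ⟨hL, hp⟩ := List.append_inj' hL rfl
    have hp : p.2 = p'.2 := by simpa using hp
    have ih' := ih M hL (fun p hp => h1 p (List.mem_append_left _ hp))
      (fun p hp => h1' p (List.mem_append_left _ hp))
      (fun L₁ q L₂ h => h2 L₁ q (L₂ ++ [p]) (by rw [h]; simp))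
      (fun L₁ q L₂ h => h2' L₁ q (L₂ ++ [p']) (by rw [h]; simp))
    have a1 := h1 p (by simp)
    have a1' := h1' p' (by simp)
    have hc := hcomp L (fun p hp => h1 p (List.mem_append_left _ hp))
    have hc' := hcomp M (fun p hp => h1' p (List.mem_append_left _ hp))
    have hsup : ∀ (K : List (MvPolynomial σ ℂ × ℕ)) q, Ideal.ofList ((K ++ [q]).map Prod.fst) =
        Ideal.ofList (K.map Prod.fst) ⊔ Ideal.span {q.1} := fun K q => by
      rw [List.map_append, Ideal.ofList_append, List.map_singleton, Ideal.ofList_singleton]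
    rw [hsup, hsup]
    rcases lt_or_ge d p.2 with hd | hd
    · rw [homPart_sup_of_lt hc a1.1 hd, homPart_sup_of_lt hc' a1'.1 (hp ▸ hd)]
      exact ih' d
    · have e1 := finrank_homPart_sup hc a1.1 a1.2 (h2 L p [] rfl) hd
      have e2 := finrank_homPart_sup hc' a1'.1 a1'.2 (h2' M p' [] rfl) (hp ▸ hd)
      rw [← hp] at e2
      have := ih' d
      have := ih' (d - p.2)
      omega

theorem regular_of_zeros {g : σ → MvPolynomial σ ℂ} {e : σ → ℕ} (he : ∀ i, e i ≠ 0)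
    (hg : ∀ i, (g i).IsHomogeneous (e i))
    (h0 : ∀ z : σ → ℂ, (∀ i, eval z (g i) = 0) → z = 0) {L₁ L₂ : List σ} {i : σ}
    (h : Finset.univ.toList = L₁ ++ i :: L₂) (v : MvPolynomial σ ℂ)
    (hv : g i * v ∈ Ideal.ofList (L₁.map g)) : v ∈ Ideal.ofList (L₁.map g) := by
  have hev : ∀ i, eval 0 (g i) = 0 := fun i => by
    rw [eval_zero, constantCoeff_eq, (hg i).coeff_eq_zero (by simpa using (he i).symm)]
  refine mem_ofList_of_mul_mem (w := 1) (fun _ => one_ne_zero) (L₁.map g) (L₂.map g) (g i)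
    ?_ ?_ (hev i) ?_ ?_ ?_ v hv
  · intro p hp
    obtain ⟨j, _, rfl⟩ := List.mem_map.mp hp
    exact ⟨_, hg j⟩
  · intro p hp
    obtain ⟨j, _, rfl⟩ := List.mem_map.mp hp
    exact hev j
  · intro p hp
    obtain ⟨j, _, rfl⟩ := List.mem_map.mp hp
    exact hev j
  · intro z z1 z2 z3
    refine h0 z fun j => ?_
    have hj : j ∈ L₁ ++ i :: L₂ := by rw [← h]; simp
    rw [List.mem_append, List.mem_cons] at hj
    rcases hj with hj | rfl | hj
    · exact z1 _ (List.mem_map_of_mem hj)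
    · exact z2
    · exact z3 _ (List.mem_map_of_mem hj)
  · have := congrArg List.length h
    rw [Finset.length_toList, Finset.card_univ] at this
    simp only [List.length_append, List.length_cons, List.length_map] at this ⊢
    omega

theorem finrank_homPart_of_zeros {g g' : σ → MvPolynomial σ ℂ} {e : σ → ℕ} (he : ∀ i, e i ≠ 0)
    (hg : ∀ i, (g i).IsHomogeneous (e i))
    (h0 : ∀ z : σ → ℂ, (∀ i, eval z (g i) = 0) → z = 0)
    (hg' : ∀ i, (g' i).IsHomogeneous (e i))
    (h0' : ∀ z : σ → ℂ, (∀ i, eval z (g' i) = 0) → z = 0) (d : ℕ) :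
    Module.finrank ℂ (homPart (Ideal.span (Set.range g)) d) =
      Module.finrank ℂ (homPart (Ideal.span (Set.range g')) d) := by
  have hne : ∀ g : σ → MvPolynomial σ ℂ, (∀ i, (g i).IsHomogeneous (e i)) →
      (∀ z : σ → ℂ, (∀ i, eval z (g i) = 0) → z = 0) → ∀ i, g i ≠ 0 := by
    intro g hg h0 i hi
    obtain ⟨L₁, L₂, h⟩ := List.append_of_mem (show i ∈ Finset.univ.toList by simp)
    have h1 := regular_of_zeros he hg h0 h 1 (by rw [hi, zero_mul]; exact zero_mem _)
    have h2 : Ideal.ofList (L₁.map g) ≤ RingHom.ker (eval (0 : σ → ℂ)) := by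
      refine Ideal.span_le.mpr fun p hp => ?_
      obtain ⟨j, _, rfl⟩ := List.mem_map.mp hp
      change eval 0 (g j) = 0
      rw [eval_zero, constantCoeff_eq, (hg j).coeff_eq_zero (by simpa using (he j).symm)]
    have h3 : eval (0 : σ → ℂ) 1 = 0 := h2 h1
    simp at h3
  have hspan : ∀ g : σ → MvPolynomial σ ℂ, Ideal.span (Set.range g) =
      Ideal.ofList ((Finset.univ.toList.map fun i => (g i, e i)).map Prod.fst) := by
    intro g
    congr 1
    ext p
    simp
  rw [hspan g, hspan g']
  have hsplit : ∀ g : σ → MvPolynomial σ ℂ, (∀ i, (g i).IsHomogeneous (e i)) →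
      (∀ z : σ → ℂ, (∀ i, eval z (g i) = 0) → z = 0) →
      ∀ L₁ p L₂, (Finset.univ.toList.map fun i => (g i, e i)) = L₁ ++ p :: L₂ →
        ∀ v, p.1 * v ∈ Ideal.ofList (L₁.map Prod.fst) → v ∈ Ideal.ofList (L₁.map Prod.fst) := by
    intro g hg h0 L₁ p L₂ h v hv
    obtain ⟨M₁, M₂, h1, rfl, h2⟩ := List.map_eq_append_iff.mp h
    obtain ⟨i, M₃, rfl, rfl, rfl⟩ := List.map_eq_cons_iff.mp h2
    rw [List.map_map] at hv ⊢
    exact regular_of_zeros he hg h0 h1 v hv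
  refine finrank_homPart_eq _ _ (by rw [List.map_map, List.map_map]; rfl) ?_ ?_
    (hsplit g hg h0) (hsplit g' hg' h0') d
  · intro p hp
    obtain ⟨i, _, rfl⟩ := List.mem_map.mp hp
    exact ⟨hg i, hne g hg h0 i⟩
  · intro p hp
    obtain ⟨i, _, rfl⟩ := List.mem_map.mp hp
    exact ⟨hg' i, hne g' hg' h0' i⟩

/-- The socle degree of a homogeneous complete intersection. -/
theorem socle_degree {g : σ → MvPolynomial σ ℂ} {e : σ → ℕ} (he : ∀ i, e i ≠ 0)
    (hg : ∀ i, (g i).IsHomogeneous (e i))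
    (h0 : ∀ z : σ → ℂ, (∀ i, eval z (g i) = 0) → z = 0) (d : ℕ) :
    (homogeneousSubmodule σ ℂ d ≤ (Ideal.span (Set.range g)).restrictScalars ℂ) ↔
      ∑ i, (e i - 1) < d := by
  classical
  have key := finrank_homPart_of_zeros (g' := fun i => X i ^ e i) he hg h0
    (fun i => by simpa using (isHomogeneous_X ℂ i).pow (e i))
    (fun z hz => funext fun i => by simpa [he i] using hz i) d
  have hiff : ∀ I : Ideal (MvPolynomial σ ℂ), homogeneousSubmodule σ ℂ d ≤ I.restrictScalars ℂ ↔
      Module.finrank ℂ (homPart I d) = Module.finrank ℂ (homogeneousSubmodule σ ℂ d) := by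
    intro I
    constructor
    · intro h
      rw [homPart, inf_eq_right.mpr h]
    · intro h
      have := Submodule.eq_of_le_of_finrank_eq (inf_le_right : homPart I d ≤ _) h
      rw [← this]
      exact inf_le_left
  rw [hiff, key, ← hiff]
  have hmem : ∀ f : MvPolynomial σ ℂ, f ∈ Ideal.span (Set.range fun i => (X i : MvPolynomial σ ℂ) ^ e i) ↔
      ∀ m ∈ f.support, ∃ i, e i ≤ m i := by
    intro f
    have : (Set.range fun i => (X i : MvPolynomial σ ℂ) ^ e i) =
        (fun s => monomial s (1 : ℂ)) '' (Set.range fun i => Finsupp.single i (e i)) := by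
      rw [← Set.range_comp]
      congr 1
      funext i
      rw [X_pow_eq_monomial, Function.comp]
    rw [this, mem_ideal_span_monomial_image]
    simp
  constructor
  · intro h
    by_contra! hd
    obtain ⟨m, hm, hm'⟩ : ∃ m : σ →₀ ℕ, m.degree = d ∧ ∀ i, m i ≤ e i - 1 := by
      obtain ⟨m, hm, hm'⟩ := (Finsupp.equivFunOnFinite.symm fun i => e i - 1).exists_le_degree_eq d
        (by rw [Finsupp.degree_eq_sum]; exact hd)
      exact ⟨m, hm', fun i => hm i⟩
    have h1 := h (show monomial m (1:ℂ) ∈ _ from isHomogeneous_monomial _ hm)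
    obtain ⟨i, hi⟩ := (hmem _).mp h1 m (by simp)
    have := hm' i
    have := he i
    omega
  · intro h f hf
    refine (hmem f).mpr fun m hm => ?_
    have h1 : m.degree = d := by
      rw [Finsupp.degree_eq_weight_one]
      exact hf (mem_support_iff.mp hm)
    by_contra! hcon
    have h2 : ∑ i, m i ≤ ∑ i, (e i - 1) := Finset.sum_le_sum fun i _ => by
      have := hcon i; omega
    rw [Finsupp.degree_eq_sum] at h1
    omega

end

end

section
variable {τ : Type} [Fintype τ]

/-- The linear form with coefficient vector `a`. -/
noncomputable def lin (a : τ → ℂ) : MvPolynomial τ ℂ := ∑ i, C (a i) * X i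

@[simp] theorem eval_lin (a z : τ → ℂ) : eval z (lin a) = a ⬝ᵥ z := by
  simp [lin, dotProduct]

theorem isHomogeneous_lin (a : τ → ℂ) : (lin a).IsHomogeneous 1 :=
  IsHomogeneous.sum _ _ _ fun i _ => by
    simpa using (isHomogeneous_C τ (a i)).mul (isHomogeneous_X ℂ i)

theorem pderiv_lin [DecidableEq τ] (a : τ → ℂ) (i : τ) : pderiv i (lin a) = C (a i) := by
  simp [lin, pderiv_X, Pi.single_apply]

theorem lin_add (a b : τ → ℂ) : lin (a + b) = lin a + lin b := by
  simp [lin, add_mul, Finset.sum_add_distrib]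

theorem lin_smul (c : ℂ) (a : τ → ℂ) : lin (c • a) = C c * lin a := by
  simp [lin, Finset.mul_sum, mul_assoc]

@[simp] theorem lin_zero : lin (0 : τ → ℂ) = 0 := by simp [lin]

theorem lin_injective : Function.Injective (lin : (τ → ℂ) → MvPolynomial τ ℂ) := by
  classical
  intro a b h
  ext i
  have := congrArg (pderiv i) h
  rw [pderiv_lin, pderiv_lin] at this
  exact C_injective _ _ this

theorem lin_ne_zero {a : τ → ℂ} (ha : a ≠ 0) : lin a ≠ 0 := fun h =>
  ha (lin_injective (h.trans lin_zero.symm))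

theorem aeval_lin {B : Type} [CommRing B] [Algebra ℂ B] (g : τ → B) (a : τ → ℂ) :
    aeval g (lin a) = ∑ i, algebraMap ℂ B (a i) * g i := by
  simp [lin]

theorem irreducible_of_isHomogeneous_one {f : MvPolynomial τ ℂ} (hf : f.IsHomogeneous 1)
    (h0 : f ≠ 0) : Irreducible f := by
  refine irreducible_of_totalDegree_eq_one (hf.totalDegree h0) fun x hx => ?_
  obtain ⟨m, hm⟩ := ne_zero_iff.mp h0
  exact isUnit_iff_ne_zero.mpr fun h => hm (by simpa [h] using hx m)

theorem prime_lin {a : τ → ℂ} (ha : a ≠ 0) : Prime (lin a) :=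
  (irreducible_of_isHomogeneous_one (isHomogeneous_lin a) (lin_ne_zero ha)).prime

theorem eq_lin_of_isHomogeneous {f : MvPolynomial τ ℂ} (hf : f.IsHomogeneous 1) :
    f = lin fun i => coeff (Finsupp.single i 1) f := by
  classical
  ext m
  by_cases hm : m.degree = 1
  · obtain ⟨i, rfl⟩ : ∃ i, m = Finsupp.single i 1 := by
      exact (Finsupp.sum_eq_one_iff m).mp hm
    simp [lin, coeff_sum, coeff_C_mul, coeff_X, Finsupp.single_left_inj]
  · rw [hf.coeff_eq_zero hm, (isHomogeneous_lin _).coeff_eq_zero hm]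

/-- Generic linear forms cut a finite family of small subspaces down to the origin. -/
theorem exists_generic_forms {κ : Type*} [Finite κ] (q : ℕ) (Z : κ → Submodule ℂ (τ → ℂ))
    (hZ : ∀ k, Module.finrank ℂ (Z k) ≤ q) :
    ∃ us : List (τ → ℂ), us.length = q ∧
      ∀ k, ∀ z ∈ Z k, (∀ u ∈ us, u ⬝ᵥ z = 0) → z = 0 := by
  induction q generalizing Z with
  | zero =>
    refine ⟨[], rfl, fun k z hz _ => ?_⟩
    have : Z k = ⊥ := Submodule.finrank_eq_zero.mp (Nat.le_zero.mp (hZ k))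
    simpa [this] using hz
  | succ q ih =>
    let A : {k // Z k ≠ ⊥} → Submodule ℂ (τ → ℂ) := fun k =>
      { carrier := {u | ∀ z ∈ Z k.1, u ⬝ᵥ z = 0}
        add_mem' := fun {u v} hu hv z hz => by rw [add_dotProduct, hu z hz, hv z hz, add_zero]
        zero_mem' := fun z _ => zero_dotProduct z
        smul_mem' := fun c u hu z hz => by rw [smul_dotProduct, hu z hz, smul_zero] }
    have hA : ∀ k, A k ≠ ⊤ := by
      intro k hk
      apply k.2
      rw [Submodule.eq_bot_iff]
      intro z hz
      refine dotProduct_eq_zero_iff.mp fun u => ?_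
      have : u ∈ A k := by rw [hk]; trivial
      rw [dotProduct_comm]
      exact this z hz
    obtain ⟨u, hu⟩ : ∃ u, ∀ k, u ∉ A k := by
      by_contra! h
      obtain ⟨k, hk⟩ := Subspace.exists_eq_top_of_iUnion_eq_univ (p := A)
        (Set.eq_univ_of_forall fun u => Set.mem_iUnion.mpr (h u))
      exact hA k hk
    let K : Submodule ℂ (τ → ℂ) :=
      { carrier := {z | u ⬝ᵥ z = 0}
        add_mem' := fun {v w} hv hw => by
          change u ⬝ᵥ v = 0 at hv
          change u ⬝ᵥ w = 0 at hw
          change u ⬝ᵥ (v + w) = 0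
          rw [dotProduct_add, hv, hw, add_zero]
        zero_mem' := dotProduct_zero u
        smul_mem' := fun c v hv => by
          change u ⬝ᵥ v = 0 at hv
          change u ⬝ᵥ (c • v) = 0
          rw [dotProduct_smul, hv, smul_zero] }
    obtain ⟨us, hl, hus⟩ := ih (fun k => Z k ⊓ K) fun k => by
      by_cases hk : Z k = ⊥
      · rw [hk, bot_inf_eq, finrank_bot]
        exact Nat.zero_le q
      · have : Z k ⊓ K < Z k := by
          refine lt_of_le_of_ne inf_le_left fun h => hu ⟨k, hk⟩ fun z hz => ?_
          have hz' : z ∈ Z k ⊓ K := by rw [h]; exact hz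
          exact hz'.2
        have := Submodule.finrank_lt_finrank_of_lt this
        have := hZ k
        omega
    refine ⟨u :: us, by simp [hl], fun k z hz h => ?_⟩
    exact hus k z ⟨hz, h u (by simp)⟩ fun v hv => h v (by simp [hv])

end

section
variable {n : ℕ} {ι : Type}

/-- The common zeros of the linear forms indexed by `J`. -/
def flat (a : ι → Fin n → ℂ) (J : Finset ι) : Submodule ℂ (Fin n → ℂ) where
  carrier := {v | ∀ k ∈ J, a k ⬝ᵥ v = 0}
  add_mem' := fun {u v} hu hv k hk => by rw [dotProduct_add, hu k hk, hv k hk, add_zero]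
  zero_mem' := fun k _ => dotProduct_zero _
  smul_mem' := fun c u hu k hk => by rw [dotProduct_smul, hu k hk, smul_zero]

theorem mem_flat {a : ι → Fin n → ℂ} {J : Finset ι} {v : Fin n → ℂ} :
    v ∈ flat a J ↔ ∀ k ∈ J, a k ⬝ᵥ v = 0 := Iff.rfl

/-- `J` contains every form vanishing on its flat. -/
def IsFlat (a : ι → Fin n → ℂ) (J : Finset ι) : Prop :=
  ∀ k, (∀ v ∈ flat a J, a k ⬝ᵥ v = 0) → k ∈ J

theorem mem_span_of_forall_flat {a : ι → Fin n → ℂ} {J : Finset ι} {w : Fin n → ℂ}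
    (h : ∀ v ∈ flat a J, w ⬝ᵥ v = 0) : w ∈ Submodule.span ℂ (a '' (J : Set ι)) := by
  have e := (dotProductEquiv ℂ (Fin n))
  have key := FiniteDimensional.mem_span_of_iInf_ker_le_ker (𝕜 := ℂ) (E := Fin n → ℂ)
    (L := fun k : J => dotProductEquiv ℂ (Fin n) (a k)) (K := dotProductEquiv ℂ (Fin n) w)
    (by
      intro v hv
      rw [LinearMap.mem_ker]
      refine h v fun k hk => ?_
      simpa using (Submodule.mem_iInf _).mp hv ⟨k, hk⟩)
  have h2 : Set.range (fun k : J => dotProductEquiv ℂ (Fin n) (a k)) =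
      (dotProductEquiv ℂ (Fin n)).toLinearMap '' (a '' (J : Set ι)) := by
    ext x
    simp
  rw [h2, Submodule.span_image] at key
  obtain ⟨w', hw', h3⟩ := key
  rwa [← (dotProductEquiv ℂ (Fin n)).injective h3]

/-- The projection attached to a splitting of the forms. -/
theorem exists_projection {a : ι → Fin n → ℂ} {J₁ J₂ : Finset ι}
    (h : flat a J₁ ⊔ flat a J₂ = ⊤) :
    ∃ T : Matrix (Fin n) (Fin n) ℂ, T * T = T ∧ (∀ v, T.mulVec v = 0 ↔ v ∈ flat a J₁) ∧
      (∀ k ∈ J₁, Matrix.vecMul (a k) T = a k) ∧ (∀ k ∈ J₂, Matrix.vecMul (a k) T = 0) ∧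
      T.trace = ((n - Module.finrank ℂ (flat a J₁) : ℕ) : ℂ) := by
  classical
  obtain ⟨C', hC'⟩ := Submodule.exists_isCompl (Submodule.comap (flat a J₂).subtype (flat a J₁))
  let C := C'.map (flat a J₂).subtype
  have hC2 : C ≤ flat a J₂ := Submodule.map_subtype_le _ _
  have hcompl : IsCompl C (flat a J₁) := by
    constructor
    · rw [Submodule.disjoint_def]
      rintro _ ⟨x, hx, rfl⟩ hx1
      have := (Submodule.disjoint_def.mp hC'.disjoint) x hx1 hx
      simp [this]
    · rw [codisjoint_iff, eq_top_iff, ← h, sup_le_iff]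
      refine ⟨le_sup_right, fun v hv => ?_⟩
      have : (⟨v, hv⟩ : flat a J₂) ∈ Submodule.comap (flat a J₂).subtype (flat a J₁) ⊔ C' := by
        rw [hC'.sup_eq_top]; trivial
      obtain ⟨y, hy, z, hz, hyz⟩ := Submodule.mem_sup.mp this
      refine Submodule.mem_sup.mpr ⟨z, ⟨z, hz, rfl⟩, y, hy, ?_⟩
      rw [add_comm]
      exact congrArg Subtype.val hyz
  let P : (Fin n → ℂ) →ₗ[ℂ] (Fin n → ℂ) := C.subtype ∘ₗ C.projectionOnto (flat a J₁) hcompl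
  have hPC : ∀ v, P v ∈ C := fun v => (C.projectionOnto (flat a J₁) hcompl v).2
  have hPid : ∀ v ∈ C, P v = v := fun v hv => by
    have := Submodule.projectionOnto_apply_left hcompl ⟨v, hv⟩
    exact congrArg Subtype.val this
  have hker : ∀ v, P v = 0 ↔ v ∈ flat a J₁ := fun v => by
    rw [← Submodule.projectionOnto_apply_eq_zero_iff hcompl]
    exact ⟨fun h => Subtype.ext h, fun h => congrArg Subtype.val h⟩
  have hsub : ∀ v, v - P v ∈ flat a J₁ := fun v => by
    rw [← hker, map_sub, hPid _ (hPC v), sub_self]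
  have hT : ∀ v, (LinearMap.toMatrix' P).mulVec v = P v := fun v => by
    rw [← Matrix.toLin'_apply, Matrix.toLin'_toMatrix']
  refine ⟨LinearMap.toMatrix' P, ?_, fun v => by rw [hT, hker], fun k hk => ?_, fun k hk => ?_, ?_⟩
  · rw [← LinearMap.toMatrix'_comp]
    congr 1
    ext1 v
    ext1
    simp [hPid _ (hPC _)]
  · refine dotProduct_eq _ _ fun v => ?_
    rw [← Matrix.dotProduct_mulVec, hT]
    have := hsub v k hk
    rw [dotProduct_sub, sub_eq_zero] at this
    exact this.symm
  · refine dotProduct_eq _ _ fun v => ?_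
    rw [← Matrix.dotProduct_mulVec, hT, zero_dotProduct]
    exact hC2 (hPC v) k hk
  · have hp : LinearMap.IsProj C P := ⟨hPC, hPid⟩
    have := hp.trace
    rw [LinearMap.trace_eq_matrix_trace ℂ (Pi.basisFun ℂ (Fin n))] at this
    rw [← LinearMap.toMatrix_eq_toMatrix']
    rw [this]
    have h2 := Submodule.finrank_add_eq_of_isCompl hcompl
    rw [Module.finrank_fin_fun] at h2
    congr 1
    omega

end

section
variable {n : ℕ} {ι : Type}

/-- Substitution of a linear map. -/
noncomputable def comp (T : Matrix (Fin n) (Fin n) ℂ) :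
    MvPolynomial (Fin n) ℂ →ₐ[ℂ] MvPolynomial (Fin n) ℂ := aeval fun i => lin (T i)

theorem eval_comp (T : Matrix (Fin n) (Fin n) ℂ) (f : MvPolynomial (Fin n) ℂ) (z : Fin n → ℂ) :
    eval z (comp T f) = eval (T.mulVec z) f := by
  have : ((eval z).comp (comp T).toRingHom : MvPolynomial (Fin n) ℂ →+* ℂ) =
      eval (T.mulVec z) := by
    ext i
    · simp [comp]
    · simp [comp, Matrix.mulVec]
  exact DFunLike.congr_fun this f

theorem comp_X (T : Matrix (Fin n) (Fin n) ℂ) (i : Fin n) : comp T (X i) = lin (T i) := by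
  simp [comp]

@[simp] theorem comp_C (T : Matrix (Fin n) (Fin n) ℂ) (c : ℂ) : comp T (C c) = C c := by
  simp [comp]

theorem comp_lin (T : Matrix (Fin n) (Fin n) ℂ) (u : Fin n → ℂ) :
    comp T (lin u) = lin (Matrix.vecMul u T) := by
  refine MvPolynomial.funext fun z => ?_
  rw [eval_comp, eval_lin, eval_lin, Matrix.dotProduct_mulVec]

theorem comp_comp {T : Matrix (Fin n) (Fin n) ℂ} (hT : T * T = T) (f : MvPolynomial (Fin n) ℂ) :
    comp T (comp T f) = comp T f := by
  refine MvPolynomial.funext fun z => ?_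
  rw [eval_comp, eval_comp, eval_comp, Matrix.mulVec_mulVec, hT]

theorem IsHomogeneous.comp {T : Matrix (Fin n) (Fin n) ℂ} {f : MvPolynomial (Fin n) ℂ} {d : ℕ}
    (hf : f.IsHomogeneous d) : (comp T f).IsHomogeneous d := by
  have := hf.aeval (fun i => lin (T i)) (fun i => isHomogeneous_lin _)
  simpa [Arrangement.comp] using this

theorem pderiv_comp (T : Matrix (Fin n) (Fin n) ℂ) (f : MvPolynomial (Fin n) ℂ) (j : Fin n) :
    pderiv j (comp T f) = ∑ i, comp T (pderiv i f) * C (T i j) := by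
  induction f using MvPolynomial.induction_on with
  | C c => simp
  | add p q hp hq => simp [hp, hq, add_mul, Finset.sum_add_distrib]
  | mul_X p k hp =>
    simp only [map_mul, Derivation.leibniz, hp, smul_eq_mul, map_add, comp_X, pderiv_lin,
      pderiv_X, add_mul, Finset.sum_add_distrib, Finset.mul_sum]
    congr 1
    · rw [Finset.sum_eq_single k]
      · simp
      · intro b _ hb; simp [Pi.single_apply, hb.symm]
      · simp
    · exact Finset.sum_congr rfl fun i _ => by ring

/-- The linear forms define distinct hyperplanes. -/
structure Reduced (a : ι → Fin n → ℂ) : Prop where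
  ne_zero : ∀ k, a k ≠ 0
  eq_of_smul : ∀ i j (c : ℂ), a i = c • a j → i = j

variable {a : ι → Fin n → ℂ}

theorem Reduced.eq_of_dvd (ha : Reduced a) {i j : ι} (h : lin (a i) ∣ lin (a j)) : i = j := by
  have : a j ∈ Submodule.span ℂ (a '' (({i} : Finset ι) : Set ι)) := by
    refine mem_span_of_forall_flat fun v hv => ?_
    obtain ⟨c, hc⟩ := h
    have := congrArg (eval v) hc
    rw [map_mul, eval_lin, eval_lin, hv i (by simp), zero_mul] at this
    exact this
  rw [Finset.coe_singleton, Set.image_singleton, Submodule.mem_span_singleton] at this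
  obtain ⟨c, hc⟩ := this
  exact (ha.eq_of_smul j i c hc.symm).symm

theorem Reduced.prod_dvd (ha : Reduced a) {J : Finset ι} {f : MvPolynomial (Fin n) ℂ}
    (h : ∀ k ∈ J, lin (a k) ∣ f) : ∏ k ∈ J, lin (a k) ∣ f := by
  refine Finset.prod_dvd_of_isRelPrime (fun i hi j hj hij => ?_) h
  refine ((prime_lin (ha.ne_zero i)).irreducible.isRelPrime_iff_not_dvd).mpr fun hd => ?_
  exact hij (ha.eq_of_dvd hd)

theorem Reduced.prod_ne_zero (ha : Reduced a) (J : Finset ι) : ∏ k ∈ J, lin (a k) ≠ 0 :=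
  Finset.prod_ne_zero_iff.mpr fun k _ => lin_ne_zero (ha.ne_zero k)

theorem isHomogeneous_prod_lin (a : ι → Fin n → ℂ) (J : Finset ι) :
    (∏ k ∈ J, lin (a k)).IsHomogeneous J.card := by
  simpa using IsHomogeneous.prod J (fun k => lin (a k)) (fun _ => 1)
    fun k _ => isHomogeneous_lin (a k)

/-- The value of the vector field `δ` on the linear form `u`. -/
noncomputable def app (u : Fin n → ℂ) (δ : Fin n → MvPolynomial (Fin n) ℂ) :
    MvPolynomial (Fin n) ℂ := ∑ j, C (u j) * δ j

theorem app_add (u : Fin n → ℂ) (δ δ' : Fin n → MvPolynomial (Fin n) ℂ) :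
    app u (δ + δ') = app u δ + app u δ' := by
  simp [app, mul_add, Finset.sum_add_distrib]

theorem app_smul (u : Fin n → ℂ) (r : MvPolynomial (Fin n) ℂ) (δ : Fin n → MvPolynomial (Fin n) ℂ) :
    app u (r • δ) = r * app u δ := by
  simp only [app, Finset.mul_sum, Pi.smul_apply, smul_eq_mul]
  exact Finset.sum_congr rfl fun i _ => by ring

theorem app_C (u v : Fin n → ℂ) : app u (fun j => C (v j)) = C (u ⬝ᵥ v) := by
  simp [app, dotProduct]

theorem Reduced.prod_dvd_det (ha : Reduced a) {J : Finset ι}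
    {χ : Matrix (Fin n) (Fin n) (MvPolynomial (Fin n) ℂ)}
    (h : ∀ i, ∀ k ∈ J, lin (a k) ∣ app (a k) (χ i)) : ∏ k ∈ J, lin (a k) ∣ χ.det := by
  refine ha.prod_dvd fun k hk => ?_
  obtain ⟨i, hi⟩ : ∃ i, a k i ≠ 0 := by
    by_contra! h
    exact ha.ne_zero k (funext h)
  choose w hw using fun i => h i k hk
  have h1 : χ.mulVec (fun j => C (a k j)) = lin (a k) • w := by
    ext1 i
    rw [Pi.smul_apply, smul_eq_mul, ← hw i]
    simp only [Matrix.mulVec, dotProduct, app, mul_comm]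
  have h2 := congrArg (χ.adjugate.mulVec) h1
  rw [Matrix.mulVec_mulVec, Matrix.adjugate_mul, Matrix.smul_mulVec, Matrix.one_mulVec,
    Matrix.mulVec_smul] at h2
  have h3 := congrFun h2 i
  simp only [Pi.smul_apply, smul_eq_mul] at h3
  have h4 : χ.det = lin (a k) * (χ.adjugate.mulVec w i * C (a k i)⁻¹) := by
    rw [← mul_assoc, ← h3, mul_assoc, ← C_mul, mul_inv_cancel₀ hi, C_1, mul_one]
  exact ⟨_, h4⟩

/-- A homogeneous basis of the logarithmic vector fields of the subarrangement `J`, adapted to a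
linear projection `π` with kernel the flat of `J`. -/
structure Saito (a : ι → Fin n → ℂ) (J : Finset ι) where
  χ : Matrix (Fin n) (Fin n) (MvPolynomial (Fin n) ℂ)
  q : Fin n → ι → MvPolynomial (Fin n) ℂ
  d : Fin n → ℕ
  π : Matrix (Fin n) (Fin n) ℂ
  c : ℂ
  hom : ∀ i j, (χ i j).IsHomogeneous (d i)
  app_eq : ∀ i, ∀ k ∈ J, app (a k) (χ i) = lin (a k) * q i k
  c_ne : c ≠ 0
  det_eq : χ.det = C c * ∏ k ∈ J, lin (a k)
  sum_d : ∑ i, d i = J.card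
  π_sq : π * π = π
  π_ker : ∀ v, π.mulVec v = 0 ↔ v ∈ flat a J
  π_form : ∀ k ∈ J, Matrix.vecMul (a k) π = a k
  π_trace : π.trace = ((n - Module.finrank ℂ (flat a J) : ℕ) : ℂ)
  comp_χ : ∀ i j, comp π (χ i j) = χ i j

namespace Saito
variable {J : Finset ι} (B : Saito a J)

theorem exists_coeff (ha : Reduced a) (δ : Fin n → MvPolynomial (Fin n) ℂ)
    (h : ∀ k ∈ J, lin (a k) ∣ app (a k) δ) :
    ∃ c : Fin n → MvPolynomial (Fin n) ℂ, ∀ j, δ j = ∑ i, c i * B.χ i j := by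
  have key : ∀ i, ∃ e, (B.χ.updateRow i δ).det = (∏ k ∈ J, lin (a k)) * e := fun i => by
    refine ha.prod_dvd_det fun i' k hk => ?_
    by_cases hi : i' = i
    · subst hi
      rw [Matrix.updateRow_self]
      exact h k hk
    · rw [Matrix.updateRow_ne hi]
      exact ⟨_, B.app_eq i' k hk⟩
  choose e he using key
  refine ⟨fun i => C B.c⁻¹ * e i, fun j => ?_⟩
  have h1 : Matrix.vecMul (Matrix.vecMul δ B.χ.adjugate) B.χ = B.χ.det • δ := by
    rw [Matrix.vecMul_vecMul, Matrix.adjugate_mul, Matrix.vecMul_smul, Matrix.vecMul_one]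
  have h2 : Matrix.vecMul δ B.χ.adjugate = (∏ k ∈ J, lin (a k)) • e := by
    ext1 i
    rw [Pi.smul_apply, smul_eq_mul, ← he i, ← Matrix.cramer_transpose_apply,
      Matrix.cramer_eq_adjugate_mulVec, ← Matrix.adjugate_transpose, Matrix.mulVec_transpose]
  rw [h2, Matrix.smul_vecMul, B.det_eq] at h1
  have h3 := congrFun h1 j
  simp only [Pi.smul_apply, smul_eq_mul] at h3
  refine mul_left_cancel₀ (mul_ne_zero (C_ne_zero.mpr B.c_ne) (ha.prod_ne_zero J)) ?_
  rw [← h3, mul_comm (C B.c), mul_assoc]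
  congr 1
  rw [Finset.mul_sum, Matrix.vecMul, dotProduct]
  refine Finset.sum_congr rfl fun i _ => ?_
  rw [← mul_assoc, ← mul_assoc, ← C_mul, mul_inv_cancel₀ B.c_ne, C_1, one_mul]

theorem exists_coeff' (ha : Reduced a) (δ : Fin n → MvPolynomial (Fin n) ℂ)
    (r : ι → MvPolynomial (Fin n) ℂ) (h : ∀ k ∈ J, app (a k) δ = lin (a k) * r k) :
    ∃ c : Fin n → MvPolynomial (Fin n) ℂ, (∀ j, δ j = ∑ i, c i * B.χ i j) ∧
      ∀ k ∈ J, r k = ∑ i, c i * B.q i k := by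
  obtain ⟨c, hc⟩ := B.exists_coeff ha δ fun k hk => ⟨_, h k hk⟩
  refine ⟨c, hc, fun k hk => mul_left_cancel₀ (lin_ne_zero (ha.ne_zero k)) ?_⟩
  rw [← h k hk, app, Finset.mul_sum]
  simp_rw [hc, Finset.mul_sum]
  rw [Finset.sum_comm]
  refine Finset.sum_congr rfl fun i _ => ?_
  rw [mul_left_comm, ← B.app_eq i k hk, app, Finset.mul_sum]
  exact Finset.sum_congr rfl fun j _ => by ring

theorem isHomogeneous_app (i : Fin n) (u : Fin n → ℂ) :
    (app u (B.χ i)).IsHomogeneous (B.d i) :=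
  IsHomogeneous.sum _ _ _ fun j _ => by
    simpa using (isHomogeneous_C (Fin n) (u j)).mul (B.hom i j)

theorem isHomogeneous_of_lin_mul {u : Fin n → ℂ} (hu : u ≠ 0) {f : MvPolynomial (Fin n) ℂ}
    {d : ℕ} (h : (lin u * f).IsHomogeneous (d + 1)) : f.IsHomogeneous d := by
  by_cases hf : f = 0
  · rw [hf]; exact isHomogeneous_zero _ _ _
  have key : ∀ e, e ≠ d → homogeneousComponent e f = 0 := fun e he => by
    have h1 := homogeneousComponent_of_mem (m := e + 1) h
    rw [if_neg (by omega), homogeneousComponent, mul_comm,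
      weightedHomogeneousComponent_mul_of_isWeightedHomogeneous _ f (isHomogeneous_lin u)] at h1
    rw [if_pos (by omega), Nat.add_sub_cancel] at h1
    exact (mul_eq_zero.mp h1).resolve_right (lin_ne_zero hu)
  have h2 : f = homogeneousComponent d f := by
    conv_lhs => rw [← sum_homogeneousComponent f]
    by_cases hd : d ∈ Finset.range (f.totalDegree + 1)
    · rw [Finset.sum_eq_single d (fun e _ he => key e he) (fun h => absurd hd h)]
    · rw [Finset.sum_eq_zero fun e he => key e (by rintro rfl; exact hd he)]
      exact (homogeneousComponent_eq_zero _ _ (by simpa using hd)).symm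
  rw [h2]
  exact homogeneousComponent_isHomogeneous _ _

theorem isHomogeneous_q (ha : Reduced a) (i : Fin n) {k : ι} (hk : k ∈ J) :
    (B.q i k).IsHomogeneous (B.d i - 1) := by
  by_cases hd : B.d i = 0
  · have h1 : B.q i k = 0 := by
      by_contra h
      have h2 := B.isHomogeneous_app i (a k)
      have h3 : app (a k) (B.χ i) ≠ 0 := by
        rw [B.app_eq i k hk]; exact mul_ne_zero (lin_ne_zero (ha.ne_zero k)) h
      have h4 := h2.totalDegree h3
      rw [B.app_eq i k hk, totalDegree_mul_of_isDomain (lin_ne_zero (ha.ne_zero k)) h,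
        (isHomogeneous_lin (a k)).totalDegree (lin_ne_zero (ha.ne_zero k))] at h4
      omega
    rw [h1]; exact isHomogeneous_zero _ _ _
  · refine isHomogeneous_of_lin_mul (ha.ne_zero k) ?_
    rw [← B.app_eq i k hk, Nat.sub_add_cancel (Nat.pos_of_ne_zero hd)]
    exact B.isHomogeneous_app i (a k)

theorem q_eq_zero (ha : Reduced a) {i : Fin n} (hd : B.d i = 0) {k : ι} (hk : k ∈ J) :
    B.q i k = 0 := by
  by_contra h
  have h2 := B.isHomogeneous_app i (a k)
  have h3 : app (a k) (B.χ i) ≠ 0 := by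
    rw [B.app_eq i k hk]; exact mul_ne_zero (lin_ne_zero (ha.ne_zero k)) h
  have h4 := h2.totalDegree h3
  rw [B.app_eq i k hk, totalDegree_mul_of_isDomain (lin_ne_zero (ha.ne_zero k)) h,
    (isHomogeneous_lin (a k)).totalDegree (lin_ne_zero (ha.ne_zero k))] at h4
  omega

theorem comp_q (ha : Reduced a) (i : Fin n) {k : ι} (hk : k ∈ J) :
    comp B.π (B.q i k) = B.q i k := by
  refine mul_left_cancel₀ (lin_ne_zero (ha.ne_zero k)) ?_
  have h1 := congrArg (comp B.π) (B.app_eq i k hk)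
  rw [map_mul, comp_lin, B.π_form k hk] at h1
  rw [← h1, ← B.app_eq i k hk, app, map_sum]
  exact Finset.sum_congr rfl fun j _ => by rw [map_mul, comp_C, B.comp_χ]

end Saito
end

section
variable {n : ℕ} {ι : Type} {a : ι → Fin n → ℂ}

/-- Irreducibility of the subarrangement `J`. -/
def Irr (a : ι → Fin n → ℂ) (J : Finset ι) : Prop :=
  ¬ ∃ V₁ V₂ : Submodule ℂ (Fin n → ℂ), IsCompl V₁ V₂ ∧
      (∀ k ∈ J, (∀ v ∈ V₁, a k ⬝ᵥ v = 0) ∨ ∀ v ∈ V₂, a k ⬝ᵥ v = 0) ∧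
      (∃ k ∈ J, ∀ v ∈ V₁, a k ⬝ᵥ v = 0) ∧ ∃ k ∈ J, ∀ v ∈ V₂, a k ⬝ᵥ v = 0

/-- Common eigenvectors of an irreducible arrangement have a common eigenvalue. -/
theorem Irr.eigenvalue_eq {J : Finset ι} (h : Irr a J)
    {A : Matrix (Fin n) (Fin n) ℂ} {c : ι → ℂ} (hA : ∀ k ∈ J, Matrix.vecMul (a k) A = c k • a k)
    {k k' : ι} (hk : k ∈ J) (hk' : k' ∈ J) : c k = c k' := by
  by_contra hne
  let f : Module.End ℂ (Fin n → ℂ) := Matrix.toLin' (A - Matrix.scalar (Fin n) (c k'))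
  have hf : ∀ i ∈ J, ∀ v, a i ⬝ᵥ f v = (c i - c k') * (a i ⬝ᵥ v) := fun i hi v => by
    simp only [f, Matrix.toLin'_apply]
    rw [Matrix.dotProduct_mulVec, Matrix.vecMul_sub, hA i hi, Matrix.scalar_apply,
      Matrix.vecMul_diagonal_const, sub_dotProduct, smul_dotProduct, sub_mul]
    simp only [smul_dotProduct, smul_eq_mul, MulOpposite.smul_eq_mul_unop, MulOpposite.unop_op,
      mul_comm]
  have hfp : ∀ m, ∀ i ∈ J, ∀ v, a i ⬝ᵥ (f ^ m) v = (c i - c k') ^ m * (a i ⬝ᵥ v) := by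
    intro m i hi
    induction m with
    | zero => simp
    | succ m ih =>
      intro v
      rw [pow_succ, Module.End.mul_apply, ih, hf i hi, pow_succ, mul_assoc]
  obtain ⟨N, hN⟩ := Filter.eventually_atTop.mp f.eventually_isCompl_ker_pow_range_pow
  have hc := hN (N + 1) (by omega)
  have h1 : ∀ i ∈ J, c i ≠ c k' → ∀ v ∈ LinearMap.ker (f ^ (N + 1)), a i ⬝ᵥ v = 0 := by
    intro i hi hci v hv
    have := hfp (N + 1) i hi v
    rw [LinearMap.mem_ker.mp hv, dotProduct_zero] at this
    exact (mul_eq_zero.mp this.symm).resolve_left (pow_ne_zero _ (sub_ne_zero.mpr hci))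
  have h2 : ∀ i ∈ J, c i = c k' → ∀ v ∈ LinearMap.range (f ^ (N + 1)), a i ⬝ᵥ v = 0 := by
    rintro i hi hci _ ⟨v, rfl⟩
    rw [hfp (N + 1) i hi v, hci, sub_self, zero_pow (Nat.succ_ne_zero N), zero_mul]
  refine h ⟨_, _, hc, fun i hi => ?_, ⟨k, hk, h1 k hk hne⟩, k', hk', h2 k' hk' rfl⟩
  by_cases hi' : c i = c k'
  · exact Or.inr (h2 i hi hi')
  · exact Or.inl (h1 i hi hi')

/-- The linear splitting of a reducible arrangement. -/
theorem exists_split_of_not_irr (ha : Reduced a) {J : Finset ι} (h : ¬ Irr a J) :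
    ∃ J₁ J₂ : Finset ι, J₁.Nonempty ∧ J₂.Nonempty ∧ Disjoint J₁ J₂ ∧
      (∀ k, k ∈ J ↔ k ∈ J₁ ∨ k ∈ J₂) ∧ flat a J₁ ⊔ flat a J₂ = ⊤ := by
  classical
  obtain ⟨V₁, V₂, hc, hJ, ⟨k₁, hk₁, h1⟩, k₂, hk₂, h2⟩ := not_not.mp h
  have h3 : ¬ ∀ v ∈ V₁, a k₂ ⬝ᵥ v = 0 := by
    intro h4
    apply ha.ne_zero k₂
    refine dotProduct_eq_zero _ fun v => ?_
    have hv : v ∈ V₁ ⊔ V₂ := by rw [hc.sup_eq_top]; trivial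
    obtain ⟨x, hx, y, hy, rfl⟩ := Submodule.mem_sup.mp hv
    rw [dotProduct_add, h4 x hx, h2 y hy, add_zero]
  refine ⟨J.filter fun k => ∀ v ∈ V₁, a k ⬝ᵥ v = 0, J.filter fun k => ¬ ∀ v ∈ V₁, a k ⬝ᵥ v = 0,
    ⟨k₁, Finset.mem_filter.mpr ⟨hk₁, h1⟩⟩, ⟨k₂, Finset.mem_filter.mpr ⟨hk₂, h3⟩⟩,
    Finset.disjoint_filter_filter_not _ _ _, fun k => ?_, ?_⟩
  · rw [Finset.mem_filter, Finset.mem_filter]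
    tauto
  · rw [eq_top_iff, ← hc.sup_eq_top]
    refine sup_le_sup (fun v hv k hk => ?_) (fun v hv k hk => ?_)
    · exact (Finset.mem_filter.mp hk).2 v hv
    · obtain ⟨hk, hk'⟩ := Finset.mem_filter.mp hk
      exact (hJ k hk).resolve_left hk' v hv

namespace Saito
variable {J : Finset ι} (B : Saito a J)

theorem det_ne_zero (ha : Reduced a) : B.χ.det ≠ 0 := by
  rw [B.det_eq]
  exact mul_ne_zero (C_ne_zero.mpr B.c_ne) (ha.prod_ne_zero J)

theorem eq_zero_of_sum (ha : Reduced a) {f : Fin n → MvPolynomial (Fin n) ℂ}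
    (h : ∀ j, ∑ i, f i * B.χ i j = 0) : f = 0 :=
  Matrix.eq_zero_of_vecMul_eq_zero (B.det_ne_zero ha) (funext h)

theorem eval_χ_zero {i : Fin n} (hi : B.d i ≠ 0) (j : Fin n) : coeff 0 (B.χ i j) = 0 :=
  (B.hom i j).coeff_eq_zero (by simpa using hi.symm)

theorem χ_eq_C {i : Fin n} (hi : B.d i = 0) (j : Fin n) : B.χ i j = C (coeff 0 (B.χ i j)) := by
  have := B.hom i j
  rw [hi] at this
  exact totalDegree_eq_zero_iff_eq_C.mp (Nat.le_zero.mp this.totalDegree_le)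

/-- The constant rows. -/
noncomputable def row (i : {i // B.d i = 0}) : Fin n → ℂ := fun j => coeff 0 (B.χ i j)

theorem row_mem_flat (ha : Reduced a) (i : {i // B.d i = 0}) : B.row i ∈ flat a J := by
  intro k hk
  have h1 := B.app_eq i k hk
  rw [B.q_eq_zero ha i.2 hk, mul_zero, app] at h1
  have h2 := congrArg (coeff 0) h1
  rw [coeff_sum] at h2
  simpa [dotProduct, row] using h2

theorem sum_eq_sum_row {M : Type*} [AddCommMonoid M] {g : Fin n → M}
    (h : ∀ i, B.d i ≠ 0 → g i = 0) : ∑ i, g i = ∑ i : {i // B.d i = 0}, g i := by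
  classical
  rw [← Finset.sum_subtype (Finset.univ.filter fun i => B.d i = 0) (by simp) g,
    Finset.sum_filter_of_ne]
  intro i _ hi
  by_contra hd
  exact hi (h i hd)

theorem linearIndependent_row (ha : Reduced a) : LinearIndependent ℂ B.row := by
  classical
  rw [Fintype.linearIndependent_iff]
  intro g hg i
  have h := B.eq_zero_of_sum ha (f := fun i => if h : B.d i = 0 then C (g ⟨i, h⟩) else 0) fun j => by
    rw [B.sum_eq_sum_row fun i hi => by rw [dif_neg hi, zero_mul]]
    have h2 := congrFun hg j
    rw [Finset.sum_apply] at h2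
    rw [Finset.sum_congr rfl (g := fun i => C (g i * B.row i j)), ← map_sum]
    · simp only [Pi.smul_apply, smul_eq_mul, Pi.zero_apply] at h2
      rw [h2, C_0]
    · intro i _
      rw [dif_pos i.2, B.χ_eq_C i.2, C_mul, row]
  have := congrFun h i
  simpa [i.2] using this

theorem span_row (ha : Reduced a) : Submodule.span ℂ (Set.range B.row) = flat a J := by
  classical
  refine le_antisymm (Submodule.span_le.mpr ?_) fun v hv => ?_
  · rintro _ ⟨i, rfl⟩
    exact B.row_mem_flat ha i
  · obtain ⟨c, hc, -⟩ := B.exists_coeff' ha (fun j => C (v j)) (fun _ => 0) fun k hk => by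
      rw [app_C, hv k hk, C_0, mul_zero]
    have : v = ∑ i : {i // B.d i = 0}, coeff 0 (c i) • B.row i := by
      funext j
      have h1 := congrArg constantCoeff (hc j)
      rw [constantCoeff_C, map_sum] at h1
      rw [h1, Finset.sum_apply, B.sum_eq_sum_row]
      · exact Finset.sum_congr rfl fun i _ => by
          rw [map_mul, Pi.smul_apply, smul_eq_mul]
          rfl
      · intro i hd
        rw [map_mul, constantCoeff_eq, B.eval_χ_zero hd, mul_zero]
    rw [this]
    exact Submodule.sum_mem _ fun i _ => Submodule.smul_mem _ _ (Submodule.subset_span ⟨i, rfl⟩)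

theorem card_row (ha : Reduced a) :
    Fintype.card {i // B.d i = 0} = Module.finrank ℂ (flat a J) := by
  rw [← B.span_row ha, finrank_span_eq_card (B.linearIndependent_row ha)]

/-- Coordinates on the flat. -/
theorem exists_coords (ha : Reduced a) : ∃ ζ : Fin n → Fin n → ℂ,
    (∀ i, Matrix.vecMul (ζ i) B.π = 0) ∧
    (∀ i, B.d i = 0 → ∀ x ∈ flat a J, ∀ j, x j = ∑ i : {i // B.d i = 0}, (ζ i ⬝ᵥ x) * B.row i j) ∧
    ∀ x, (∀ i, B.d i = 0 → ζ i ⬝ᵥ x = 0) → B.π.mulVec x = x := by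
  classical
  let b : Module.Basis {i // B.d i = 0} ℂ (flat a J) :=
    (Module.Basis.span (B.linearIndependent_row ha)).map (LinearEquiv.ofEq _ _ (B.span_row ha))
  have hb : ∀ i, (b i : Fin n → ℂ) = B.row i := fun i => by
    simp only [b, Module.Basis.map_apply]
    change ((Module.Basis.span (B.linearIndependent_row ha) i : _) : Fin n → ℂ) = _
    rw [Module.Basis.span_apply]
  have hker : ∀ x, x - B.π.mulVec x ∈ flat a J := fun x => by
    rw [← B.π_ker, Matrix.mulVec_sub, Matrix.mulVec_mulVec, B.π_sq, sub_self]
  let P : (Fin n → ℂ) →ₗ[ℂ] flat a J :=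
    LinearMap.codRestrict _ (LinearMap.id - B.π.mulVecLin) hker
  have hPv : ∀ x, ((P x : flat a J) : Fin n → ℂ) = x - B.π.mulVec x := fun x => rfl
  let ζ : Fin n → Fin n → ℂ := fun i =>
    if h : B.d i = 0 then (dotProductEquiv ℂ (Fin n)).symm ((b.coord ⟨i, h⟩).comp P) else 0
  have hζ : ∀ i : {i // B.d i = 0}, ∀ x, ζ i ⬝ᵥ x = b.repr (P x) i := fun i x => by
    have : ζ i = (dotProductEquiv ℂ (Fin n)).symm ((b.coord i).comp P) := dif_pos i.2
    rw [this]
    exact congrFun (congrArg DFunLike.coe ((dotProductEquiv ℂ (Fin n)).apply_symm_apply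
      ((b.coord i).comp P))) x
  refine ⟨ζ, fun i => ?_, fun _ _ x hx j => ?_, fun x hx => ?_⟩
  · refine dotProduct_eq_zero _ fun v => ?_
    rw [← Matrix.dotProduct_mulVec]
    by_cases h : B.d i = 0
    · have hP0 : P (B.π.mulVec v) = 0 := Subtype.ext (by
        rw [hPv, Matrix.mulVec_mulVec, B.π_sq, sub_self]; rfl)
      rw [hζ ⟨i, h⟩, hP0, map_zero]
      rfl
    · have : ζ i = 0 := dif_neg h
      rw [this, zero_dotProduct]
  · have hPx : P x = ⟨x, hx⟩ := Subtype.ext (by rw [hPv, (B.π_ker x).mpr hx, sub_zero])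
    have h1 := congrArg Subtype.val (b.sum_repr (P x))
    rw [AddSubmonoidClass.coe_finsetSum] at h1
    have h2 := congrFun h1 j
    rw [Finset.sum_apply, hPx] at h2
    refine Eq.trans h2.symm (Finset.sum_congr rfl fun i _ => ?_)
    rw [hζ, hPx, ← hb]
    rfl
  · have h1 : P x = 0 := by
      apply b.repr.injective
      ext i
      rw [← hζ i x, hx i i.2]
      simp
    have h2 := congrArg Subtype.val h1
    rw [hPv] at h2
    exact (sub_eq_zero.mp h2).symm

/-- A combination acting trivially on all the forms involves only the constant rows. -/
theorem coeff_eq_zero_of_sum_q (ha : Reduced a) {f : Fin n → MvPolynomial (Fin n) ℂ}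
    (h : ∀ k ∈ J, ∑ i, f i * B.q i k = 0) {i : Fin n} (hi : B.d i ≠ 0) : f i = 0 := by
  classical
  let δ : Fin n → MvPolynomial (Fin n) ℂ := fun j => ∑ i, f i * B.χ i j
  have hδ : ∀ k ∈ J, app (a k) δ = 0 := fun k hk => by
    have : app (a k) δ = lin (a k) * ∑ i, f i * B.q i k := by
      simp only [app, δ, Finset.mul_sum]
      rw [Finset.sum_comm]
      refine Finset.sum_congr rfl fun i _ => ?_
      rw [mul_left_comm, ← B.app_eq i k hk, app, Finset.mul_sum]
      exact Finset.sum_congr rfl fun j _ => by ring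
    rw [this, h k hk, mul_zero]
  obtain ⟨ζ, -, hζ, -⟩ := B.exists_coords ha
  by_cases h0 : ∃ i, B.d i = 0
  · obtain ⟨i₀, hi₀⟩ := h0
    have h1 : ∀ j, δ j = ∑ i : {i // B.d i = 0}, app (ζ i) δ * B.χ i j := by
      intro j
      refine MvPolynomial.funext fun x => ?_
      have hx : (fun j => eval x (δ j)) ∈ flat a J := fun k hk => by
        have := congrArg (eval x) (hδ k hk)
        simpa [app, dotProduct] using this
      rw [hζ i₀ hi₀ _ hx j, map_sum]
      refine Finset.sum_congr rfl fun i _ => ?_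
      rw [B.χ_eq_C i.2, map_mul, eval_C]
      simp [app, dotProduct, row]
    have h2 := B.eq_zero_of_sum ha
      (f := fun i => f i - if B.d i = 0 then app (ζ i) δ else 0) fun j => by
      simp only [sub_mul, Finset.sum_sub_distrib]
      rw [sub_eq_zero]
      change δ j = _
      rw [h1 j, B.sum_eq_sum_row fun i hi => by rw [if_neg hi, zero_mul]]
      exact Finset.sum_congr rfl fun i _ => by rw [if_pos i.2]
    have := congrFun h2 i
    simpa [hi] using this
  · push Not at h0
    have h1 : ∀ j, δ j = 0 := by
      intro j
      refine MvPolynomial.funext fun x => ?_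
      have hx : (fun j => eval x (δ j)) ∈ flat a J := fun k hk => by
        have := congrArg (eval x) (hδ k hk)
        simpa [app, dotProduct] using this
      have hf : flat a J = ⊥ := by
        rw [← Submodule.finrank_eq_zero (R := ℂ), ← B.card_row ha]
        exact Fintype.card_eq_zero_iff.mpr ⟨fun i => h0 i i.2⟩
      rw [hf, Submodule.mem_bot] at hx
      simpa using congrFun hx j
    exact congrFun (B.eq_zero_of_sum ha h1) i

/-- Linear rows of an irreducible arrangement are multiples of the Euler field. -/
theorem q_eq_C (ha : Reduced a) (hirr : Irr a J) {i : Fin n} (hi : B.d i = 1) :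
    ∃ c : ℂ, ∀ k ∈ J, B.q i k = C c := by
  have hA' : ∀ j, ∃ u, B.χ i j = lin u := fun j => ⟨_, eq_lin_of_isHomogeneous (hi ▸ B.hom i j)⟩
  choose A hA using hA'
  have hq : ∀ k ∈ J, B.q i k = C (coeff 0 (B.q i k)) := fun k hk => by
    have := B.isHomogeneous_q ha i hk
    rw [hi] at this
    exact totalDegree_eq_zero_iff_eq_C.mp (Nat.le_zero.mp this.totalDegree_le)
  have hvm : ∀ k ∈ J, Matrix.vecMul (a k) (Matrix.of A) = coeff 0 (B.q i k) • a k := by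
    intro k hk
    apply lin_injective
    have h1 := B.app_eq i k hk
    rw [hq k hk, mul_comm, ← lin_smul] at h1
    rw [← h1, ← comp_lin, comp, aeval_lin]
    simp only [app, hA, algebraMap_eq]
    rfl
  rcases J.eq_empty_or_nonempty with rfl | ⟨k₀, hk₀⟩
  · exact ⟨0, by simp⟩
  · exact ⟨_, fun k hk => by rw [hq k hk, hirr.eigenvalue_eq hvm hk hk₀]⟩

theorem exists_degree_one (ha : Reduced a) (hirr : Irr a J) (hJ : J.Nonempty) :
    ∃ i₁, ∃ c : ℂ, c ≠ 0 ∧ B.d i₁ = 1 ∧ (∀ k ∈ J, B.q i₁ k = C c) ∧ ∀ i, B.d i = 1 → i = i₁ := by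
  classical
  obtain ⟨k₀, hk₀⟩ := hJ
  obtain ⟨f, -, hf⟩ := B.exists_coeff' ha (fun j => X j) (fun _ => 1) fun k hk => by
    simp [app, lin]
  have h1 := congrArg constantCoeff (hf k₀ hk₀)
  rw [map_one, map_sum] at h1
  obtain ⟨i₁, -, hi₁⟩ := Finset.exists_ne_zero_of_sum_ne_zero (h1 ▸ one_ne_zero)
  have hd : B.d i₁ = 1 := by
    by_contra hd
    rw [map_mul] at hi₁
    refine hi₁ ?_
    by_cases h0 : B.d i₁ = 0
    · rw [B.q_eq_zero ha h0 hk₀, map_zero, mul_zero]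
    · have h2 : constantCoeff (B.q i₁ k₀) = 0 := (B.isHomogeneous_q ha i₁ hk₀).coeff_eq_zero (by
        simp only [map_zero]
        omega)
      rw [h2, mul_zero]
  obtain ⟨c, hc⟩ := B.q_eq_C ha hirr hd
  have hc0 : c ≠ 0 := by
    rintro rfl
    rw [hc k₀ hk₀, C_0, mul_zero, map_zero] at hi₁
    exact hi₁ rfl
  refine ⟨i₁, c, hc0, hd, hc, fun i hi => ?_⟩
  by_contra hne
  obtain ⟨c', hc'⟩ := B.q_eq_C ha hirr hi
  have := B.coeff_eq_zero_of_sum_q ha (f := Pi.single i (C c) - Pi.single i₁ (C c'))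
    (fun k hk => by
      simp only [Pi.sub_apply, sub_mul, Finset.sum_sub_distrib, Pi.single_apply, ite_mul, zero_mul,
        Finset.sum_ite_eq', Finset.mem_univ, if_true, hc k hk, hc' k hk]
      ring)
    (i := i) (by rw [hi]; exact one_ne_zero)
  simp [hne] at this
  exact hc0 this

end Saito
end

section
variable {n : ℕ} {ι : Type} {a : ι → Fin n → ℂ}

/-- A generic point of a flat. -/
theorem exists_generic_point [Finite ι] {J : Finset ι} (hJ : IsFlat a J) :
    ∃ x ∈ flat a J, ∀ k, k ∉ J → a k ⬝ᵥ x ≠ 0 := by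
  by_contra! h
  let A : {k // k ∉ J} → Submodule ℂ (flat a J) := fun k =>
    Submodule.comap (flat a J).subtype (flat a {k.1})
  obtain ⟨k, hk⟩ := Subspace.exists_eq_top_of_iUnion_eq_univ (p := A)
    (Set.eq_univ_of_forall fun x => by
      obtain ⟨k, hk, hk'⟩ := h x.1 x.2
      refine Set.mem_iUnion.mpr ⟨⟨k, hk⟩, fun i hi => ?_⟩
      rw [Finset.mem_singleton.mp hi]
      exact hk')
  refine k.2 (hJ k fun v hv => ?_)
  have : (⟨v, hv⟩ : flat a J) ∈ A k := by rw [hk]; trivial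
  exact this k.1 (Finset.mem_singleton_self _)

/-- The vector fields tangent to all the hyperplanes. -/
noncomputable def logVec (a : ι → Fin n → ℂ) :
    Submodule (MvPolynomial (Fin n) ℂ) (Fin n → MvPolynomial (Fin n) ℂ) where
  carrier := {δ | ∀ k, lin (a k) ∣ app (a k) δ}
  add_mem' := fun hx hy k => by rw [app_add]; exact dvd_add (hx k) (hy k)
  zero_mem' := fun k => by simp [app]
  smul_mem' := fun r δ hδ k => by rw [app_smul]; exact (hδ k).mul_left r

theorem derivation_lin (χ : Derivation ℂ (MvPolynomial (Fin n) ℂ) (MvPolynomial (Fin n) ℂ))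
    (u : Fin n → ℂ) : χ (lin u) = app u fun j => χ (X j) := by
  simp [lin, app, C_mul']

theorem free_logVec (h : Module.Free (MvPolynomial (Fin n) ℂ) (DA fun k => lin (a k))) :
    Module.Free (MvPolynomial (Fin n) ℂ) (logVec a) := by
  let f : DA (fun k => lin (a k)) →ₗ[MvPolynomial (Fin n) ℂ] logVec a :=
    { toFun := fun χ => ⟨fun j => χ.1 (X j), fun k => by
        rw [← derivation_lin]
        exact Ideal.mem_span_singleton.mp (χ.2 k)⟩
      map_add' := fun χ χ' => rfl
      map_smul' := fun r χ => rfl }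
  refine Module.Free.of_equiv (LinearEquiv.ofBijective f ⟨fun χ χ' hχ => ?_, fun δ => ?_⟩)
  · refine Subtype.ext (MvPolynomial.derivation_ext fun j => ?_)
    exact congrFun (congrArg Subtype.val hχ) j
  · refine ⟨⟨mkDerivation ℂ δ.1, fun k => ?_⟩, ?_⟩
    · rw [derivation_lin, Ideal.mem_span_singleton]
      simpa using δ.2 k
    · refine Subtype.ext (funext fun j => ?_)
      exact mkDerivation_X ℂ δ.1 j

theorem exists_basis_matrix [Fintype ι] (ha : Reduced a)
    (h : Module.Free (MvPolynomial (Fin n) ℂ) (logVec a)) :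
    ∃ χ : Matrix (Fin n) (Fin n) (MvPolynomial (Fin n) ℂ),
      (∀ i k, lin (a k) ∣ app (a k) (χ i)) ∧
      ∀ M : Matrix (Fin n) (Fin n) (MvPolynomial (Fin n) ℂ),
        (∀ i k, lin (a k) ∣ app (a k) (M i)) → χ.det ∣ M.det := by
  have hr : Module.finrank (MvPolynomial (Fin n) ℂ) (logVec a) = n := by
    refine le_antisymm ?_ ?_
    · have := LinearMap.finrank_le_finrank_of_injective (logVec a).subtype_injective
      rwa [Module.finrank_fin_fun] at this
    · let g : (Fin n → MvPolynomial (Fin n) ℂ) →ₗ[MvPolynomial (Fin n) ℂ] logVec a :=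
        LinearMap.codRestrict _ (LinearMap.lsmul _ _ (∏ k, lin (a k))) fun δ k => by
          change _ ∣ app (a k) ((∏ k, lin (a k)) • δ)
          rw [app_smul]
          exact (Finset.dvd_prod_of_mem _ (Finset.mem_univ k)).mul_right _
      have hg : Function.Injective g := by
        intro δ δ' hδ
        have := congrArg Subtype.val hδ
        change (∏ k, lin (a k)) • δ = (∏ k, lin (a k)) • δ' at this
        ext1 j
        exact mul_left_cancel₀ (ha.prod_ne_zero Finset.univ) (congrFun this j)
      have := LinearMap.finrank_le_finrank_of_injective hg
      rwa [Module.finrank_fin_fun] at this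
  let b := Module.finBasisOfFinrankEq (MvPolynomial (Fin n) ℂ) (logVec a) hr
  refine ⟨Matrix.of fun i => (b i).1, fun i k => (b i).2 k, fun M hM => ?_⟩
  have : M = (Matrix.of fun i i' => b.repr ⟨M i, hM i⟩ i') *
      (Matrix.of fun i => (b i).1 : Matrix (Fin n) (Fin n) (MvPolynomial (Fin n) ℂ)) := by
    funext i j
    have h1 := congrArg Subtype.val (b.sum_repr ⟨M i, hM i⟩)
    rw [AddSubmonoidClass.coe_finsetSum] at h1
    have h2 := congrFun h1 j
    rw [Finset.sum_apply] at h2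
    exact h2.symm
  rw [this, Matrix.det_mul]
  exact dvd_mul_left _ _

theorem det_basis_matrix [Fintype ι] [Nonempty ι] (ha : Reduced a)
    {χ : Matrix (Fin n) (Fin n) (MvPolynomial (Fin n) ℂ)}
    (h1 : ∀ i k, lin (a k) ∣ app (a k) (χ i))
    (h2 : ∀ M : Matrix (Fin n) (Fin n) (MvPolynomial (Fin n) ℂ),
        (∀ i k, lin (a k) ∣ app (a k) (M i)) → χ.det ∣ M.det) :
    ∃ c : ℂ, c ≠ 0 ∧ χ.det = C c * ∏ k, lin (a k) := by
  classical
  obtain ⟨g, hg⟩ := ha.prod_dvd_det (J := Finset.univ) fun i k _ => h1 i k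
  have key : ∀ k₀, ∃ u : ℂ, u ≠ 0 ∧ ∃ N, g ∣ C u * (∏ k ∈ Finset.univ.erase k₀, lin (a k)) ^ N := by
    intro k₀
    obtain ⟨i₀, hi₀⟩ : ∃ i, a k₀ i ≠ 0 := by
      by_contra! h
      exact ha.ne_zero k₀ (funext h)
    set Q := ∏ k ∈ Finset.univ.erase k₀, lin (a k) with hQ
    have hF : lin (a k₀) * Q = ∏ k, lin (a k) := Finset.mul_prod_erase _ _ (Finset.mem_univ _)
    let U : Matrix (Fin n) (Fin n) ℂ := fun i =>
      if i = i₀ then Pi.single i₀ 1 else a k₀ i₀ • Pi.single i 1 - a k₀ i • Pi.single i₀ 1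
    have hU : U.det ≠ 0 := by
      intro h
      obtain ⟨v, hv, hv'⟩ := Matrix.exists_mulVec_eq_zero_iff.mpr h
      refine hv (funext fun i => ?_)
      have e0 : v i₀ = 0 := by
        have := congrFun hv' i₀
        simpa [Matrix.mulVec, U] using this
      by_cases hi : i = i₀
      · rw [hi]; exact e0
      · have h6 : U i ⬝ᵥ v = 0 := congrFun hv' i
        have h7 : U i = a k₀ i₀ • Pi.single i 1 - a k₀ i • Pi.single i₀ 1 := if_neg hi
        rw [h7, sub_dotProduct, smul_dotProduct, smul_dotProduct, single_dotProduct,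
          single_dotProduct, e0] at h6
        simpa [hi₀] using h6
    let w : Fin n → MvPolynomial (Fin n) ℂ := fun i => if i = i₀ then ∏ k, lin (a k) else Q
    let M : Matrix (Fin n) (Fin n) (MvPolynomial (Fin n) ℂ) :=
      Matrix.diagonal w * U.map C
    have hM : ∀ i, M i = w i • fun j => C (U i j) := fun i => by
      ext1 j
      simp [M, Matrix.diagonal_mul]
    have hMdet : M.det = (∏ k, lin (a k)) * (C U.det * Q ^ (n - 1)) := by
      rw [Matrix.det_mul, Matrix.det_diagonal, ← Finset.mul_prod_erase _ _ (Finset.mem_univ i₀),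
        Finset.prod_congr rfl (g := fun _ => Q)
          (fun i hi => if_neg (Finset.ne_of_mem_erase hi)), Finset.prod_const,
        Finset.card_erase_of_mem (Finset.mem_univ _), Finset.card_univ, Fintype.card_fin]
      have : (U.map (C : ℂ → MvPolynomial (Fin n) ℂ)).det = C U.det := by
        rw [← RingHom.mapMatrix_apply, ← RingHom.map_det]
      rw [this]
      simp only [w, if_true]
      ring
    have hlog : ∀ i k, lin (a k) ∣ app (a k) (M i) := by
      intro i k
      rw [hM, app_smul]
      by_cases hi : i = i₀
      · refine Dvd.dvd.mul_right ?_ _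
        simp only [w, hi, if_true]
        exact Finset.dvd_prod_of_mem _ (Finset.mem_univ k)
      · by_cases hk : k = k₀
        · rw [app_C, hk]
          have : a k₀ ⬝ᵥ U i = 0 := by
            simp [U, hi, dotProduct_sub, mul_comm]
          rw [this, C_0, mul_zero]
          exact dvd_zero _
        · refine Dvd.dvd.mul_right ?_ _
          simp only [w, hi, if_false]
          exact Finset.dvd_prod_of_mem _ (Finset.mem_erase.mpr ⟨hk, Finset.mem_univ k⟩)
    have h3 := h2 M hlog
    rw [hg, hMdet, mul_dvd_mul_iff_left (ha.prod_ne_zero _)] at h3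
    exact ⟨_, hU, _, h3⟩
  have hg0 : g ≠ 0 := by
    rintro rfl
    obtain ⟨u, hu, N, h⟩ := key (Classical.arbitrary ι)
    rw [zero_dvd_iff] at h
    refine mul_ne_zero (C_ne_zero.mpr hu) (pow_ne_zero _ ?_) h
    exact ha.prod_ne_zero _
  have hunit : IsUnit g := by
    by_contra hn
    obtain ⟨P, hP, hPg⟩ := WfDvdMonoid.exists_irreducible_factor hn hg0
    have hPp := hP.prime
    have hdvd : ∀ k₀, P ∣ ∏ k ∈ Finset.univ.erase k₀, lin (a k) := by
      intro k₀
      obtain ⟨u, hu, N, h⟩ := key k₀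
      have hCu : IsUnit (C u : MvPolynomial (Fin n) ℂ) := (isUnit_iff_ne_zero.mpr hu).map C
      have h' := hPg.trans h
      rw [hCu.dvd_mul_left] at h'
      exact hPp.dvd_of_dvd_pow h'
    obtain ⟨j, _, hj⟩ := hPp.exists_mem_finset_dvd (hdvd (Classical.arbitrary ι))
    have hass : Associated P (lin (a j)) :=
      hP.associated_of_dvd (prime_lin (ha.ne_zero j)).irreducible hj
    have h' := hass.symm.dvd.trans (hdvd j)
    obtain ⟨i, hi, hi'⟩ := (prime_lin (ha.ne_zero j)).exists_mem_finset_dvd h'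
    exact (Finset.mem_erase.mp hi).1 (ha.eq_of_dvd hi').symm
  obtain ⟨c, hc, rfl⟩ := MvPolynomial.isUnit_iff_eq_C_of_isReduced.mp hunit
  exact ⟨c, hc.ne_zero, by rw [hg, mul_comm]⟩

theorem exists_saito [Fintype ι] [Nonempty ι] (ha : Reduced a)
    (h : Module.Free (MvPolynomial (Fin n) ℂ) (DA fun k => lin (a k))) {J : Finset ι}
    (hJ : IsFlat a J) : Nonempty (Saito a J) := by
  classical
  obtain ⟨χ, h1, h2⟩ := exists_basis_matrix ha (free_logVec h)
  obtain ⟨c, hc, hdet⟩ := det_basis_matrix ha h1 h2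
  obtain ⟨x, hx, hx'⟩ := exists_generic_point hJ
  let tr : MvPolynomial (Fin n) ℂ →ₐ[ℂ] MvPolynomial (Fin n) ℂ :=
    aeval fun i => X i + C (x i)
  have htr : ∀ u, tr (lin u) = lin u + C (u ⬝ᵥ x) := fun u => by
    simp [tr, mul_add, Finset.sum_add_distrib, lin, dotProduct]
  have htrJ : ∀ k ∈ J, tr (lin (a k)) = lin (a k) := fun k hk => by
    rw [htr, hx k hk, C_0, add_zero]
  let χ' : Matrix (Fin n) (Fin n) (MvPolynomial (Fin n) ℂ) := χ.map tr
  have hχ'log : ∀ i, ∀ k ∈ J, lin (a k) ∣ app (a k) (χ' i) := fun i k hk => by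
    have := map_dvd tr (h1 i k)
    rw [htrJ k hk] at this
    convert this using 1
    simp only [app, map_sum, map_mul, χ', Matrix.map_apply]
    refine Finset.sum_congr rfl fun j _ => ?_
    congr 1
    exact (algHom_C tr _).symm
  have hχ'det : χ'.det = (C c * ∏ k ∈ Finset.univ \ J, tr (lin (a k))) * ∏ k ∈ J, lin (a k) := by
    have : χ'.det = tr χ.det := (AlgHom.map_det tr χ).symm
    rw [this, hdet, map_mul, map_prod, ← Finset.prod_sdiff (Finset.subset_univ J), algHom_C,
      mul_assoc, Finset.prod_congr rfl htrJ]
    rfl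
  let w : Fin n → ℕ := 1
  have hcomp : weightedHomogeneousComponent w J.card χ'.det ≠ 0 := by
    rw [hχ'det, weightedHomogeneousComponent_mul_of_isWeightedHomogeneous w _
      (isHomogeneous_prod_lin a J), if_pos le_rfl, Nat.sub_self]
    refine mul_ne_zero ?_ (ha.prod_ne_zero J)
    rw [weightedHomogeneousComponent_zero_eq_C w (by simp [w])]
    refine C_ne_zero.mpr ?_
    rw [← constantCoeff_eq, map_mul, map_prod, constantCoeff_C]
    refine mul_ne_zero hc (Finset.prod_ne_zero_iff.mpr fun k hk => ?_)
    rw [htr, map_add, constantCoeff_C, constantCoeff_eq,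
      (isHomogeneous_lin (a k)).coeff_eq_zero (by simp), zero_add]
    exact hx' k (Finset.mem_sdiff.mp hk).2
  -- decompose the rows into homogeneous components
  have hN : ∃ N, ∀ i j, χ' i j = ∑ e ∈ Finset.range N, weightedHomogeneousComponent w e (χ' i j) := by
    choose N hN using fun i j => sum_range_weightedHomogeneousComponent w (χ' i j)
    exact ⟨∑ i, ∑ j, N i j, fun i j => hN i j _ <|
      (Finset.single_le_sum (f := fun j => N i j) (fun _ _ => Nat.zero_le _)
        (Finset.mem_univ j)).trans
      (Finset.single_le_sum (f := fun i => ∑ j, N i j) (fun _ _ => Nat.zero_le _)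
        (Finset.mem_univ i))⟩
  obtain ⟨N, hN⟩ := hN
  let row : Fin n → ℕ → Fin n → MvPolynomial (Fin n) ℂ := fun i e j =>
    weightedHomogeneousComponent w e (χ' i j)
  have hexp : χ'.det = ∑ d ∈ Fintype.piFinset fun _ : Fin n => Finset.range N,
      (Matrix.of fun i => row i (d i)).det := by
    have h3 : χ' = fun i => ∑ e ∈ Finset.range N, row i e := by
      funext i j
      rw [Finset.sum_apply]
      exact hN i j
    change Matrix.detRowAlternating.toMultilinearMap χ' = _
    conv_lhs => rw [h3]
    exact MultilinearMap.map_sum_finset _ _ _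
  have hrow : ∀ i e j, (row i e j).IsHomogeneous e := fun i e j =>
    weightedHomogeneousComponent_mem w (χ' i j) e
  have hdethom : ∀ d : Fin n → ℕ, (Matrix.of fun i => row i (d i)).det.IsHomogeneous (∑ i, d i) := by
    intro d
    rw [Matrix.det_apply]
    refine IsHomogeneous.sum _ _ _ fun σ _ => ?_
    have h4 : (∏ i, (Matrix.of fun i => row i (d i)) (σ i) i).IsHomogeneous (∑ i, d (σ i)) :=
      IsHomogeneous.prod _ _ _ fun i _ => hrow _ _ _
    rw [Equiv.sum_comp σ d] at h4
    exact Submodule.smul_of_tower_mem (homogeneousSubmodule (Fin n) ℂ _) (Equiv.Perm.sign σ) h4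
  obtain ⟨d, hd, hd0⟩ : ∃ d : Fin n → ℕ, ∑ i, d i = J.card ∧
      (Matrix.of fun i => row i (d i)).det ≠ 0 := by
    by_contra! hcon
    apply hcomp
    rw [hexp, map_sum]
    refine Finset.sum_eq_zero fun d _ => ?_
    by_cases hd : ∑ i, d i = J.card
    · rw [hcon d hd, map_zero]
    · exact IsWeightedHomogeneous.weightedHomogeneousComponent_ne _ (hdethom d) (Ne.symm hd)
  have hrowlog : ∀ i, ∀ k ∈ J, lin (a k) ∣ app (a k) (row i (d i)) := by
    intro i k hk
    obtain ⟨g, hg⟩ := hχ'log i k hk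
    have h5 : app (a k) (row i (d i)) = weightedHomogeneousComponent w (d i) (app (a k) (χ' i)) := by
      rw [app, app, map_sum]
      exact Finset.sum_congr rfl fun j _ => by rw [weightedHomogeneousComponent_C_mul]
    rw [h5, hg, mul_comm, weightedHomogeneousComponent_mul_of_isWeightedHomogeneous w g
      (isHomogeneous_lin (a k))]
    split_ifs
    · exact dvd_mul_left _ _
    · exact dvd_zero _
  obtain ⟨π, hπ1, hπ2, hπ3, -, hπ4⟩ := exists_projection (a := a) (J₁ := J) (J₂ := ∅) (by
    rw [eq_top_iff]
    exact le_sup_of_le_right fun v _ k hk => absurd hk (Finset.notMem_empty k))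
  obtain ⟨g, hg⟩ := ha.prod_dvd_det (χ := Matrix.of fun i => row i (d i)) hrowlog
  have hgc : ∃ c' : ℂ, c' ≠ 0 ∧ g = C c' := by
    have hg0 : g ≠ 0 := by rintro rfl; rw [mul_zero] at hg; exact hd0 hg
    have e1 := (hdethom d).totalDegree hd0
    rw [hg, totalDegree_mul_of_isDomain (ha.prod_ne_zero J) hg0,
      (isHomogeneous_prod_lin a J).totalDegree (ha.prod_ne_zero J), hd] at e1
    have e2 : g.totalDegree = 0 := by omega
    refine ⟨coeff 0 g, fun h0 => hg0 ?_, totalDegree_eq_zero_iff_eq_C.mp e2⟩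
    rw [totalDegree_eq_zero_iff_eq_C.mp e2, h0, C_0]
  obtain ⟨c', hc', rfl⟩ := hgc
  let χ'' : Matrix (Fin n) (Fin n) (MvPolynomial (Fin n) ℂ) :=
    (Matrix.of fun i => row i (d i)).map (comp π)
  have hq : ∀ i k, ∃ q, k ∈ J → app (a k) (χ'' i) = lin (a k) * q := fun i k => by
    by_cases hk : k ∈ J
    · obtain ⟨q, hq⟩ := hrowlog i k hk
      refine ⟨comp π q, fun _ => ?_⟩
      have := congrArg (comp π) hq
      rw [map_mul, comp_lin, hπ3 k hk] at this
      rw [← this, app, app, map_sum]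
      exact Finset.sum_congr rfl fun j _ => by
        rw [map_mul, comp_C]
        rfl
    · exact ⟨0, fun h => absurd h hk⟩
  choose q hq using hq
  exact ⟨{
    χ := χ'', q := q, d := d, π := π, c := c'
    hom := fun i j => IsHomogeneous.comp (hrow i (d i) j)
    app_eq := fun i k hk => hq i k hk
    c_ne := hc'
    det_eq := by
      have : χ''.det = comp π (Matrix.of fun i => row i (d i)).det := (AlgHom.map_det _ _).symm
      rw [this, hg, map_mul, comp_C, map_prod, mul_comm]
      congr 1
      exact Finset.prod_congr rfl fun k hk => by rw [comp_lin, hπ3 k hk]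
    sum_d := hd
    π_sq := hπ1
    π_ker := hπ2
    π_form := hπ3
    π_trace := hπ4
    comp_χ := fun i j => comp_comp hπ1 _ }⟩

end

section
variable {n : ℕ} {ι : Type} {a : ι → Fin n → ℂ}

/-- The defining polynomial of a subarrangement. -/
noncomputable def dp (a : ι → Fin n → ℂ) (J : Finset ι) : MvPolynomial (Fin n) ℂ :=
  ∏ k ∈ J, lin (a k)

theorem eval_dp_eq_zero {J : Finset ι} {z : Fin n → ℂ} :
    eval z (dp a J) = 0 ↔ ∃ k ∈ J, a k ⬝ᵥ z = 0 := by
  simp [dp, Finset.prod_eq_zero_iff]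

theorem IsFlat.filter {J : Finset ι} (hJ : IsFlat a J) (z : Fin n → ℂ)
    [DecidablePred fun k => a k ⬝ᵥ z = 0] : IsFlat a (J.filter fun k => a k ⬝ᵥ z = 0) := by
  intro k hk
  refine Finset.mem_filter.mpr ⟨hJ k fun v hv => hk v fun i hi => hv i (Finset.mem_filter.mp hi).1,
    hk z fun i hi => (Finset.mem_filter.mp hi).2⟩

namespace Saito
variable {J : Finset ι} (B : Saito a J)

theorem zero_app (ha : Reduced a) {z ξ : Fin n → ℂ} {s : ι → ℂ}
    (h : ∀ i, ∑ j, eval z (B.χ i j) * ξ j = ∑ k ∈ J, s k * eval z (B.q i k))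
    {δ : Fin n → MvPolynomial (Fin n) ℂ} {r : ι → MvPolynomial (Fin n) ℂ}
    (hδ : ∀ k ∈ J, app (a k) δ = lin (a k) * r k) :
    ∑ j, eval z (δ j) * ξ j = ∑ k ∈ J, s k * eval z (r k) := by
  obtain ⟨c, hc, hr⟩ := B.exists_coeff' ha δ r hδ
  have h1 : ∑ k ∈ J, s k * eval z (r k) = ∑ k ∈ J, ∑ i, eval z (c i) * (s k * eval z (B.q i k)) :=
    Finset.sum_congr rfl fun k hk => by
      rw [hr k hk, map_sum, Finset.mul_sum]
      exact Finset.sum_congr rfl fun i _ => by rw [map_mul]; ring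
  rw [h1, Finset.sum_comm]
  simp_rw [← Finset.mul_sum, ← h, hc, map_sum, map_mul, Finset.sum_mul, Finset.mul_sum]
  rw [Finset.sum_comm]
  exact Finset.sum_congr rfl fun i _ => Finset.sum_congr rfl fun j _ => by ring

open Classical in
theorem zero_sigma (ha : Reduced a) {z ξ : Fin n → ℂ} {s : ι → ℂ}
    (h : ∀ i, ∑ j, eval z (B.χ i j) * ξ j = ∑ k ∈ J, s k * eval z (B.q i k)) :
    ∑ k ∈ J.filter fun k => a k ⬝ᵥ z = 0, s k = 0 := by
  set S := J.filter fun k => a k ⬝ᵥ z = 0 with hS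
  have hSJ : S ⊆ J := Finset.filter_subset _ _
  obtain ⟨T, -, hT2, hT3, -, -⟩ := exists_projection (a := a) (J₁ := S) (J₂ := ∅) (by
    rw [eq_top_iff]
    exact le_sup_of_le_right fun v _ k hk => absurd hk (Finset.notMem_empty k))
  have hTz : T.mulVec z = 0 := (hT2 z).mpr fun k hk => (Finset.mem_filter.mp hk).2
  have hF : eval z (dp a (J \ S)) ≠ 0 := by
    rw [Ne, eval_dp_eq_zero]
    rintro ⟨k, hk, hk'⟩
    exact (Finset.mem_sdiff.mp hk).2 (Finset.mem_filter.mpr ⟨(Finset.mem_sdiff.mp hk).1, hk'⟩)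
  have happ : ∀ u, app u (fun j => lin (T j)) = lin (Matrix.vecMul u T) := fun u => by
    rw [← comp_lin, comp, aeval_lin]
    rfl
  have h1 := B.zero_app ha h (δ := dp a (J \ S) • fun j => lin (T j))
    (r := fun k => if k ∈ S then dp a (J \ S) else dp a ((J \ S).erase k) * lin (Matrix.vecMul (a k) T))
    fun k hk => by
      rw [app_smul, happ]
      split_ifs with h2
      · rw [hT3 k h2, mul_comm]
      · rw [dp, ← Finset.mul_prod_erase _ _ (Finset.mem_sdiff.mpr ⟨hk, h2⟩), mul_assoc]
        rfl
  have h2 : ∑ j, eval z ((dp a (J \ S) • fun j => lin (T j)) j) * ξ j = 0 :=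
    Finset.sum_eq_zero fun j _ => by
      rw [Pi.smul_apply, smul_eq_mul, map_mul, eval_lin]
      have : T j ⬝ᵥ z = 0 := congrFun hTz j
      rw [this]
      ring
  rw [h2, ← Finset.sum_sdiff hSJ, Finset.sum_eq_zero, zero_add] at h1
  · rw [Finset.sum_congr rfl (g := fun k => s k * eval z (dp a (J \ S)))
      (fun k hk => by rw [if_pos hk]), ← Finset.sum_mul] at h1
    exact (mul_eq_zero.mp h1.symm).resolve_right hF
  · intro k hk
    rw [if_neg (Finset.mem_sdiff.mp hk).2, map_mul, eval_lin, ← Matrix.dotProduct_mulVec, hTz,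
      dotProduct_zero, mul_zero, mul_zero]

open Classical in
theorem zero_perp (ha : Reduced a) {z ξ : Fin n → ℂ}
    (h : ∀ i, ∑ j, eval z (B.χ i j) * ξ j = 0) {v : Fin n → ℂ}
    (hv : v ∈ flat a (J.filter fun k => a k ⬝ᵥ z = 0)) : v ⬝ᵥ ξ = 0 := by
  set S := J.filter fun k => a k ⬝ᵥ z = 0 with hS
  have hF : eval z (dp a (J \ S)) ≠ 0 := by
    rw [Ne, eval_dp_eq_zero]
    rintro ⟨k, hk, hk'⟩
    exact (Finset.mem_sdiff.mp hk).2 (Finset.mem_filter.mpr ⟨(Finset.mem_sdiff.mp hk).1, hk'⟩)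
  have h1 := B.zero_app ha (s := 0) (by simpa using h)
    (δ := dp a (J \ S) • fun j => C (v j))
    (r := fun k => if k ∈ S then 0 else dp a ((J \ S).erase k) * C (a k ⬝ᵥ v))
    fun k hk => by
      rw [app_smul, app_C]
      split_ifs with h2
      · rw [hv k h2, C_0]
        ring
      · rw [dp, ← Finset.mul_prod_erase _ _ (Finset.mem_sdiff.mpr ⟨hk, h2⟩), mul_assoc]
        rfl
  simp only [Pi.smul_apply, smul_eq_mul, map_mul, eval_C, Pi.zero_apply, zero_mul,
    Finset.sum_const_zero, mul_assoc, ← Finset.mul_sum] at h1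
  exact (mul_eq_zero.mp h1).resolve_left hF

/-- The specialization of the symbols `∑ₖ sₖ qᵢₖ`. -/
noncomputable def α (i : Fin n) (s : ι → ℂ) : MvPolynomial (Fin n) ℂ := ∑ k ∈ J, C (s k) * B.q i k

theorem eval_α (i : Fin n) (s : ι → ℂ) (z : Fin n → ℂ) :
    eval z (B.α i s) = ∑ k ∈ J, s k * eval z (B.q i k) := by
  simp [α]

theorem isHomogeneous_α (ha : Reduced a) (i : Fin n) (s : ι → ℂ) :
    (B.α i s).IsHomogeneous (B.d i - 1) :=
  IsHomogeneous.sum _ _ _ fun k hk => by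
    simpa using (isHomogeneous_C (Fin n) (s k)).mul (B.isHomogeneous_q ha i hk)

theorem comp_dp : comp B.π (dp a J) = dp a J := by
  rw [dp, map_prod]
  exact Finset.prod_congr rfl fun k hk => by rw [comp_lin, B.π_form k hk]

/-- The complete intersection attached to an irreducible arrangement at a residual parameter. -/
noncomputable def sys (ζ : Fin n → Fin n → ℂ) (s : ι → ℂ) (i : Fin n) : MvPolynomial (Fin n) ℂ :=
  if B.d i = 0 then lin (ζ i) else if B.d i = 1 then dp a J else B.α i s

theorem isHomogeneous_sys (ha : Reduced a) (ζ : Fin n → Fin n → ℂ) (s : ι → ℂ) (i : Fin n) :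
    (B.sys ζ s i).IsHomogeneous
      (if B.d i = 0 then 1 else if B.d i = 1 then J.card else B.d i - 1) := by
  simp only [sys]
  split_ifs
  · exact isHomogeneous_lin _
  · exact isHomogeneous_prod_lin a J
  · exact B.isHomogeneous_α ha i s

theorem eq_zero_of_eval_sys (ha : Reduced a) (hirr : Irr a J) (hne : J.Nonempty) (hJ : IsFlat a J)
    {ζ : Fin n → Fin n → ℂ} (hζ : ∀ x, (∀ i, B.d i = 0 → ζ i ⬝ᵥ x = 0) → B.π.mulVec x = x)
    {s : ι → ℂ} (hs : ∑ k ∈ J, s k = 0)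
    (hs' : ∀ S : Finset ι, S ⊆ J → S ≠ J → S.Nonempty → IsFlat a S → ∑ k ∈ S, s k ≠ 0)
    {z : Fin n → ℂ} (hz : ∀ i, eval z (B.sys ζ s i) = 0) : z = 0 := by
  classical
  obtain ⟨i₁, c, hc, hi₁, hq, hu⟩ := B.exists_degree_one ha hirr hne
  have hα : ∀ i, ∑ k ∈ J, s k * eval z (B.q i k) = 0 := by
    intro i
    by_cases h0 : B.d i = 0
    · exact Finset.sum_eq_zero fun k hk => by rw [B.q_eq_zero ha h0 hk, map_zero, mul_zero]
    by_cases h1 : B.d i = 1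
    · rw [hu i h1, Finset.sum_congr rfl fun k hk => by rw [hq k hk], ← Finset.sum_mul, hs,
        zero_mul]
    · have := hz i
      rwa [sys, if_neg h0, if_neg h1, eval_α] at this
  have hF : eval z (dp a J) = 0 := by
    have := hz i₁
    rwa [sys, if_neg (by omega), if_pos hi₁] at this
  obtain ⟨k, hk, hkz⟩ := eval_dp_eq_zero.mp hF
  have h1 := B.zero_sigma ha (z := z) (ξ := 0) (s := s) (by simpa using fun i => (hα i).symm)
  have h2 : J.filter (fun k => a k ⬝ᵥ z = 0) = J := by
    by_contra hne'
    exact hs' _ (Finset.filter_subset _ _) hne' ⟨k, Finset.mem_filter.mpr ⟨hk, hkz⟩⟩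
      (hJ.filter z) h1
  have h3 : z ∈ flat a J := fun k hk => by
    rw [← h2] at hk
    exact (Finset.mem_filter.mp hk).2
  rw [← hζ z fun i hi => by simpa [sys, hi] using hz i]
  exact (B.π_ker z).mpr h3

theorem sys_socle (ha : Reduced a) (hirr : Irr a J) (hne : J.Nonempty) (hJ : IsFlat a J)
    {ζ : Fin n → Fin n → ℂ} (hζ : ∀ x, (∀ i, B.d i = 0 → ζ i ⬝ᵥ x = 0) → B.π.mulVec x = x)
    {s : ι → ℂ} (hs : ∑ k ∈ J, s k = 0)
    (hs' : ∀ S : Finset ι, S ⊆ J → S ≠ J → S.Nonempty → IsFlat a S → ∑ k ∈ S, s k ≠ 0) (d : ℕ) :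
    (homogeneousSubmodule (Fin n) ℂ d ≤
      (Ideal.span (Set.range (B.sys ζ s))).restrictScalars ℂ) ↔
      2 * (J.card - (n - Module.finrank ℂ (flat a J))) < d := by
  classical
  obtain ⟨i₁, c, hc, hi₁, hq, hu⟩ := B.exists_degree_one ha hirr hne
  have hJc : J.card ≠ 0 := Finset.card_ne_zero.mpr hne
  let e : Fin n → ℕ := fun i => if B.d i = 0 then 1 else if B.d i = 1 then J.card else B.d i - 1
  have hsum : ∑ i, (e i - 1) = 2 * (J.card - (n - Module.finrank ℂ (flat a J))) := by
    have h1 : ∀ i, ((e i - 1 : ℕ) : ℤ) = (B.d i - 2) + (if B.d i = 0 then 2 else 0) +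
        if i = i₁ then (J.card : ℤ) else 0 := by
      intro i
      by_cases h : i = i₁
      · subst h
        simp only [e, hi₁, if_true, one_ne_zero, if_false]
        omega
      · have h2 : B.d i ≠ 1 := fun h3 => h (hu i h3)
        simp only [e, h, h2, if_false]
        split_ifs with h3 <;> omega
    have h2 : ((∑ i, (e i - 1) : ℕ) : ℤ) =
        2 * (J.card : ℤ) - 2 * (n - Module.finrank ℂ (flat a J)) := by
      rw [Nat.cast_sum, Finset.sum_congr rfl fun i _ => h1 i, Finset.sum_add_distrib,
        Finset.sum_add_distrib, Finset.sum_sub_distrib, Finset.sum_ite_eq', ← Finset.sum_filter,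
        Finset.sum_const, Finset.sum_const, ← Fintype.card_subtype, B.card_row ha,
        ← Nat.cast_sum, B.sum_d]
      simp
      ring
    have h3 : Module.finrank ℂ (flat a J) ≤ n := by
      simpa using Submodule.finrank_le (flat a J)
    omega
  rw [← hsum]
  refine socle_degree (fun i => ?_) (B.isHomogeneous_sys ha ζ s)
    (fun z hz => B.eq_zero_of_eval_sys ha hirr hne hJ hζ hs hs' hz) d
  split_ifs <;> omega

end Saito
end

section
variable {n : ℕ} {ι : Type}

theorem isWeightedHomogeneous_rename {σ τ : Type} {w : τ → ℕ} {f : σ → τ} {p : MvPolynomial σ ℂ}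
    {e : ℕ} (hp : p.IsHomogeneous e) (hf : ∀ i, w (f i) = 1) :
    IsWeightedHomogeneous w (rename f p) e := by
  rw [p.as_sum, map_sum]
  refine IsWeightedHomogeneous.sum _ _ _ fun d hd => ?_
  rw [rename_monomial]
  refine isWeightedHomogeneous_monomial _ _ _ ?_
  have h := hp (mem_support_iff.mp hd)
  rw [Finsupp.weight_apply, Finsupp.sum_mapDomain_index (by simp) (by intros; simp [add_mul]), ← h,
    Finsupp.weight_apply]
  exact Finsupp.sum_congr fun i _ => by simp [hf]

/-- The variables `x`, `s` and `ξ`. -/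
abbrev Symb (n : ℕ) (ι : Type) : Type := (Fin n ⊕ ι) ⊕ Fin n

/-- Polynomials in `x` inside the polynomials in `x`, `s` and `ξ`. -/
noncomputable def ix : MvPolynomial (Fin n) ℂ →ₐ[ℂ] MvPolynomial (Symb n ι) ℂ :=
  rename (Sum.inl ∘ Sum.inl)

theorem eval_ix (z : Symb n ι → ℂ) (p : MvPolynomial (Fin n) ℂ) :
    eval z (ix p : MvPolynomial (Symb n ι) ℂ) = eval (fun i => z (Sum.inl (Sum.inl i))) p :=
  eval_rename _ _ _

/-- The weights of the variables for which the symbols are homogeneous. -/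
def symbWeight : Symb n ι → ℕ := Sum.elim (Sum.elim (fun _ => 1) fun _ => 2) fun _ => 1

theorem symbWeight_ne (i : Symb n ι) : symbWeight i ≠ 0 := by
  rcases i with (i | i) | i <;> simp [symbWeight]

theorem isWeightedHomogeneous_ix {p : MvPolynomial (Fin n) ℂ} {e : ℕ} (hp : p.IsHomogeneous e) :
    IsWeightedHomogeneous symbWeight (ix p : MvPolynomial (Symb n ι) ℂ) e :=
  isWeightedHomogeneous_rename hp fun _ => rfl

variable {a : ι → Fin n → ℂ}

/-- The pairs `(x, ξ)` with `x` in the flat of `S` and `ξ` orthogonal to it. -/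
def conormal (a : ι → Fin n → ℂ) (S : Finset ι) : Submodule ℂ (Fin n ⊕ Fin n → ℂ) where
  carrier := {u | u ∘ Sum.inl ∈ flat a S ∧ ∀ v ∈ flat a S, v ⬝ᵥ (u ∘ Sum.inr) = 0}
  add_mem' := fun {u v} hu hv => ⟨add_mem hu.1 hv.1, fun x hx => by
    rw [Pi.add_comp, dotProduct_add, hu.2 x hx, hv.2 x hx, add_zero]⟩
  zero_mem' := ⟨zero_mem _, fun v _ => dotProduct_zero v⟩
  smul_mem' := fun c u hu => ⟨Submodule.smul_mem _ c hu.1, fun x hx => by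
    rw [Pi.smul_comp, dotProduct_smul, hu.2 x hx, smul_zero]⟩

theorem finrank_conormal_le (S : Finset ι) : Module.finrank ℂ (conormal a S) ≤ n := by
  let f : conormal a S →ₗ[ℂ] flat a S × (flat a S).dualAnnihilator :=
    { toFun := fun u => ⟨⟨_, u.2.1⟩, ⟨dotProductEquiv ℂ (Fin n) (u.1 ∘ Sum.inr), by
        rw [Submodule.mem_dualAnnihilator]
        intro v hv
        simpa [dotProduct_comm] using u.2.2 v hv⟩⟩
      map_add' := fun u v => by
        ext1
        · rfl
        · apply Subtype.ext
          exact map_add (dotProductEquiv ℂ (Fin n)) _ _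
      map_smul' := fun c u => by
        ext1
        · rfl
        · apply Subtype.ext
          exact map_smul (dotProductEquiv ℂ (Fin n)) c _ }
  have hf : Function.Injective f := by
    rw [← LinearMap.ker_eq_bot, LinearMap.ker_eq_bot']
    intro u hu
    have h1 : u.1 ∘ Sum.inl = 0 := congrArg (fun z => z.1.1) hu
    have h2 : dotProductEquiv ℂ (Fin n) (u.1 ∘ Sum.inr) = 0 := congrArg (fun z => z.2.1) hu
    rw [LinearEquiv.map_eq_zero_iff] at h2
    apply Subtype.ext
    funext i
    rcases i with i | i
    · exact congrFun h1 i
    · exact congrFun h2 i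
  have h := LinearMap.finrank_le_finrank_of_injective hf
  rwa [Module.finrank_prod, Subspace.finrank_add_finrank_dualAnnihilator_eq,
    Module.finrank_fin_fun] at h

namespace Saito
variable {J : Finset ι} (B : Saito a J)

/-- The symbols of the operators annihilating the twist. -/
noncomputable def t (i : Fin n) : MvPolynomial (Symb n ι) ℂ :=
  ∑ j, ix (B.χ i j) * X (Sum.inr j) - ∑ k ∈ J, X (Sum.inl (Sum.inr k)) * ix (B.q i k)

/-- The ideal of the symbols. -/
noncomputable def tI : Ideal (MvPolynomial (Symb n ι) ℂ) := Ideal.ofList (List.ofFn B.t)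

theorem t_mem (i : Fin n) : B.t i ∈ B.tI := Ideal.subset_span (by simp)

theorem eval_t_eq_zero {z : Symb n ι → ℂ} {i : Fin n} : eval z (B.t i) = 0 ↔
    ∑ j, eval (fun i => z (Sum.inl (Sum.inl i))) (B.χ i j) * z (Sum.inr j) =
      ∑ k ∈ J, z (Sum.inl (Sum.inr k)) * eval (fun i => z (Sum.inl (Sum.inl i))) (B.q i k) := by
  simp [t, eval_ix, sub_eq_zero]

theorem isWeightedHomogeneous_t (ha : Reduced a) (i : Fin n) :
    IsWeightedHomogeneous symbWeight (B.t i) (B.d i + 1) := by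
  refine Submodule.sub_mem (weightedHomogeneousSubmodule ℂ symbWeight (B.d i + 1)) ?_ ?_
  · exact IsWeightedHomogeneous.sum _ _ _ fun j _ =>
      (isWeightedHomogeneous_ix (B.hom i j)).mul (isWeightedHomogeneous_X ℂ symbWeight _)
  · refine IsWeightedHomogeneous.sum _ _ _ fun k hk => ?_
    by_cases hd : B.d i = 0
    · rw [B.q_eq_zero ha hd hk, map_zero, mul_zero]
      exact isWeightedHomogeneous_zero _ _ _
    · have := (isWeightedHomogeneous_X ℂ (symbWeight (n := n)) (Sum.inl (Sum.inr k))).mul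
        (isWeightedHomogeneous_ix (B.isHomogeneous_q ha i hk))
      have h2 : symbWeight (n := n) (Sum.inl (Sum.inr k)) + (B.d i - 1) = B.d i + 1 := by
        simp [symbWeight]; omega
      rwa [h2] at this

variable [Fintype ι]

theorem exists_xi_cuts (ha : Reduced a) : ∃ hs : List (MvPolynomial (Symb n ι) ℂ),
    hs.length = n ∧ (∀ h ∈ hs, eval 0 h = 0) ∧
    ∀ z : Symb n ι → ℂ, (∀ i, eval z (B.t i) = 0) → (∀ k, z (Sum.inl (Sum.inr k)) = 0) →
      (∀ h ∈ hs, eval z h = 0) → z = 0 := by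
  classical
  obtain ⟨us, hus, h⟩ := exists_generic_forms n (conormal a) fun S => finrank_conormal_le S
  refine ⟨us.map fun u => rename (Sum.elim (Sum.inl ∘ Sum.inl) Sum.inr) (lin u), by simpa,
    by
      simp only [List.mem_map, forall_exists_index, and_imp, forall_apply_eq_imp_iff₂, eval_rename]
      intro u _
      rw [eval_lin]
      exact Finset.sum_eq_zero fun i _ => by simp, fun z ht hs hz => ?_⟩
  set u : Fin n ⊕ Fin n → ℂ := z ∘ Sum.elim (Sum.inl ∘ Sum.inl) Sum.inr with hu
  have hu0 : u = 0 := by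
    refine h (J.filter fun k => a k ⬝ᵥ (u ∘ Sum.inl) = 0) u
      ⟨fun k hk => (Finset.mem_filter.mp hk).2, fun v hv => ?_⟩ fun u' hu' => ?_
    · refine B.zero_perp ha (z := u ∘ Sum.inl) (fun i => ?_) hv
      have := B.eval_t_eq_zero.mp (ht i)
      simp only [hs, zero_mul, Finset.sum_const_zero] at this
      exact this
    · have := hz _ (List.mem_map.mpr ⟨u', hu', rfl⟩)
      rwa [eval_rename, eval_lin] at this
  funext i
  rcases i with (i | i) | i
  · exact congrFun hu0 (Sum.inl i)
  · exact hs i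
  · exact congrFun hu0 (Sum.inr i)

/-- The linear form in the variables `s` with the given coefficients. -/
noncomputable def sform (u : ι → ℂ) : MvPolynomial (Symb n ι) ℂ :=
  rename (Sum.inl ∘ Sum.inr) (lin u)

theorem eval_sform (z : Symb n ι → ℂ) (u : ι → ℂ) :
    eval z (sform u : MvPolynomial (Symb n ι) ℂ) = u ⬝ᵥ fun k => z (Sum.inl (Sum.inr k)) := by
  rw [sform, eval_rename, eval_lin]
  rfl

theorem exists_cuts (ha : Reduced a) (hJ : J.Nonempty) :
    ∃ hs : List (MvPolynomial (Symb n ι) ℂ), n + 1 + hs.length = Fintype.card (Symb n ι) ∧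
      (∀ h ∈ hs, eval 0 h = 0) ∧
      ∀ z : Symb n ι → ℂ, (∀ i, eval z (B.t i) = 0) → eval z (ix (dp a J) : MvPolynomial (Symb n ι) ℂ) = 0 →
      (∀ h ∈ hs, eval z h = 0) → z = 0 := by
  classical
  obtain ⟨k₀, hk₀⟩ := hJ
  obtain ⟨hs, hl, h0, h⟩ := B.exists_xi_cuts ha
  let u : ι → ι → ℂ := fun k => if k ∈ J then Pi.single k 1 - Pi.single k₀ 1 else Pi.single k 1
  refine ⟨(Finset.univ.erase k₀).toList.map (fun k => sform (u k)) ++ hs, ?_, ?_, ?_⟩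
  · have : 0 < Fintype.card ι := Fintype.card_pos_iff.mpr ⟨k₀⟩
    simp [hl]
    omega
  · intro p hp
    rcases List.mem_append.mp hp with hp | hp
    · obtain ⟨k, -, rfl⟩ := List.mem_map.mp hp
      rw [eval_sform]
      exact Finset.sum_eq_zero fun i _ => by simp
    · exact h0 p hp
  · intro z ht hF hz
    refine h z ht ?_ fun p hp => hz p (List.mem_append.mpr (Or.inr hp))
    have h1 : ∀ k, k ≠ k₀ → u k ⬝ᵥ (fun k => z (Sum.inl (Sum.inr k))) = 0 := fun k hk => by
      rw [← eval_sform]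
      exact hz _ (List.mem_append.mpr (Or.inl (List.mem_map.mpr ⟨k, by simpa, rfl⟩)))
    have h2 : ∀ k ∈ J, z (Sum.inl (Sum.inr k)) = z (Sum.inl (Sum.inr k₀)) := fun k hk => by
      by_cases hkk : k = k₀
      · rw [hkk]
      · have := h1 k hkk
        simpa [u, hk, sub_dotProduct, sub_eq_zero] using this
    have h3 := B.zero_sigma ha fun i => B.eval_t_eq_zero.mp (ht i)
    rw [eval_ix, eval_dp_eq_zero] at hF
    obtain ⟨k₁, hk₁, hk₁'⟩ := hF
    rw [Finset.sum_congr rfl fun k hk => h2 k (Finset.mem_filter.mp hk).1, Finset.sum_const,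
      nsmul_eq_mul, mul_eq_zero, Nat.cast_eq_zero, Finset.card_eq_zero] at h3
    have h4 : z (Sum.inl (Sum.inr k₀)) = 0 := by
      refine h3.resolve_left fun h => ?_
      have : k₁ ∈ (∅ : Finset ι) := h ▸ Finset.mem_filter.mpr ⟨hk₁, hk₁'⟩
      simp at this
    intro k
    by_cases hk : k ∈ J
    · rw [h2 k hk, h4]
    · have := h1 k fun h => hk (h ▸ hk₀)
      simpa [u, hk] using this

theorem eval_zero_t (ha : Reduced a) (i : Fin n) : eval 0 (B.t i) = 0 :=
  B.eval_t_eq_zero.mpr (by simp)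

theorem eval_zero_dp (hJ : J.Nonempty) : eval 0 (ix (dp a J) : MvPolynomial (Symb n ι) ℂ) = 0 := by
  obtain ⟨k, hk⟩ := hJ
  rw [eval_ix, eval_dp_eq_zero]
  exact ⟨k, hk, dotProduct_zero _⟩

theorem mem_tI_of_mul_mem (ha : Reduced a) {v : MvPolynomial (Symb n ι) ℂ}
    (hv : ix (dp a J) * v ∈ B.tI) : v ∈ B.tI := by
  rcases J.eq_empty_or_nonempty with hJ | hJ
  · simpa [hJ, dp] using hv
  obtain ⟨hs, hl, h0, h⟩ := B.exists_cuts ha hJ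
  refine mem_ofList_of_mul_mem symbWeight_ne (List.ofFn B.t) hs (ix (dp a J)) ?_ ?_
    (eval_zero_dp hJ) h0 (fun z h1 => h z fun i => h1 _ (by simp)) (by rw [← hl]; simp) v hv
  · intro g hg
    obtain ⟨i, rfl⟩ := (List.mem_ofFn' _ _).mp hg
    exact ⟨_, B.isWeightedHomogeneous_t ha i⟩
  · intro g hg
    obtain ⟨i, rfl⟩ := (List.mem_ofFn' _ _).mp hg
    exact B.eval_zero_t ha i

/-- The ideal of the symbols and the defining polynomial. -/
noncomputable def tF : Ideal (MvPolynomial (Symb n ι) ℂ) :=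
  Ideal.ofList (List.ofFn B.t ++ [ix (dp a J)])

theorem tI_le_tF : B.tI ≤ B.tF := by
  rw [tF, Ideal.ofList_append]
  exact le_sup_left

theorem dp_mem_tF : (ix (dp a J) : MvPolynomial (Symb n ι) ℂ) ∈ B.tF := Ideal.subset_span (by simp)

theorem mem_tF_of_ann (ha : Reduced a) (I : Ideal (MvPolynomial (Symb n ι) ℂ)) (us : List (ι → ℂ))
    (hus : us.length + 2 ≤ Fintype.card ι) (ht : ∀ i, B.t i ∈ I)
    (hz : ∀ z : Symb n ι → ℂ, (∀ p ∈ I, eval z p = 0) →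
      (∀ u ∈ us, u ⬝ᵥ (fun k => z (Sum.inl (Sum.inr k))) = 0) → ∀ k, z (Sum.inl (Sum.inr k)) = 0)
    {v : MvPolynomial (Symb n ι) ℂ} (hv : ∀ x ∈ I, x * v ∈ B.tF) : v ∈ B.tF := by
  rcases J.eq_empty_or_nonempty with hJ | hJ
  · have := B.tF.mul_mem_left v B.dp_mem_tF
    simpa [hJ, dp] using this
  obtain ⟨hs, hl, h0, h⟩ := B.exists_cuts ha hJ
  obtain ⟨hs', hl', h0', h'⟩ := B.exists_xi_cuts ha
  refine mem_ofList_of_zeros symbWeight_ne (List.ofFn B.t ++ [ix (dp a J)]) hs ?_ ?_ h0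
    (fun z h1 => h z (fun i => h1 _ (by simp)) (h1 _ (by simp))) (by rw [← hl]; simp)
    I (us.map sform ++ hs') ?_ ?_ (by simp [hl']; omega) v hv
  · intro g hg
    rcases List.mem_append.mp hg with hg | hg
    · obtain ⟨i, rfl⟩ := (List.mem_ofFn' _ _).mp hg
      exact ⟨_, B.isWeightedHomogeneous_t ha i⟩
    · rw [List.mem_singleton.mp hg]
      exact ⟨_, isWeightedHomogeneous_ix (isHomogeneous_prod_lin _ _)⟩
  · intro g hg
    rcases List.mem_append.mp hg with hg | hg
    · obtain ⟨i, rfl⟩ := (List.mem_ofFn' _ _).mp hg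
      exact B.eval_zero_t ha i
    · rw [List.mem_singleton.mp hg]
      exact eval_zero_dp hJ
  · intro g hg
    rcases List.mem_append.mp hg with hg | hg
    · obtain ⟨u, -, rfl⟩ := List.mem_map.mp hg
      rw [eval_sform]
      exact Finset.sum_eq_zero fun i _ => by simp
    · exact h0' g hg
  · intro z h1 h2
    refine h' z (fun i => h1 _ (ht i)) (hz z h1 fun u hu => ?_)
      fun p hp => h2 p (List.mem_append.mpr (Or.inr hp))
    rw [← eval_sform]
    exact h2 _ (List.mem_append.mpr (Or.inl (List.mem_map.mpr ⟨u, hu, rfl⟩)))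

end Saito
end

section
variable {σ τ : Type} {K : Type} [CommRing K] {w : σ → ℕ} {v : τ → ℕ}

theorem finsupp_induction_single {P : (σ →₀ ℕ) → Prop} (h0 : P 0)
    (hs : ∀ i m, P m → P (m + Finsupp.single i 1)) (m : σ →₀ ℕ) : P m := by
  classical
  suffices h : ∀ u : Multiset σ, P (Multiset.toFinsupp u) by
    simpa using h (Finsupp.toMultiset m)
  intro u
  induction u using Multiset.induction_on with
  | empty => simpa
  | cons i u ih =>
    rw [← Multiset.singleton_add, map_add, Multiset.toFinsupp_singleton, add_comm]
    exact hs i _ ih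

theorem weight_add_single (m : σ →₀ ℕ) (i : σ) :
    Finsupp.weight w (m + Finsupp.single i 1) = Finsupp.weight w m + w i := by
  simp [Finsupp.weight_apply, Finsupp.sum_add_index', add_mul]

variable (K) in
/-- The polynomials all of whose monomials have weight less than `d`. -/
def low (w : σ → ℕ) (d : ℕ) : Submodule K (MvPolynomial σ K) where
  carrier := {g | ∀ m, coeff m g ≠ 0 → Finsupp.weight w m < d}
  add_mem' := fun {f g} hf hg m hm => by
    by_cases h : coeff m f = 0
    · exact hg m (by simpa [h] using hm)
    · exact hf m h
  zero_mem' := fun m hm => absurd (coeff_zero m) hm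
  smul_mem' := fun c f hf m hm => hf m fun h => hm (by simp [h])

theorem low_mono {d e : ℕ} (h : d ≤ e) : low K w d ≤ low K w e :=
  fun _ hg m hm => (hg m hm).trans_le h

theorem monomial_mem_low {m : σ →₀ ℕ} {d : ℕ} (h : Finsupp.weight w m < d) (c : K) :
    monomial m c ∈ low K w d := fun m' hm' => by
  classical
  rw [coeff_monomial] at hm'
  split_ifs at hm' with h1
  · exact h1 ▸ h
  · exact absurd rfl hm'

theorem low_induction {d : ℕ} {P : MvPolynomial σ K → Prop} (h0 : P 0)
    (hadd : ∀ f g, P f → P g → P (f + g))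
    (hm : ∀ m c, Finsupp.weight w m < d → P (monomial m c)) {g : MvPolynomial σ K}
    (hg : g ∈ low K w d) : P g := by
  rw [g.as_sum]
  exact Finset.sum_induction _ P hadd h0 fun m h => hm m _ (hg m (mem_support_iff.mp h))

theorem exists_mem_low (g : MvPolynomial σ K) : ∃ d, g ∈ low K w d := by
  refine ⟨g.support.sup (Finsupp.weight w) + 1, fun m hm => ?_⟩
  exact Nat.lt_succ_of_le (Finset.le_sup (f := Finsupp.weight w) (mem_support_iff.mpr hm))

theorem mem_low_zero {g : MvPolynomial σ K} (hg : g ∈ low K w 0) : g = 0 := by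
  ext m
  by_contra h
  exact absurd (hg m (by simpa using h)) (Nat.not_lt_zero _)

theorem IsWeightedHomogeneous.mem_low {g : MvPolynomial σ K} {d e : ℕ}
    (hg : IsWeightedHomogeneous w g d) (h : d < e) : g ∈ low K w e :=
  fun m hm => (hg hm).trans_lt h

theorem mul_mem_low {f g : MvPolynomial σ K} {d e : ℕ} (hf : f ∈ low K w d)
    (hg : g ∈ low K w (e + 1)) : f * g ∈ low K w (d + e) := by
  intro m hm
  classical
  rw [coeff_mul] at hm
  obtain ⟨⟨x, y⟩, hxy, h⟩ := Finset.exists_ne_zero_of_sum_ne_zero hm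
  have h1 := hf x (left_ne_zero_of_mul h)
  have h2 := hg y (right_ne_zero_of_mul h)
  rw [← Finset.HasAntidiagonal.mem_antidiagonal.mp hxy, map_add]
  dsimp only
  omega

theorem sub_component_mem_low {g : MvPolynomial σ K} {d : ℕ} (hg : g ∈ low K w (d + 1)) :
    g - weightedHomogeneousComponent w d g ∈ low K w d := by
  classical
  intro m hm
  rw [coeff_sub, coeff_weightedHomogeneousComponent] at hm
  split_ifs at hm with h
  · simp at hm
  · have := hg m (by simpa using hm)
    omega

theorem component_eq_zero_of_mem_low {g : MvPolynomial σ K} {d e : ℕ} (hg : g ∈ low K w d)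
    (h : d ≤ e) : weightedHomogeneousComponent w e g = 0 := by
  classical
  ext m
  rw [coeff_weightedHomogeneousComponent, coeff_zero, ite_eq_right_iff]
  intro hm
  by_contra h1
  have := hg m h1
  omega

theorem component_mul {f g : MvPolynomial σ K} {d e : ℕ} (hf : f ∈ low K w (d + 1))
    (hg : g ∈ low K w (e + 1)) : weightedHomogeneousComponent w (d + e) (f * g) =
      weightedHomogeneousComponent w d f * weightedHomogeneousComponent w e g := by
  set f' := weightedHomogeneousComponent w d f with hf'
  set g' := weightedHomogeneousComponent w e g with hg'
  have h1 : f * g = f' * g' + ((f - f') * g + f' * (g - g')) := by ring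
  have hfh : IsWeightedHomogeneous w f' d := weightedHomogeneousComponent_isWeightedHomogeneous _ _
  have hgh : IsWeightedHomogeneous w g' e := weightedHomogeneousComponent_isWeightedHomogeneous _ _
  rw [h1, map_add, (hfh.mul hgh).weightedHomogeneousComponent_same,
    component_eq_zero_of_mem_low (d := d + e) _ le_rfl, add_zero]
  refine add_mem (mul_mem_low (sub_component_mem_low hf) hg) ?_
  rw [mul_comm, add_comm]
  exact mul_mem_low (sub_component_mem_low hg) (IsWeightedHomogeneous.mem_low hfh (Nat.lt_succ_self d))

theorem pderiv_mem_low {g : MvPolynomial σ K} {d : ℕ} (hg : g ∈ low K w d) (i : σ) :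
    pderiv i g ∈ low K w d := by
  refine low_induction (w := w) (d := d) (P := fun g => pderiv i g ∈ low K w d) (by simp)
    (fun f g hf hg => by rw [map_add]; exact add_mem hf hg) (fun m c hm => ?_) hg
  rw [pderiv_monomial]
  by_cases hi : m i = 0
  · simp [hi]
  refine monomial_mem_low (lt_of_le_of_lt ?_ hm) _
  have : m - Finsupp.single i 1 + Finsupp.single i 1 = m := by
    ext j
    by_cases hj : j = i
    · subst hj; simp; omega
    · simp [Finsupp.single_eq_of_ne hj]
  conv_rhs => rw [← this, weight_add_single]
  omega

theorem isWeightedHomogeneous_aeval {f : σ → MvPolynomial τ K} {g : MvPolynomial σ K} {d : ℕ}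
    (hg : IsWeightedHomogeneous w g d) (hf : ∀ i, IsWeightedHomogeneous v (f i) (w i)) :
    IsWeightedHomogeneous v (aeval f g) d := by
  rw [g.as_sum, map_sum]
  refine IsWeightedHomogeneous.sum _ _ _ fun m hm => ?_
  rw [aeval_monomial, ← zero_add d]
  refine (isWeightedHomogeneous_C v _).mul ?_
  rw [← hg (mem_support_iff.mp hm), Finsupp.weight_apply]
  exact IsWeightedHomogeneous.prod _ _ _ fun i _ => (hf i).pow (m i)

theorem aeval_smul_pow {A : Type} [CommRing A] [Algebra K A] {f : σ → A} {r : A}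
    {g : MvPolynomial σ K} {d : ℕ} (hg : IsWeightedHomogeneous w g d) :
    aeval (fun i => r ^ w i * f i) g = r ^ d * aeval f g := by
  rw [g.as_sum, map_sum, map_sum, Finset.mul_sum]
  refine Finset.sum_congr rfl fun m hm => ?_
  rw [aeval_monomial, aeval_monomial, ← hg (mem_support_iff.mp hm), Finsupp.weight_apply,
    mul_left_comm, Finsupp.prod, Finsupp.prod, Finsupp.sum]
  congr 1
  rw [← Finset.prod_pow_eq_pow_sum, ← Finset.prod_mul_distrib]
  exact Finset.prod_congr rfl fun i _ => by rw [mul_pow, ← pow_mul, smul_eq_mul, mul_comm (w i)]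

end

section
variable {n : ℕ} {ι : Type} {a : ι → Fin n → ℂ}

/-- Polynomials in `x` inside the polynomials in `x` and `s`. -/
noncomputable def ex : MvPolynomial (Fin n) ℂ →ₐ[ℂ] MvPolynomial (Fin n ⊕ ι) ℂ := rename Sum.inl

/-- Polynomials in `x` and `s` inside the polynomials in `x`, `s` and `ξ`. -/
noncomputable def emb : MvPolynomial (Fin n ⊕ ι) ℂ →ₐ[ℂ] MvPolynomial (Symb n ι) ℂ :=
  rename Sum.inl

@[simp] theorem emb_ex (f : MvPolynomial (Fin n) ℂ) :
    emb (ex f : MvPolynomial (Fin n ⊕ ι) ℂ) = ix f := rename_rename _ _ _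

@[simp] theorem emb_X (u : Fin n ⊕ ι) :
    emb (X u : MvPolynomial (Fin n ⊕ ι) ℂ) = X (Sum.inl u) := rename_X _ _

/-- The weights counting the variables `s`. -/
def sWeight : Fin n ⊕ ι → ℕ := Sum.elim (fun _ => 0) fun _ => 1

/-- The weights counting the variables `s` and `ξ`. -/
def tWeight : Symb n ι → ℕ := Sum.elim sWeight fun _ => 1

theorem isWeightedHomogeneous_rename_of_eq {σ τ : Type} {v : σ → ℕ} {w : τ → ℕ} {f : σ → τ}
    {p : MvPolynomial σ ℂ} {e : ℕ} (hp : IsWeightedHomogeneous v p e) (hf : ∀ i, w (f i) = v i) :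
    IsWeightedHomogeneous w (rename f p) e := by
  rw [rename_eq_aeval]
  exact isWeightedHomogeneous_aeval hp fun i => hf i ▸ isWeightedHomogeneous_X ℂ w (f i)

theorem isWeightedHomogeneous_ex (f : MvPolynomial (Fin n) ℂ) :
    IsWeightedHomogeneous sWeight (ex f : MvPolynomial (Fin n ⊕ ι) ℂ) 0 :=
  isWeightedHomogeneous_rename_of_eq (v := fun _ => 0) (fun m _ => by
    simp [Finsupp.weight_apply]) fun _ => rfl

theorem isWeightedHomogeneous_emb {f : MvPolynomial (Fin n ⊕ ι) ℂ} {e : ℕ}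
    (hf : IsWeightedHomogeneous sWeight f e) : IsWeightedHomogeneous tWeight (emb f) e :=
  isWeightedHomogeneous_rename_of_eq hf fun _ => rfl

theorem isWeightedHomogeneous_ix_zero (f : MvPolynomial (Fin n) ℂ) :
    IsWeightedHomogeneous tWeight (ix f : MvPolynomial (Symb n ι) ℂ) 0 :=
  emb_ex (ι := ι) f ▸ isWeightedHomogeneous_emb (isWeightedHomogeneous_ex f)

theorem emb_mem_low {f : MvPolynomial (Fin n ⊕ ι) ℂ} {e : ℕ} (hf : f ∈ low ℂ sWeight e) :
    emb f ∈ low ℂ tWeight e := by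
  refine low_induction (w := sWeight) (P := fun g => emb g ∈ low ℂ tWeight e)
    (by simp) (fun f g hf hg => by rw [map_add]; exact add_mem hf hg) (fun m c hm => ?_) hf
  exact IsWeightedHomogeneous.mem_low
    (isWeightedHomogeneous_emb (isWeightedHomogeneous_monomial _ _ _ rfl)) hm

theorem component_emb {f : MvPolynomial (Fin n ⊕ ι) ℂ} {e : ℕ} (hf : f ∈ low ℂ sWeight (e + 1)) :
    weightedHomogeneousComponent tWeight e (emb f) =
      emb (weightedHomogeneousComponent sWeight e f) := by
  have h : emb f = emb (weightedHomogeneousComponent sWeight e f) +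
      emb (f - weightedHomogeneousComponent sWeight e f) := by rw [← map_add]; congr 1; ring
  rw [h, map_add, component_eq_zero_of_mem_low (emb_mem_low (sub_component_mem_low hf)) le_rfl,
    add_zero, (isWeightedHomogeneous_emb
      (weightedHomogeneousComponent_isWeightedHomogeneous _ _)).weightedHomogeneousComponent_same]

open Classical in
/-- The numerators of the logarithmic derivatives of the twist. -/
noncomputable def Psi (a : ι → Fin n → ℂ) (J : Finset ι) (j : Fin n) :
    MvPolynomial (Fin n ⊕ ι) ℂ :=
  ∑ k ∈ J, X (Sum.inr k) * ex (C (a k j) * dp a (J.erase k))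

/-- The values of symbols on the graph of the logarithmic derivatives of the twist, homogenized. -/
noncomputable def hat (a : ι → Fin n → ℂ) (J : Finset ι) :
    MvPolynomial (Symb n ι) ℂ →ₐ[ℂ] MvPolynomial (Fin n ⊕ ι) ℂ :=
  aeval (Sum.elim (Sum.elim (fun i => X (Sum.inl i)) fun k => ex (dp a J) * X (Sum.inr k)) (Psi a J))

theorem isWeightedHomogeneous_Psi (J : Finset ι) (j : Fin n) :
    IsWeightedHomogeneous sWeight (Psi a J j) 1 :=
  IsWeightedHomogeneous.sum _ _ _ fun k _ =>
    (isWeightedHomogeneous_X ℂ sWeight (Sum.inr k)).mul (isWeightedHomogeneous_ex _)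

theorem isWeightedHomogeneous_hat {J : Finset ι} {g : MvPolynomial (Symb n ι) ℂ} {d : ℕ}
    (hg : IsWeightedHomogeneous tWeight g d) : IsWeightedHomogeneous sWeight (hat a J g) d := by
  refine isWeightedHomogeneous_aeval hg fun i => ?_
  rcases i with (i | i) | i
  · exact isWeightedHomogeneous_X ℂ sWeight (Sum.inl i)
  · exact (isWeightedHomogeneous_ex _).mul (isWeightedHomogeneous_X ℂ sWeight (Sum.inr i))
  · exact isWeightedHomogeneous_Psi J i

namespace Saito
variable {J : Finset ι} (B : Saito a J)

theorem isWeightedHomogeneous_tWeight_t (i : Fin n) :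
    IsWeightedHomogeneous tWeight (B.t i) 1 := by
  refine Submodule.sub_mem (weightedHomogeneousSubmodule ℂ tWeight 1) ?_ ?_
  · exact IsWeightedHomogeneous.sum _ _ _ fun j _ => (zero_add 1 : 0 + 1 = 1) ▸
      (isWeightedHomogeneous_ix_zero _).mul (isWeightedHomogeneous_X ℂ tWeight (Sum.inr j))
  · exact IsWeightedHomogeneous.sum _ _ _ fun k _ =>
      (isWeightedHomogeneous_X ℂ (tWeight (n := n)) (Sum.inl (Sum.inr k))).mul
        (isWeightedHomogeneous_ix_zero _)

theorem dp_mul_q (i : Fin n) :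
    ∑ j, ex (B.χ i j) * Psi a J j = ∑ k ∈ J, X (Sum.inr k) * ex (dp a J * B.q i k) := by
  classical
  simp_rw [Psi, Finset.mul_sum]
  rw [Finset.sum_comm]
  refine Finset.sum_congr rfl fun k hk => ?_
  have h : dp a J * B.q i k = app (a k) (B.χ i) * dp a (J.erase k) := by
    rw [B.app_eq i k hk, dp, ← Finset.mul_prod_erase J _ hk, dp]
    ring
  rw [h, app, map_mul, map_sum, Finset.sum_mul, Finset.mul_sum]
  refine Finset.sum_congr rfl fun j _ => ?_
  simp only [map_mul]
  ring

theorem sum_mul_dp_mul_X_sub (i : Fin n) :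
    ∑ j, ix (B.χ i j) * (ix (dp a J) * X (Sum.inr j) - emb (Psi a J j)) = ix (dp a J) * B.t i := by
  have h := congrArg (emb (n := n) (ι := ι)) (B.dp_mul_q i)
  rw [map_sum, map_sum] at h
  have h1 : ∑ j, ix (B.χ i j) * emb (Psi a J j) =
      ix (dp a J) * ∑ k ∈ J, (X (Sum.inl (Sum.inr k)) * ix (B.q i k) : MvPolynomial (Symb n ι) ℂ) := by
    rw [Finset.mul_sum, ← Finset.sum_congr rfl fun j _ => (by rw [map_mul, emb_ex] :
      emb (ex (B.χ i j) * Psi a J j) = ix (B.χ i j) * emb (Psi a J j)), h]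
    refine Finset.sum_congr rfl fun k _ => ?_
    rw [map_mul, emb_ex, emb_X, map_mul]
    ring
  rw [t, mul_sub, ← h1, Finset.mul_sum, ← Finset.sum_sub_distrib]
  exact Finset.sum_congr rfl fun j _ => by ring

variable [Fintype ι]

theorem dp_mul_X_sub_mem (ha : Reduced a) (j : Fin n) :
    ix (dp a J) * X (Sum.inr j) - emb (Psi a J j) ∈ B.tI := by
  obtain ⟨y, hy⟩ : ∃ y : Fin n → MvPolynomial (Symb n ι) ℂ,
    ∀ j, y j = ix (dp a J) * X (Sum.inr j) - emb (Psi a J j) := ⟨_, fun _ => rfl⟩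
  have h1 : ∀ i, ∑ j, ix (B.χ i j) * y j = ix (dp a J) * B.t i := fun i => by
    rw [← B.sum_mul_dp_mul_X_sub]
    exact Finset.sum_congr rfl fun j _ => by rw [hy]
  have h2 : ∀ j, ix (B.χ.det) * y j ∈ B.tI := fun j => by
    have h3 : ix (B.χ.det) * y j = ∑ i, ix (B.χ.adjugate j i) * ∑ j, ix (B.χ i j) * y j := by
      have h4 : ∀ j', ∑ i, (ix (B.χ.adjugate j i) * ix (B.χ i j') : MvPolynomial (Symb n ι) ℂ) =
          if j = j' then ix B.χ.det else 0 := fun j' => by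
        have h5 := congrArg (ix (ι := ι)) (congrFun (congrFun B.χ.adjugate_mul j) j')
        simp only [Matrix.mul_apply, map_sum, map_mul, Matrix.smul_apply, Matrix.one_apply,
          smul_eq_mul, mul_ite, mul_one, mul_zero] at h5
        rw [h5]
        split_ifs <;> simp
      simp_rw [Finset.mul_sum]
      rw [Finset.sum_comm]
      simp_rw [← mul_assoc, ← Finset.sum_mul, h4]
      simp
    rw [h3]
    exact Ideal.sum_mem _ fun i _ => B.tI.mul_mem_left _ (by
      rw [h1]; exact B.tI.mul_mem_left _ (B.t_mem i))
  have h3 : ix (dp a J) * y j ∈ B.tI := by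
    have h4 := B.tI.mul_mem_left (C B.c⁻¹) (h2 j)
    rwa [B.det_eq, map_mul, ← mul_assoc, ← mul_assoc, ix, rename_C, ← C_mul,
      inv_mul_cancel₀ B.c_ne, C_1, one_mul] at h4
  exact hy j ▸ B.mem_tI_of_mul_mem ha h3

theorem mem_tI_of_pow_mul_mem (ha : Reduced a) {g : MvPolynomial (Symb n ι) ℂ} (d : ℕ)
    (h : ix (dp a J) ^ d * g ∈ B.tI) : g ∈ B.tI := by
  induction d with
  | zero => simpa using h
  | succ d ih =>
    rw [pow_succ', mul_assoc] at h
    exact ih (B.mem_tI_of_mul_mem ha h)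

theorem mem_tI_of_hat_eq_zero (ha : Reduced a) {g : MvPolynomial (Symb n ι) ℂ} {d : ℕ}
    (hg : IsWeightedHomogeneous tWeight g d) (h : hat a J g = 0) : g ∈ B.tI := by
  have h1 : (Ideal.Quotient.mkₐ ℂ B.tI).comp ((emb (n := n) (ι := ι)).comp (hat a J)) =
      (Ideal.Quotient.mkₐ ℂ B.tI).comp (aeval fun i => ix (dp a J) ^ tWeight i * X i) := by
    refine MvPolynomial.algHom_ext fun i => ?_
    rcases i with (i | i) | i
    · simp [hat, tWeight, sWeight]
    · simp [hat, tWeight, sWeight]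
    · simp only [hat, AlgHom.comp_apply, aeval_X, Sum.elim_inr, tWeight, pow_one]
      exact (Ideal.Quotient.eq.mpr (B.dp_mul_X_sub_mem ha i)).symm
  have h2 := DFunLike.congr_fun h1 g
  rw [AlgHom.comp_apply, AlgHom.comp_apply, AlgHom.comp_apply, h, map_zero, map_zero,
    aeval_smul_pow hg, aeval_X_left, AlgHom.id_apply] at h2
  have h3 : ix (dp a J) ^ d * g ∈ B.tI := Ideal.Quotient.eq_zero_iff_mem.mp h2.symm
  exact B.mem_tI_of_pow_mul_mem ha d h3

end Saito
end

section
variable {n : ℕ} {ι : Type} {a : ι → Fin n → ℂ} {M : Type} [CommRing M] [Algebra ℂ M]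

/-- A differential ring containing the polynomials in `x` and `s` and inverses of the forms. -/
structure Twist (a : ι → Fin n → ℂ) (M : Type) [CommRing M] [Algebra ℂ M] where
  al : MvPolynomial (Fin n ⊕ ι) ℂ →ₐ[ℂ] M
  δ : Fin n → Derivation ℂ M M
  δ_al : ∀ i r, δ i (al r) = al (pderiv (Sum.inl i) r)
  δ_comm : ∀ i j m, δ i (δ j m) = δ j (δ i m)
  inj : Function.Injective al
  il : ι → M
  il_mul : ∀ k, il k * al (ex (lin (a k))) = 1

theorem monomial_eq_emb_mul (m : Symb n ι →₀ ℕ) (c : ℂ) : ∃ m₁ m₂,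
    (monomial m c : MvPolynomial (Symb n ι) ℂ) =
      emb (monomial m₁ c) * rename Sum.inr (monomial m₂ (1 : ℂ)) ∧
    Finsupp.weight tWeight m = Finsupp.weight sWeight m₁ + m₂.degree := by
  classical
  have h : m = (m.comapDomain Sum.inl Sum.inl_injective.injOn).mapDomain Sum.inl +
      (m.comapDomain Sum.inr Sum.inr_injective.injOn).mapDomain Sum.inr := by
    ext i
    rcases i with i | i
    · rw [Finsupp.add_apply, Finsupp.mapDomain_apply Sum.inl_injective,
        Finsupp.mapDomain_of_notMem_range _ _ (by simp)]
      simp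
    · rw [Finsupp.add_apply, Finsupp.mapDomain_apply Sum.inr_injective,
        Finsupp.mapDomain_of_notMem_range _ _ (by simp)]
      simp
  refine ⟨m.comapDomain Sum.inl Sum.inl_injective.injOn,
    m.comapDomain Sum.inr Sum.inr_injective.injOn, ?_, ?_⟩
  · rw [emb, rename_monomial, rename_monomial, monomial_mul, mul_one, ← h]
  · conv_lhs => rw [h, map_add, Finsupp.weight_apply, Finsupp.weight_apply,
      Finsupp.sum_mapDomain_index (by simp) (by intros; simp [add_mul]),
      Finsupp.sum_mapDomain_index (by simp) (by intros; simp [add_mul])]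
    rw [Finsupp.weight_apply, Finsupp.degree_apply]
    simp [tWeight, Finsupp.sum]

theorem symb_induction {P : MvPolynomial (Symb n ι) ℂ → Prop} (h0 : P 0)
    (hadd : ∀ f g, P f → P g → P (f + g))
    (hm : ∀ s b, P (emb s * rename Sum.inr (monomial b (1 : ℂ)))) (g : MvPolynomial (Symb n ι) ℂ) :
    P g := by
  rw [g.as_sum]
  refine Finset.sum_induction _ P hadd h0 fun m _ => ?_
  obtain ⟨m₁, m₂, h, -⟩ := monomial_eq_emb_mul m (coeff m g)
  exact h ▸ hm _ _

namespace Twist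
variable (T : Twist a M) (J : Finset ι)

/-- The logarithmic derivatives of the twist. -/
noncomputable def ψ (i : Fin n) : M := ∑ k ∈ J, T.al (C (a k i) * X (Sum.inr k)) * T.il k

/-- The twisted partial derivatives. -/
noncomputable def nab (i : Fin n) : Module.End ℂ M := (T.δ i).toLinearMap + LinearMap.mulLeft ℂ (T.ψ J i)

theorem nab_apply (i : Fin n) (m : M) : T.nab J i m = T.δ i m + T.ψ J i * m := rfl

theorem nab_al_mul (i : Fin n) (r : MvPolynomial (Fin n ⊕ ι) ℂ) (m : M) :
    T.nab J i (T.al r * m) = T.al (pderiv (Sum.inl i) r) * m + T.al r * T.nab J i m := by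
  simp only [nab_apply, Derivation.leibniz, δ_al, smul_eq_mul]
  ring

theorem pderiv_ex (i : Fin n) (f : MvPolynomial (Fin n) ℂ) :
    pderiv (Sum.inl i) (ex f : MvPolynomial (Fin n ⊕ ι) ℂ) = ex (pderiv i f) := by
  classical
  rw [ex, pderiv_rename Sum.inl_injective]

theorem δ_il (i : Fin n) (k : ι) : T.δ i (T.il k) = - (T.il k ^ 2 * T.al (C (a k i))) := by
  have h : T.δ i (T.il k * T.al (ex (lin (a k)))) = 0 := by
    rw [T.il_mul, Derivation.map_one_eq_zero]
  have h2 := congrArg (T.il k * ·) h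
  rw [Derivation.leibniz, δ_al, pderiv_ex, pderiv_lin] at h2
  have h3 : (ex (C (a k i)) : MvPolynomial (Fin n ⊕ ι) ℂ) = C (a k i) := by simp [ex]
  simp only [smul_eq_mul, mul_add, h3, mul_zero] at h2
  linear_combination h2 - T.δ i (T.il k) * T.il_mul k

theorem δ_ψ (i j : Fin n) : T.δ i (T.ψ J j) =
    - ∑ k ∈ J, T.al (C (a k i) * C (a k j) * X (Sum.inr k)) * T.il k ^ 2 := by
  classical
  rw [ψ, map_sum, ← Finset.sum_neg_distrib]
  refine Finset.sum_congr rfl fun k _ => ?_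
  have h : pderiv (Sum.inl i) (C (a k j) * X (Sum.inr k) : MvPolynomial (Fin n ⊕ ι) ℂ) = 0 := by
    rw [pderiv_C_mul, pderiv_X_of_ne (by simp), mul_zero]
  rw [Derivation.leibniz, δ_al, h, δ_il]
  simp only [map_zero, smul_eq_mul, map_mul]
  ring

theorem nab_comm (i j : Fin n) : T.nab J i * T.nab J j = T.nab J j * T.nab J i := by
  ext m
  simp only [Module.End.mul_apply, nab_apply, map_add, Derivation.leibniz, T.δ_comm i j, δ_ψ,
    smul_eq_mul]
  have : ∀ k : ι, (C (a k i) * C (a k j) * X (Sum.inr k) : MvPolynomial (Fin n ⊕ ι) ℂ) =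
    C (a k j) * C (a k i) * X (Sum.inr k) := fun k => by ring
  simp_rw [this]
  ring

open scoped IsMulCommutative in
theorem exists_hom : ∃ Φ : MvPolynomial (Fin n) ℂ →ₐ[ℂ] Module.End ℂ M,
    ∀ i, Φ (X i) = T.nab J i := by
  have : IsMulCommutative (Algebra.adjoin ℂ (Set.range (T.nab J))) :=
    Algebra.isMulCommutative_adjoin ℂ (by
      rintro _ ⟨i, rfl⟩ _ ⟨j, rfl⟩
      exact T.nab_comm J i j)
  let f : MvPolynomial (Fin n) ℂ →ₐ[ℂ] Algebra.adjoin ℂ (Set.range (T.nab J)) :=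
    aeval (R := ℂ) (S₁ := Algebra.adjoin ℂ (Set.range (T.nab J)))
      fun i => ⟨T.nab J i, Algebra.subset_adjoin ⟨i, rfl⟩⟩
  refine ⟨(Subalgebra.val _).comp f, fun i => ?_⟩
  simp [f]

/-- The action of polynomials in the twisted partial derivatives. -/
noncomputable def act : MvPolynomial (Fin n) ℂ →ₐ[ℂ] Module.End ℂ M := (T.exists_hom J).choose

@[simp] theorem act_X (i : Fin n) : T.act J (X i) = T.nab J i := (T.exists_hom J).choose_spec i

/-- The action on `e` of the differential operators with the given symbols. -/
noncomputable def L (e : M) : MvPolynomial (Symb n ι) ℂ →ₗ[ℂ] M :=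
  (basisMonomials (Symb n ι) ℂ).constr ℂ fun m =>
    T.al (monomial (m.comapDomain Sum.inl Sum.inl_injective.injOn) 1) *
      T.act J (monomial (m.comapDomain Sum.inr Sum.inr_injective.injOn) 1) e

theorem L_emb_mul_rename (e : M) (s : MvPolynomial (Fin n ⊕ ι) ℂ) (q : MvPolynomial (Fin n) ℂ) :
    T.L J e (emb s * rename Sum.inr q) = T.al s * T.act J q e := by
  classical
  induction s using MvPolynomial.induction_on' with
  | add f g hf hg => rw [map_add, add_mul, map_add, hf, hg, map_add, add_mul]
  | monomial m₁ c =>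
    induction q using MvPolynomial.induction_on' with
    | add f g hf hg => rw [map_add, mul_add, map_add, hf, hg, map_add, LinearMap.add_apply, mul_add]
    | monomial m₂ c' =>
      have h1 : emb (monomial m₁ c) * rename Sum.inr (monomial m₂ c') =
          (c * c') • basisMonomials (Symb n ι) ℂ (m₁.mapDomain Sum.inl + m₂.mapDomain Sum.inr) := by
        rw [emb, rename_monomial, rename_monomial, monomial_mul, coe_basisMonomials, smul_monomial,
          smul_eq_mul, mul_one]
      have h2 : (m₁.mapDomain Sum.inl + m₂.mapDomain Sum.inr : Symb n ι →₀ ℕ).comapDomain Sum.inl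
          Sum.inl_injective.injOn = m₁ := by
        ext i
        rw [Finsupp.comapDomain_apply, Finsupp.add_apply,
          Finsupp.mapDomain_apply Sum.inl_injective, Finsupp.mapDomain_of_notMem_range _ _ (by simp),
          add_zero]
      have h3 : (m₁.mapDomain Sum.inl + m₂.mapDomain Sum.inr : Symb n ι →₀ ℕ).comapDomain Sum.inr
          Sum.inr_injective.injOn = m₂ := by
        ext i
        rw [Finsupp.comapDomain_apply, Finsupp.add_apply,
          Finsupp.mapDomain_apply Sum.inr_injective, Finsupp.mapDomain_of_notMem_range _ _ (by simp),
          zero_add]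
      rw [h1, map_smul, L, Module.Basis.constr_basis, h2, h3]
      have h4 : (monomial m₁ c : MvPolynomial (Fin n ⊕ ι) ℂ) = c • monomial m₁ 1 := by
        rw [smul_monomial, smul_eq_mul, mul_one]
      have h5 : (monomial m₂ c' : MvPolynomial (Fin n) ℂ) = c' • monomial m₂ 1 := by
        rw [smul_monomial, smul_eq_mul, mul_one]
      rw [h4, h5, map_smul, map_smul, LinearMap.smul_apply, smul_mul_smul_comm]

theorem L_emb_mul (e : M) (s : MvPolynomial (Fin n ⊕ ι) ℂ) (g : MvPolynomial (Symb n ι) ℂ) :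
    T.L J e (emb s * g) = T.al s * T.L J e g := by
  induction g using symb_induction with
  | h0 => simp
  | hadd f g hf hg => rw [mul_add, map_add, hf, hg, map_add, mul_add]
  | hm s' b => rw [← mul_assoc, ← map_mul, L_emb_mul_rename, L_emb_mul_rename, map_mul, mul_assoc]

theorem L_one (e : M) : T.L J e 1 = e := by
  simpa using T.L_emb_mul_rename J e 1 1

theorem L_emb (e : M) (s : MvPolynomial (Fin n ⊕ ι) ℂ) : T.L J e (emb s) = T.al s * e := by
  simpa [L_one] using T.L_emb_mul J e s 1

theorem L_mul_X (e : M) (g : MvPolynomial (Symb n ι) ℂ) (i : Fin n) :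
    T.L J e (g * X (Sum.inr i)) = T.L J (T.nab J i e) g := by
  induction g using symb_induction with
  | h0 => simp
  | hadd f g hf hg => rw [add_mul, map_add, hf, hg, map_add]
  | hm s b =>
    have : (X (Sum.inr i) : MvPolynomial (Symb n ι) ℂ) = rename Sum.inr (X i) := by simp
    rw [this, mul_assoc, ← map_mul, L_emb_mul_rename, L_emb_mul_rename, map_mul,
      Module.End.mul_apply, act_X]

theorem nab_L (e : M) (g : MvPolynomial (Symb n ι) ℂ) (i : Fin n) :
    T.nab J i (T.L J e g) =
      T.L J e (X (Sum.inr i) * g + pderiv (Sum.inl (Sum.inl i)) g) := by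
  classical
  induction g using symb_induction with
  | h0 => simp
  | hadd f g hf hg => simp only [map_add, mul_add, hf, hg]; abel
  | hm s b =>
    have h1 : (X (Sum.inr i) : MvPolynomial (Symb n ι) ℂ) = rename Sum.inr (X i) := by simp
    have h2 : pderiv (Sum.inl (Sum.inl i)) (rename Sum.inr (monomial b (1 : ℂ)) :
        MvPolynomial (Symb n ι) ℂ) = 0 := by
      refine pderiv_eq_zero_of_notMem_vars fun h => ?_
      have := vars_rename _ _ h
      simp at this
    have h3 : pderiv (Sum.inl (Sum.inl i)) (emb s : MvPolynomial (Symb n ι) ℂ) =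
        emb (pderiv (Sum.inl i) s) := by
      rw [emb, pderiv_rename Sum.inl_injective]
    rw [L_emb_mul_rename, nab_al_mul, map_add, pderiv_mul, h2, mul_zero, add_zero, h3,
      L_emb_mul_rename, h1, mul_left_comm, ← map_mul, L_emb_mul_rename, map_mul,
      Module.End.mul_apply, act_X, add_comm]

end Twist
end

section
variable {n : ℕ} {ι : Type} {a : ι → Fin n → ℂ} {M : Type} [CommRing M] [Algebra ℂ M]

theorem ex_mem_low (f : MvPolynomial (Fin n) ℂ) :
    (ex f : MvPolynomial (Fin n ⊕ ι) ℂ) ∈ low ℂ sWeight 1 :=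
  IsWeightedHomogeneous.mem_low (isWeightedHomogeneous_ex f) Nat.one_pos

theorem ix_mem_low (f : MvPolynomial (Fin n) ℂ) :
    (ix f : MvPolynomial (Symb n ι) ℂ) ∈ low ℂ tWeight 1 :=
  IsWeightedHomogeneous.mem_low (isWeightedHomogeneous_ix_zero f) Nat.one_pos

theorem X_inr_mem_low (i : Fin n) : (X (Sum.inr i) : MvPolynomial (Symb n ι) ℂ) ∈ low ℂ tWeight 2 :=
  IsWeightedHomogeneous.mem_low (isWeightedHomogeneous_X ℂ tWeight (Sum.inr i)) Nat.one_lt_two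

namespace Twist
variable (T : Twist a M) (J : Finset ι)

theorem isUnit_dp : IsUnit (T.al (ex (dp a J))) := by
  rw [dp, map_prod, map_prod, IsUnit.prod_iff]
  exact fun k _ => IsUnit.of_mul_eq_one_right _ (T.il_mul k)

open Classical in
theorem dp_mul_il {k : ι} (hk : k ∈ J) :
    T.al (ex (dp a J)) * T.il k = T.al (ex (dp a (J.erase k))) := by
  rw [dp, ← Finset.mul_prod_erase J _ hk, map_mul, map_mul, dp]
  linear_combination T.al (ex (∏ x ∈ J.erase k, lin (a x))) * T.il_mul k

theorem dp_mul_ψ (i : Fin n) : T.al (ex (dp a J)) * T.ψ J i = T.al (Psi a J i) := by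
  classical
  rw [ψ, Psi, Finset.mul_sum, map_sum]
  refine Finset.sum_congr rfl fun k hk => ?_
  have h3 : (ex (C (a k i)) : MvPolynomial (Fin n ⊕ ι) ℂ) = C (a k i) := by simp [ex]
  rw [mul_left_comm, T.dp_mul_il J hk, ← map_mul, map_mul ex, h3]
  congr 1
  ring

theorem exists_act_monomial (γ : Fin n →₀ ℕ) : ∃ r ∈ low ℂ sWeight γ.degree,
    T.al (ex (dp a J)) ^ γ.degree * T.act J (monomial γ 1) 1 =
      T.al (hat a J (rename Sum.inr (monomial γ 1)) + r) := by
  classical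
  induction γ using finsupp_induction_single with
  | h0 => exact ⟨0, zero_mem _, by simp⟩
  | hs i γ ih =>
    obtain ⟨r, hr, h⟩ := ih
    set H := hat a J (rename Sum.inr (monomial γ (1 : ℂ))) with hH
    set F : MvPolynomial (Fin n ⊕ ι) ℂ := ex (dp a J) with hF
    set m := T.act J (monomial γ 1) 1 with hm
    set d := γ.degree with hd
    have hH' : IsWeightedHomogeneous sWeight H d := by
      refine isWeightedHomogeneous_hat (isWeightedHomogeneous_rename (isHomogeneous_monomial _ rfl)
        fun _ => rfl)
    have hR : H + r ∈ low ℂ sWeight (d + 1) :=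
      add_mem (IsWeightedHomogeneous.mem_low hH' (Nat.lt_succ_self d)) (low_mono (Nat.le_succ d) hr)
    have hX : (monomial (γ + Finsupp.single i 1) (1 : ℂ)) = X i * monomial γ 1 := by
      rw [X, monomial_mul, add_comm, one_mul]
    have hdeg : (γ + Finsupp.single i 1).degree = d + 1 := by simp [hd]
    have hpow : F * pderiv (Sum.inl i) (F ^ d) = (d : MvPolynomial (Fin n ⊕ ι) ℂ) *
        pderiv (Sum.inl i) F * F ^ d := by
      rw [pderiv_pow]
      rcases d with _ | d
      · simp
      · rw [Nat.add_sub_cancel, pow_succ]; ring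
    have hpow' := congrArg T.al hpow
    have hn := T.nab_al_mul J i (F ^ d) m
    have hn' := T.nab_al_mul J i (H + r) 1
    have hone : T.nab J i 1 = T.ψ J i := by simp [nab_apply]
    have hψ := T.dp_mul_ψ J i
    refine ⟨F * pderiv (Sum.inl i) (H + r) + Psi a J i * r - (d : MvPolynomial (Fin n ⊕ ι) ℂ) *
      pderiv (Sum.inl i) F * (H + r), ?_, ?_⟩
    · rw [hdeg]
      refine sub_mem (add_mem ?_ ?_) ?_
      · rw [mul_comm, ← add_zero (d + 1)]
        exact mul_mem_low (pderiv_mem_low hR _) (ex_mem_low _)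
      · rw [mul_comm]
        exact mul_mem_low hr (IsWeightedHomogeneous.mem_low (isWeightedHomogeneous_Psi J i)
          Nat.one_lt_two)
      · rw [mul_comm, ← add_zero (d + 1)]
        refine mul_mem_low hR ?_
        rw [← nsmul_eq_mul]
        exact Submodule.smul_of_tower_mem _ _ (pderiv_mem_low (ex_mem_low _) _)
    · have hhat : hat a J (rename Sum.inr (monomial (γ + Finsupp.single i 1) (1 : ℂ))) =
          Psi a J i * H := by
        rw [hX, map_mul, map_mul, rename_X, hat, aeval_X]
        rfl
      rw [hhat, hX, map_mul, Module.End.mul_apply, act_X, hdeg, ← hm]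
      rw [map_pow, h, ← mul_one (T.al (H + r)), hn'] at hn
      simp only [map_mul, map_pow, map_add, map_sub, map_natCast, mul_one, hone] at h hn hψ hpow' ⊢
      linear_combination (-T.al F) * hn + (T.al H + T.al r) * hψ - m * hpow' -
        (d : M) * T.al (pderiv (Sum.inl i) F) * h

theorem exists_L_one {g : MvPolynomial (Symb n ι) ℂ} {d : ℕ} (hg : g ∈ low ℂ tWeight (d + 1)) :
    ∃ r ∈ low ℂ sWeight d, T.al (ex (dp a J)) ^ d * T.L J 1 g =
      T.al (hat a J (weightedHomogeneousComponent tWeight d g) + r) := by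
  refine low_induction (w := tWeight) (P := fun g => ∃ r ∈ low ℂ sWeight d,
    T.al (ex (dp a J)) ^ d * T.L J 1 g =
      T.al (hat a J (weightedHomogeneousComponent tWeight d g) + r)) ⟨0, zero_mem _, by simp⟩ ?_ ?_ hg
  · rintro f g ⟨r, hr, h⟩ ⟨r', hr', h'⟩
    exact ⟨r + r', add_mem hr hr', by
      rw [map_add, mul_add, h, h', ← map_add, map_add (weightedHomogeneousComponent _ _),
        map_add (hat a J), add_add_add_comm]⟩
  · intro m c hm
    obtain ⟨m₁, m₂, h1, h2⟩ := monomial_eq_emb_mul m c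
    obtain ⟨r, hr, h⟩ := T.exists_act_monomial J m₂
    have hs : IsWeightedHomogeneous sWeight (monomial m₁ c) (Finsupp.weight sWeight m₁) :=
      isWeightedHomogeneous_monomial _ _ _ rfl
    set e := Finsupp.weight sWeight m₁ with he
    set H := hat a J (rename Sum.inr (monomial m₂ (1 : ℂ))) with hH
    have hHe : IsWeightedHomogeneous sWeight H m₂.degree :=
      isWeightedHomogeneous_hat (isWeightedHomogeneous_rename (isHomogeneous_monomial _ rfl)
        fun _ => rfl)
    have hle : e + m₂.degree ≤ d := by omega
    obtain ⟨k, rfl⟩ := Nat.exists_eq_add_of_le hle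
    have hL : T.al (ex (dp a J)) ^ (e + m₂.degree + k) * T.L J 1 (monomial m c) =
        T.al (ex (dp a J ^ (e + k)) * monomial m₁ c * (H + r)) := by
      rw [h1, L_emb_mul_rename, map_mul, map_mul, ← h, map_pow, map_pow, pow_add, pow_add, pow_add]
      ring
    have hlow : ex (dp a J ^ (e + k)) * monomial m₁ c * r ∈ low ℂ sWeight (e + m₂.degree) := by
      rw [mul_comm, add_comm]
      refine mul_mem_low hr ?_
      rw [mul_comm]
      exact mul_mem_low (e := 0) (IsWeightedHomogeneous.mem_low hs (Nat.lt_succ_self e)) (ex_mem_low _)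
    have hmono : IsWeightedHomogeneous tWeight (monomial m c) (e + m₂.degree) :=
      isWeightedHomogeneous_monomial _ _ _ h2
    rw [hL]
    rcases k with _ | k
    · refine ⟨_, hlow, ?_⟩
      rw [add_zero, add_zero, hmono.weightedHomogeneousComponent_same, h1, map_mul (hat a J)]
      have h3 : hat a J (emb (monomial m₁ c)) = ex (dp a J ^ e) * monomial m₁ c := by
        rw [hat, emb, aeval_rename]
        have := aeval_smul_pow (f := fun i => X i) (r := (ex (dp a J) : MvPolynomial (Fin n ⊕ ι) ℂ)) hs
        rw [aeval_X_left, AlgHom.id_apply, ← map_pow] at this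
        rw [← this]
        congr 2
        funext i
        rcases i with i | i <;> simp [sWeight]
      rw [h3]
      congr 1
      ring
    · refine ⟨ex (dp a J ^ (e + (k + 1))) * monomial m₁ c * (H + r), ?_, ?_⟩
      · rw [mul_add]
        refine add_mem ?_ (low_mono (by omega) hlow)
        exact IsWeightedHomogeneous.mem_low (((isWeightedHomogeneous_ex _).mul hs).mul hHe) (by omega)
      · rw [hmono.weightedHomogeneousComponent_ne _ (by omega), map_zero, zero_add]

theorem component_mem_tI [Fintype ι] (ha : Reduced a) (B : Saito a J)
    {g : MvPolynomial (Symb n ι) ℂ} {d : ℕ}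
    (hg : g ∈ low ℂ tWeight (d + 1)) (h : T.L J 1 g = 0) :
    weightedHomogeneousComponent tWeight d g ∈ B.tI := by
  obtain ⟨r, hr, h1⟩ := T.exists_L_one J hg
  rw [h, mul_zero, eq_comm, map_eq_zero_iff _ T.inj] at h1
  have h2 : IsWeightedHomogeneous tWeight (weightedHomogeneousComponent tWeight d g) d :=
    weightedHomogeneousComponent_isWeightedHomogeneous _ _
  refine B.mem_tI_of_hat_eq_zero ha h2 ?_
  have h3 := isWeightedHomogeneous_hat (a := a) (J := J) h2
  rw [← h3.weightedHomogeneousComponent_same, eq_neg_of_add_eq_zero_left h1, map_neg,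
    component_eq_zero_of_mem_low hr le_rfl, neg_zero]

end Twist
end

section
variable {n : ℕ} {ι : Type} {a : ι → Fin n → ℂ} {M : Type} [CommRing M] [Algebra ℂ M]

theorem sum_mul_pderiv_dp {δ : Fin n → MvPolynomial (Fin n) ℂ} {q : ι → MvPolynomial (Fin n) ℂ}
    (S : Finset ι) (h : ∀ k ∈ S, app (a k) δ = lin (a k) * q k) :
    ∑ j, δ j * pderiv j (dp a S) = (∑ k ∈ S, q k) * dp a S := by
  classical
  induction S using Finset.induction_on with
  | empty => simp [dp]
  | insert k S hk ih =>
    have h1 := ih fun k' hk' => h k' (Finset.mem_insert_of_mem hk')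
    have h2 := h k (Finset.mem_insert_self k S)
    have h3 : dp a (insert k S) = lin (a k) * dp a S := Finset.prod_insert hk
    rw [Finset.sum_insert hk, h3]
    simp_rw [pderiv_mul, pderiv_lin, mul_add, Finset.sum_add_distrib]
    have h4 : ∑ j, δ j * (C (a k j) * dp a S) = app (a k) δ * dp a S := by
      rw [app, Finset.sum_mul]
      exact Finset.sum_congr rfl fun j _ => by ring
    have h5 : ∑ j, δ j * (lin (a k) * pderiv j (dp a S)) =
        lin (a k) * ∑ j, δ j * pderiv j (dp a S) := by
      rw [Finset.mul_sum]
      exact Finset.sum_congr rfl fun j _ => by ring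
    rw [h4, h5, h1, h2]
    ring

namespace Twist
variable (T : Twist a M) (J : Finset ι)

theorem exists_lift_rename {e : M} {h : MvPolynomial (Symb n ι) ℂ} {d : ℕ}
    (hh : h ∈ low ℂ tWeight (d + 1)) (h0 : T.L J e h = 0) (b : Fin n →₀ ℕ) :
    ∃ u ∈ low ℂ tWeight (b.degree + d),
      T.L J e (rename Sum.inr (monomial b (1 : ℂ)) * h + u) = 0 := by
  induction b using finsupp_induction_single with
  | h0 => exact ⟨0, zero_mem _, by simpa⟩
  | hs i b ih =>
    obtain ⟨u, hu, h1⟩ := ih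
    have hX : (monomial (b + Finsupp.single i 1) (1 : ℂ)) = X i * monomial b 1 := by
      rw [X, monomial_mul, add_comm, one_mul]
    have hb : (rename Sum.inr (monomial b (1 : ℂ)) : MvPolynomial (Symb n ι) ℂ) ∈
        low ℂ tWeight (b.degree + 1) :=
      IsWeightedHomogeneous.mem_low (isWeightedHomogeneous_rename (isHomogeneous_monomial _ rfl)
        fun _ => rfl) (Nat.lt_succ_self _)
    have hg : rename Sum.inr (monomial b (1 : ℂ)) * h + u ∈ low ℂ tWeight (b.degree + 1 + d) :=
      add_mem (mul_mem_low hb hh) (low_mono (by omega) hu)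
    refine ⟨X (Sum.inr i) * u + pderiv (Sum.inl (Sum.inl i))
      (rename Sum.inr (monomial b (1 : ℂ)) * h + u), ?_, ?_⟩
    · have hdeg : (b + Finsupp.single i 1).degree = b.degree + 1 := by simp
      rw [hdeg]
      refine add_mem ?_ (pderiv_mem_low hg _)
      rw [mul_comm, add_right_comm]
      exact mul_mem_low hu (X_inr_mem_low i)
    · have := T.nab_L J e (rename Sum.inr (monomial b (1 : ℂ)) * h + u) i
      rw [h1, map_zero] at this
      rw [this, hX, map_mul, rename_X]
      congr 1
      ring

theorem exists_lift {e : M} {c h : MvPolynomial (Symb n ι) ℂ} {m d : ℕ}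
    (hc : c ∈ low ℂ tWeight (m + 1))
    (hh : h ∈ low ℂ tWeight (d + 1)) (h0 : T.L J e h = 0) :
    ∃ u ∈ low ℂ tWeight (m + d), T.L J e (c * h + u) = 0 := by
  refine low_induction (w := tWeight) (P := fun c => ∃ u ∈ low ℂ tWeight (m + d),
    T.L J e (c * h + u) = 0) ⟨0, zero_mem _, by simp⟩ ?_ ?_ hc
  · rintro f g ⟨u, hu, h1⟩ ⟨u', hu', h1'⟩
    refine ⟨u + u', add_mem hu hu', ?_⟩
    rw [add_mul, add_add_add_comm, map_add, h1, h1', add_zero]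
  · intro b c hb
    obtain ⟨b₁, b₂, h1, h2⟩ := monomial_eq_emb_mul b c
    obtain ⟨u, hu, h3⟩ := T.exists_lift_rename J hh h0 b₂
    have hs : emb (monomial b₁ c) ∈ low ℂ tWeight (Finsupp.weight sWeight b₁ + 1) :=
      emb_mem_low (monomial_mem_low (Nat.lt_succ_self _) c)
    refine ⟨emb (monomial b₁ c) * u, ?_, ?_⟩
    · rw [mul_comm]
      exact low_mono (by omega) (mul_mem_low hu hs)
    · rw [h1, mul_assoc, ← mul_add, L_emb_mul, h3, mul_zero]

variable {J}

theorem exists_mem_low_of_component_mem (B : Saito a J) {e : M}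
    (hβ : ∀ i, ∃ β : MvPolynomial (Fin n) ℂ, T.L J e (B.t i - ix β) = 0)
    {g : MvPolynomial (Symb n ι) ℂ} {d : ℕ} (hg : g ∈ low ℂ tWeight (d + 1))
    (h : weightedHomogeneousComponent tWeight d g ∈ B.tI) :
    ∃ g' ∈ low ℂ tWeight d, T.L J e g' = T.L J e g := by
  have hI : B.tI = Ideal.span (Set.range B.t) := by
    rw [Saito.tI, Ideal.ofList]
    congr 1
    ext
    simp [List.mem_ofFn']
  rw [hI, Ideal.span, Submodule.mem_span_range_iff_exists_fun] at h
  obtain ⟨c, hc⟩ := h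
  have hc' := congrArg (weightedHomogeneousComponent tWeight d) hc
  rw [(weightedHomogeneousComponent_isWeightedHomogeneous _ _).weightedHomogeneousComponent_same,
    map_sum] at hc'
  simp_rw [smul_eq_mul, weightedHomogeneousComponent_mul_of_isWeightedHomogeneous _ _
    (B.isWeightedHomogeneous_tWeight_t _) d] at hc'
  rcases d with _ | d
  · refine ⟨g - weightedHomogeneousComponent tWeight 0 g, sub_component_mem_low hg, ?_⟩
    rw [← hc']
    simp
  · simp only [Nat.le_add_left, if_true, Nat.add_sub_cancel] at hc'
    choose β hβ using hβ
    obtain ⟨c', hc₁⟩ : ∃ c' : Fin n → MvPolynomial (Symb n ι) ℂ,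
      ∀ i, c' i = weightedHomogeneousComponent tWeight d (c i) := ⟨_, fun _ => rfl⟩
    simp_rw [← hc₁] at hc'
    have hlow : ∀ i, c' i ∈ low ℂ tWeight (d + 1) := fun i => hc₁ i ▸ IsWeightedHomogeneous.mem_low
      (weightedHomogeneousComponent_isWeightedHomogeneous _ _) (Nat.lt_succ_self d)
    have key : ∀ i, ∃ u ∈ low ℂ tWeight (d + 1),
        T.L J e (c' i * (B.t i - ix (β i)) + u) = 0 := by
      intro i
      refine T.exists_lift J (hlow i) ?_ (hβ i)
      exact sub_mem (IsWeightedHomogeneous.mem_low (B.isWeightedHomogeneous_tWeight_t i)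
        (Nat.lt_succ_self 1)) (low_mono (by omega) (ix_mem_low _))
    choose u hu h1 using key
    refine ⟨g - weightedHomogeneousComponent tWeight (d + 1) g +
      ∑ i, (c' i * ix (β i) - u i), ?_, ?_⟩
    · refine add_mem (sub_component_mem_low hg) (sum_mem fun i _ => sub_mem ?_ (hu i))
      exact mul_mem_low (e := 0) (hlow i) (ix_mem_low _)
    · have h2 : ∑ i, T.L J e (c' i * (B.t i - ix (β i)) + u i) = 0 := Finset.sum_eq_zero fun i _ => h1 i
      have h3 : ∑ i, (c' i * (B.t i - ix (β i)) + u i) =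
          ∑ i, c' i * B.t i - ∑ i, (c' i * ix (β i) - u i) := by
        rw [← Finset.sum_sub_distrib]
        exact Finset.sum_congr rfl fun i _ => by ring
      rw [← map_sum, h3] at h2
      rw [← hc', sub_add, map_sub, h2, sub_zero]

theorem L_t (B : Saito a J) (e : M) (i : Fin n) : T.L J e (B.t i) =
    ∑ j, T.al (ex (B.χ i j)) * T.nab J j e -
      T.al (∑ k ∈ J, X (Sum.inr k) * ex (B.q i k)) * e := by
  have h : B.t i = ∑ j, emb (ex (B.χ i j)) * (1 * X (Sum.inr j)) -
      emb (∑ k ∈ J, X (Sum.inr k) * ex (B.q i k)) := by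
    simp [Saito.t]
  rw [h, map_sub, map_sum, L_emb]
  simp_rw [L_emb_mul, L_mul_X, L_one]

theorem L_one_t (B : Saito a J) (i : Fin n) : T.L J 1 (B.t i) = 0 := by
  rw [← (T.isUnit_dp J).mul_right_eq_zero, L_t, mul_sub, Finset.mul_sum]
  have hone : ∀ j, T.nab J j 1 = T.ψ J j := fun j => by simp [nab_apply]
  simp_rw [hone, mul_left_comm _ (T.al (ex (B.χ i _))), dp_mul_ψ, ← map_mul, ← map_sum,
    B.dp_mul_q, mul_one, ← map_mul, Finset.mul_sum]
  rw [sub_eq_zero]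
  congr 1
  exact Finset.sum_congr rfl fun k _ => by rw [map_mul]; ring

theorem L_dp_t (B : Saito a J) (i : Fin n) :
    T.L J (T.al (ex (dp a J))) (B.t i - ix (∑ k ∈ J, B.q i k)) = 0 := by
  have h := T.L_one_t B i
  have hd := congrArg T.al (congrArg ex (sum_mul_pderiv_dp (δ := B.χ i) J (B.app_eq i)))
  have hone : ∀ j, T.nab J j (T.al (ex (dp a J))) =
      T.al (ex (pderiv j (dp a J))) + T.al (ex (dp a J)) * T.nab J j 1 := fun j => by
    conv_lhs => rw [← mul_one (T.al (ex (dp a J)))]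
    rw [nab_al_mul, pderiv_ex, mul_one]
  rw [L_t, mul_one] at h
  rw [map_sub, L_t, ← emb_ex, L_emb]
  simp_rw [hone, mul_add, Finset.sum_add_distrib, mul_left_comm _ (T.al (ex (dp a J))),
    ← Finset.mul_sum]
  rw [map_sum, map_sum, map_mul, map_mul] at hd
  simp only [map_mul] at hd
  rw [hd, sub_eq_zero.mp h]
  ring

theorem exists_L_dp_rename (b : Fin n →₀ ℕ) :
    ∃ h, h - ix (dp a J) * rename Sum.inr (monomial b (1 : ℂ)) ∈ low ℂ tWeight b.degree ∧
      T.L J (T.al (ex (dp a J))) (rename Sum.inr (monomial b (1 : ℂ))) = T.L J 1 h := by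
  induction b using finsupp_induction_single with
  | h0 =>
    refine ⟨ix (dp a J), by simp, ?_⟩
    rw [← emb_ex, L_emb, mul_one]
    simp [L_one]
  | hs i b ih =>
    obtain ⟨h, h1, h2⟩ := ih
    have hX : (monomial (b + Finsupp.single i 1) (1 : ℂ)) = X i * monomial b 1 := by
      rw [X, monomial_mul, add_comm, one_mul]
    have hdeg : (b + Finsupp.single i 1).degree = b.degree + 1 := by simp
    have hb : (rename Sum.inr (monomial b (1 : ℂ)) : MvPolynomial (Symb n ι) ℂ) ∈
        low ℂ tWeight (b.degree + 1) :=
      IsWeightedHomogeneous.mem_low (isWeightedHomogeneous_rename (isHomogeneous_monomial _ rfl)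
        fun _ => rfl) (Nat.lt_succ_self _)
    have hh : h ∈ low ℂ tWeight (b.degree + 1) := by
      have := add_mem (low_mono (Nat.le_succ _) h1) (mul_mem_low (e := 0) hb (ix_mem_low (dp a J)))
      rwa [mul_comm (ix (dp a J)), sub_add_cancel] at this
    refine ⟨X (Sum.inr i) * h + pderiv (Sum.inl (Sum.inl i)) h, ?_, ?_⟩
    · rw [hdeg, hX, map_mul, rename_X]
      have h3 := mul_mem_low h1 (X_inr_mem_low (ι := ι) i)
      have h4 := add_mem h3 (pderiv_mem_low hh (Sum.inl (Sum.inl i)))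
      convert h4 using 1
      ring
    · have h3 := T.L_emb_mul_rename J (T.al (ex (dp a J))) 1 (X i * monomial b 1)
      have h4 := T.L_emb_mul_rename J (T.al (ex (dp a J))) 1 (monomial b 1)
      rw [map_one emb, map_one T.al, one_mul, one_mul] at h3 h4
      rw [hX, h3, map_mul, Module.End.mul_apply, ← h4, act_X, h2, nab_L]

theorem exists_L_dp {c : MvPolynomial (Symb n ι) ℂ} {d : ℕ} (hc : c ∈ low ℂ tWeight (d + 1)) :
    ∃ h, h - ix (dp a J) * c ∈ low ℂ tWeight d ∧ T.L J (T.al (ex (dp a J))) c = T.L J 1 h := by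
  refine low_induction (w := tWeight) (P := fun c => ∃ h, h - ix (dp a J) * c ∈ low ℂ tWeight d ∧
    T.L J (T.al (ex (dp a J))) c = T.L J 1 h) ⟨0, by simp⟩ ?_ ?_ hc
  · rintro f g ⟨u, hu, h1⟩ ⟨u', hu', h1'⟩
    refine ⟨u + u', ?_, by rw [map_add, h1, h1', map_add]⟩
    rw [mul_add, add_sub_add_comm]
    exact add_mem hu hu'
  · intro b c hb
    obtain ⟨b₁, b₂, h1, h2⟩ := monomial_eq_emb_mul b c
    obtain ⟨u, hu, h3⟩ := T.exists_L_dp_rename (J := J) b₂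
    have hs : emb (monomial b₁ c) ∈ low ℂ tWeight (Finsupp.weight sWeight b₁ + 1) :=
      emb_mem_low (monomial_mem_low (Nat.lt_succ_self _) c)
    refine ⟨emb (monomial b₁ c) * u, ?_, by rw [h1, L_emb_mul, h3, L_emb_mul]⟩
    rw [h1, mul_left_comm, ← mul_sub, mul_comm]
    exact low_mono (by omega) (mul_mem_low hu hs)

variable (J) in
/-- The module of values of differential operators on the product of the forms. -/
noncomputable def N : Submodule ℂ M := LinearMap.range (T.L J (T.al (ex (dp a J))))

theorem al_mul_mem_N {m : M} (hm : m ∈ T.N J) (s : MvPolynomial (Fin n ⊕ ι) ℂ) :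
    T.al s * m ∈ T.N J := by
  obtain ⟨g, rfl⟩ := hm
  exact ⟨emb s * g, T.L_emb_mul _ _ _ _⟩

theorem nab_mem_N {m : M} (hm : m ∈ T.N J) (i : Fin n) : T.nab J i m ∈ T.N J := by
  obtain ⟨g, rfl⟩ := hm
  exact ⟨_, (T.nab_L _ _ _ _).symm⟩

theorem dp_mem_N : T.al (ex (dp a J)) ∈ T.N J := ⟨1, T.L_one _ _⟩

variable [Fintype ι]

theorem component_mem_tF (ha : Reduced a) (B : Saito a J) {g : MvPolynomial (Symb n ι) ℂ} {d : ℕ}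
    (hg : g ∈ low ℂ tWeight (d + 1)) (h : T.L J 1 g ∈ T.N J) :
    weightedHomogeneousComponent tWeight d g ∈ B.tF := by
  obtain ⟨c, hc⟩ := h
  obtain ⟨m, hm⟩ := exists_mem_low (K := ℂ) (w := tWeight) c
  induction m generalizing c with
  | zero =>
    rw [mem_low_zero hm, map_zero] at hc
    exact B.tI_le_tF (T.component_mem_tI J ha B hg hc.symm)
  | succ e ih =>
    obtain ⟨h, h1, h2⟩ := T.exists_L_dp (J := J) hm
    have h3 : T.L J 1 (g - h) = 0 := by rw [map_sub, ← h2, hc, sub_self]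
    have hF := mul_mem_low (e := 0) hm (ix_mem_low (dp a J))
    rw [mul_comm] at hF
    have hh : h ∈ low ℂ tWeight (e + 1) := by
      have := add_mem (low_mono (Nat.le_succ _) h1) hF
      rwa [sub_add_cancel] at this
    rcases le_or_gt e d with hed | hed
    · have h4 := T.component_mem_tI J ha B (sub_mem hg (low_mono (by omega) hh)) h3
      have h5 : weightedHomogeneousComponent tWeight d h ∈ B.tF := by
        have h6 : h = (h - ix (dp a J) * c) + c * ix (dp a J) := by ring
        rw [h6, map_add, component_eq_zero_of_mem_low h1 hed, zero_add,
          weightedHomogeneousComponent_mul_of_isWeightedHomogeneous _ _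
          (isWeightedHomogeneous_ix_zero (dp a J)) d, if_pos (Nat.zero_le _)]
        exact Ideal.mul_mem_left _ _ B.dp_mem_tF
      rw [map_sub] at h4
      simpa using add_mem (B.tI_le_tF h4) h5
    · have h4 := T.component_mem_tI J ha B (sub_mem (low_mono (by omega) hg) hh) h3
      have h6 : g - h = g - (h - ix (dp a J) * c) - c * ix (dp a J) := by ring
      rw [h6, map_sub, map_sub, component_eq_zero_of_mem_low h1 le_rfl,
        component_eq_zero_of_mem_low hg hed, sub_zero, zero_sub, neg_mem_iff,
        weightedHomogeneousComponent_mul_of_isWeightedHomogeneous _ _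
          (isWeightedHomogeneous_ix_zero (dp a J)) e, if_pos (Nat.zero_le _), mul_comm,
          Nat.sub_zero] at h4
      obtain ⟨c', hc', h7⟩ := T.exists_mem_low_of_component_mem B (fun i => ⟨_, T.L_dp_t B i⟩) hm
        (B.mem_tI_of_mul_mem ha h4)
      exact ih c' (h7.trans hc) hc'

theorem mem_N_of_ann (ha : Reduced a) (B : Saito a J) (A : Set (MvPolynomial (Fin n ⊕ ι) ℂ))
    (us : List (ι → ℂ)) (hus : us.length + 2 ≤ Fintype.card ι)
    (hz : ∀ z : Symb n ι → ℂ, (∀ i, eval z (B.t i) = 0) →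
      (∀ θ ∈ A, ∀ e, θ ∈ low ℂ sWeight (e + 1) →
        eval (z ∘ Sum.inl) (weightedHomogeneousComponent sWeight e θ) = 0) →
      (∀ u ∈ us, u ⬝ᵥ (fun k => z (Sum.inl (Sum.inr k))) = 0) → ∀ k, z (Sum.inl (Sum.inr k)) = 0)
    {v : M} (hv : v ∈ LinearMap.range (T.L J 1)) (hA : ∀ θ ∈ A, T.al θ * v ∈ T.N J) :
    v ∈ T.N J := by
  obtain ⟨g, rfl⟩ := hv
  obtain ⟨d, hd⟩ := exists_mem_low (K := ℂ) (w := tWeight) g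
  induction d generalizing g with
  | zero =>
    rw [mem_low_zero hd, map_zero]
    exact zero_mem _
  | succ d ih =>
    have h1 : weightedHomogeneousComponent tWeight d g ∈ B.tF := by
      refine B.mem_tF_of_ann ha (Ideal.span (Set.range B.t ∪
        {y | ∃ θ ∈ A, ∃ e, θ ∈ low ℂ sWeight (e + 1) ∧
          y = emb (weightedHomogeneousComponent sWeight e θ)})) us hus
        (fun i => Ideal.subset_span (Or.inl ⟨i, rfl⟩)) ?_ ?_
      · intro z h1 h2
        refine hz z (fun i => h1 _ (Ideal.subset_span (Or.inl ⟨i, rfl⟩))) ?_ h2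
        intro θ hθ e he
        have := h1 _ (Ideal.subset_span (Or.inr ⟨θ, hθ, e, he, rfl⟩))
        rwa [emb, eval_rename] at this
      · intro x hx
        induction hx using Submodule.span_induction with
        | mem y hy =>
          rcases hy with ⟨i, rfl⟩ | ⟨θ, hθ, e, he, rfl⟩
          · exact Ideal.mul_mem_right _ _ (B.tI_le_tF (B.t_mem i))
          · rw [← component_emb he, ← component_mul (emb_mem_low he) hd]
            refine T.component_mem_tF ha B ?_ ?_
            · rw [add_assoc, add_comm, add_comm d]
              have := mul_mem_low (emb_mem_low he) hd
              exact low_mono (by omega) this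
            · rw [L_emb_mul]
              exact hA θ hθ
        | zero => simp
        | add x y _ _ hx hy => rw [add_mul]; exact add_mem hx hy
        | smul r x _ hx => rw [smul_eq_mul, mul_assoc]; exact Ideal.mul_mem_left _ _ hx
    have hI : HasComponents tWeight B.tI := by
      rw [Saito.tI, Ideal.ofList]
      refine hasComponents_span _ fun g hg => ?_
      obtain ⟨i, rfl⟩ := (List.mem_ofFn' _ _).mp hg
      exact ⟨_, B.isWeightedHomogeneous_tWeight_t i⟩
    rw [Saito.tF, Ideal.ofList_append, Ideal.ofList_singleton, Submodule.mem_sup] at h1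
    obtain ⟨y, hy, y', hy', h2⟩ := h1
    obtain ⟨c, rfl⟩ := Ideal.mem_span_singleton'.mp hy'
    have h3 := congrArg (weightedHomogeneousComponent tWeight d) h2
    rw [(weightedHomogeneousComponent_isWeightedHomogeneous _ _).weightedHomogeneousComponent_same,
      map_add, weightedHomogeneousComponent_mul_of_isWeightedHomogeneous _ _
        (isWeightedHomogeneous_ix_zero (dp a J)) d, if_pos (Nat.zero_le _), Nat.sub_zero] at h3
    obtain ⟨c', hc'⟩ : ∃ c', c' = weightedHomogeneousComponent tWeight d c := ⟨_, rfl⟩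
    rw [← hc'] at h3
    have hcl : c' ∈ low ℂ tWeight (d + 1) := hc' ▸ IsWeightedHomogeneous.mem_low
      (weightedHomogeneousComponent_isWeightedHomogeneous _ _) (Nat.lt_succ_self d)
    obtain ⟨h, h4, h5⟩ := T.exists_L_dp (J := J) hcl
    have hh : h ∈ low ℂ tWeight (d + 1) := by
      have := add_mem (low_mono (Nat.le_succ _) h4) (mul_mem_low (e := 0) hcl (ix_mem_low (dp a J)))
      rwa [mul_comm (ix (dp a J)), sub_add_cancel] at this
    have h6 : weightedHomogeneousComponent tWeight d (g - h) ∈ B.tI := by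
      have h7 : g - h = g - (h - ix (dp a J) * c') - c' * ix (dp a J) := by ring
      rw [h7, map_sub, map_sub, component_eq_zero_of_mem_low h4 le_rfl, sub_zero, ← h3,
        weightedHomogeneousComponent_mul_of_isWeightedHomogeneous _ _
        (isWeightedHomogeneous_ix_zero (dp a J)) d, if_pos (Nat.zero_le _), Nat.sub_zero]
      rw [hc', (weightedHomogeneousComponent_isWeightedHomogeneous _ _).weightedHomogeneousComponent_same,
        add_sub_cancel_right]
      exact hI _ hy d
    obtain ⟨g', hg', h8⟩ := T.exists_mem_low_of_component_mem B
      (e := 1) (fun i => ⟨0, by rw [map_zero, sub_zero, T.L_one_t B i]⟩) (sub_mem hd hh) h6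
    have hN : T.L J 1 h ∈ T.N J := h5 ▸ ⟨c', rfl⟩
    have h9 := ih g' (fun θ hθ => by
      rw [h8, map_sub, mul_sub]
      exact sub_mem (hA θ hθ) (T.al_mul_mem_N hN θ)) hg'
    rw [h8, map_sub] at h9
    simpa using add_mem h9 hN

end Twist
end

section
variable {n : ℕ} {ι : Type} {a : ι → Fin n → ℂ} {M : Type} [CommRing M] [Algebra ℂ M]

/-- Polynomials in `s` inside the polynomials in `x` and `s`. -/
noncomputable def es : MvPolynomial ι ℂ →ₐ[ℂ] MvPolynomial (Fin n ⊕ ι) ℂ := rename Sum.inr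

@[simp] theorem es_X (k : ι) : (es (X k) : MvPolynomial (Fin n ⊕ ι) ℂ) = X (Sum.inr k) :=
  rename_X _ _

@[simp] theorem es_C (c : ℂ) : (es (C c : MvPolynomial ι ℂ) : MvPolynomial (Fin n ⊕ ι) ℂ) = C c :=
  rename_C _ _

theorem ex_C (c : ℂ) : (ex (C c) : MvPolynomial (Fin n ⊕ ι) ℂ) = C c := rename_C _ _

theorem pderiv_es (i : Fin n) (b : MvPolynomial ι ℂ) :
    pderiv (Sum.inl i) (es b : MvPolynomial (Fin n ⊕ ι) ℂ) = 0 := by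
  classical
  refine pderiv_eq_zero_of_notMem_vars fun h => ?_
  have := vars_rename _ _ h
  simp at this

variable (a) in
/-- The linear factor attached to a set of hyperplanes and a shift. -/
noncomputable def lfac (S : Finset ι) (j : ℕ) : MvPolynomial ι ℂ :=
  ∑ k ∈ S, X k + C (((n - Module.finrank ℂ (flat a S) : ℕ) : ℂ) + j)

variable (a) in
/-- The contribution of a flat to the Bernstein polynomial. -/
noncomputable def fac (S : Finset ι) : MvPolynomial ι ℂ :=
  ∏ j ∈ Finset.range (2 * (S.card - (n - Module.finrank ℂ (flat a S))) + 1), lfac a S j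

variable (a) in
/-- The nonempty irreducible flats. -/
def IsIrrFlat (S : Finset ι) : Prop := S.Nonempty ∧ IsFlat a S ∧ Irr a S

open Classical in
variable (a) in
/-- The product of the contributions of the irreducible flats contained in `J`. -/
noncomputable def bpol (J : Finset ι) : MvPolynomial ι ℂ :=
  ∏ S ∈ J.powerset.filter (IsIrrFlat a), fac a S

open Classical in
variable (a) in
/-- The product of the contributions of the irreducible flats properly contained in `J`. -/
noncomputable def bsub (J : Finset ι) : MvPolynomial ι ℂ :=
  ∏ S ∈ (J.powerset.filter (IsIrrFlat a)).erase J, fac a S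

theorem bpol_of_irr {J : Finset ι} (h : IsIrrFlat a J) : bpol a J = fac a J * bsub a J := by
  classical
  exact (Finset.mul_prod_erase _ _ (Finset.mem_filter.mpr
    ⟨Finset.mem_powerset_self J, h⟩)).symm

theorem bpol_of_not_irr {J : Finset ι} (h : ¬ IsIrrFlat a J) : bpol a J = bsub a J := by
  classical
  rw [bpol, bsub, Finset.erase_eq_of_notMem]
  exact fun h' => h (Finset.mem_filter.mp h').2

theorem bpol_dvd_bsub {S J : Finset ι} (h : S ⊆ J) (hne : S ≠ J) : bpol a S ∣ bsub a J := by
  classical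
  refine Finset.prod_dvd_prod_of_subset _ _ _ fun S' hS' => ?_
  obtain ⟨h1, h2⟩ := Finset.mem_filter.mp hS'
  rw [Finset.mem_powerset] at h1
  refine Finset.mem_erase.mpr ⟨fun h3 => hne (h.antisymm (h3 ▸ h1)), Finset.mem_filter.mpr
    ⟨Finset.mem_powerset.mpr (h1.trans h), h2⟩⟩

namespace Twist
variable (T : Twist a M)

theorem exists_pow_mul_nab {S J : Finset ι} (h : S ⊆ J) [DecidableEq ι] {m : M} {N : ℕ}
    (hm : T.al (ex (dp a (J \ S) ^ N)) * m ∈ T.N J) (i : Fin n) :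
    T.al (ex (dp a (J \ S) ^ (N + 1))) * T.nab S i m ∈ T.N J := by
  have h1 : T.nab J i m = T.nab S i m + T.ψ (J \ S) i * m := by
    have : T.ψ J i = T.ψ S i + T.ψ (J \ S) i := by
      rw [ψ, ψ, ψ, add_comm, Finset.sum_sdiff h]
    rw [nab_apply, nab_apply, this]
    ring
  have h2 : T.nab J i (T.al (ex (dp a (J \ S) ^ (N + 1))) * m) ∈ T.N J := by
    refine T.nab_mem_N ?_ i
    rw [pow_succ', map_mul, map_mul, mul_assoc]
    exact T.al_mul_mem_N hm _
  rw [nab_al_mul, pderiv_ex, h1, mul_add] at h2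
  have h3 : T.al (ex (dp a (J \ S) ^ (N + 1))) * (T.ψ (J \ S) i * m) =
      T.al (Psi a (J \ S) i) * (T.al (ex (dp a (J \ S) ^ N)) * m) := by
    rw [← T.dp_mul_ψ, pow_succ, map_mul, map_mul]
    ring
  have h4 : T.al (ex (pderiv i (dp a (J \ S) ^ (N + 1)))) * m =
      T.al (ex ((N + 1 : ℕ) * pderiv i (dp a (J \ S)))) *
        (T.al (ex (dp a (J \ S) ^ N)) * m) := by
    have h5 : pderiv i (dp a (J \ S) ^ (N + 1)) =
        (N + 1 : ℕ) * pderiv i (dp a (J \ S)) * dp a (J \ S) ^ N := by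
      rw [pderiv_pow, Nat.add_sub_cancel]
      ring
    rw [h5, map_mul ex, map_mul T.al, mul_assoc]
  rw [h3, h4] at h2
  have h5 := T.al_mul_mem_N hm (Psi a (J \ S) i)
  have h6 := T.al_mul_mem_N hm (ex ((N + 1 : ℕ) * pderiv i (dp a (J \ S))))
  have h7 := sub_mem (sub_mem h2 h5) h6
  have aux : ∀ x y z : M, x + (y + z) - z - x = y := fun x y z => by ring
  rwa [aux] at h7

theorem exists_pow_mul_mem_of_step {S J : Finset ι} (Q : MvPolynomial (Fin n) ℂ)
    (h0 : T.al (ex (Q ^ 1)) * T.al (ex (dp a S)) ∈ T.N J)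
    (hs : ∀ m N, T.al (ex (Q ^ N)) * m ∈ T.N J → ∀ i,
      T.al (ex (Q ^ (N + 1))) * T.nab S i m ∈ T.N J) {m : M}
    (hm : m ∈ T.N S) : ∃ N, T.al (ex (Q ^ N)) * m ∈ T.N J := by
  obtain ⟨g, rfl⟩ := hm
  induction g using symb_induction with
  | h0 => exact ⟨0, by simp⟩
  | hadd f g hf hg =>
    obtain ⟨N₁, h1⟩ := hf
    obtain ⟨N₂, h2⟩ := hg
    refine ⟨N₁ + N₂, ?_⟩
    rw [map_add, mul_add]
    refine add_mem ?_ ?_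
    · rw [pow_add, mul_comm (_ ^ N₁), map_mul, map_mul, mul_assoc]
      exact T.al_mul_mem_N h1 _
    · rw [pow_add, map_mul, map_mul, mul_assoc]
      exact T.al_mul_mem_N h2 _
  | hm s b =>
    rw [L_emb_mul_rename]
    suffices h' : ∃ N, T.al (ex (Q ^ N)) *
        T.act S (monomial b 1) (T.al (ex (dp a S))) ∈ T.N J by
      obtain ⟨N, hN⟩ := h'
      refine ⟨N, ?_⟩
      rw [mul_left_comm]
      exact T.al_mul_mem_N hN _
    induction b using finsupp_induction_single with
    | h0 =>
      refine ⟨1, ?_⟩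
      have : (monomial 0 (1 : ℂ) : MvPolynomial (Fin n) ℂ) = 1 := rfl
      rwa [this, map_one (T.act S), Module.End.one_apply]
    | hs i b ih =>
      obtain ⟨N, hN⟩ := ih
      have hX : (monomial (b + Finsupp.single i 1) (1 : ℂ)) = X i * monomial b 1 := by
        rw [X, monomial_mul, add_comm, one_mul]
      refine ⟨N + 1, ?_⟩
      rw [hX, map_mul, Module.End.mul_apply, act_X]
      exact hs _ _ hN i

theorem exists_pow_mul_mem_N {S J : Finset ι} (h : S ⊆ J) [DecidableEq ι] {m : M}
    (hm : m ∈ T.N S) : ∃ N, T.al (ex (dp a (J \ S) ^ N)) * m ∈ T.N J := by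
  refine T.exists_pow_mul_mem_of_step _ ?_ (fun m N hN i => T.exists_pow_mul_nab h hN i) hm
  have : dp a (J \ S) * dp a S = dp a J := Finset.prod_sdiff h
  rw [pow_one, ← map_mul, ← map_mul, this]
  exact T.dp_mem_N

theorem exists_pow_mul_mem_N_of_subset {S J : Finset ι} (h : S ⊆ J) [DecidableEq ι] {m : M}
    (hm : m ∈ T.N J) : ∃ N, T.al (ex (dp a (J \ S) ^ N)) * m ∈ T.N S := by
  refine T.exists_pow_mul_mem_of_step (dp a (J \ S)) ?_ (fun m N hN i => ?_) hm
  · have : dp a (J \ S) * dp a S = dp a J := Finset.prod_sdiff h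
    rw [← this, map_mul, map_mul]
    exact T.al_mul_mem_N (T.al_mul_mem_N T.dp_mem_N _) _
  have h1 : T.nab J i m = T.nab S i m + T.ψ (J \ S) i * m := by
    have : T.ψ J i = T.ψ S i + T.ψ (J \ S) i := by
      rw [ψ, ψ, ψ, add_comm, Finset.sum_sdiff h]
    rw [nab_apply, nab_apply, this]
    ring
  have h2 : T.nab S i (T.al (ex (dp a (J \ S) ^ (N + 1))) * m) ∈ T.N S := by
    refine T.nab_mem_N ?_ i
    rw [pow_succ', map_mul, map_mul, mul_assoc]
    exact T.al_mul_mem_N hN _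
  rw [nab_al_mul, pderiv_ex] at h2
  have h3 : T.al (ex (dp a (J \ S) ^ (N + 1))) * (T.ψ (J \ S) i * m) =
      T.al (Psi a (J \ S) i) * (T.al (ex (dp a (J \ S) ^ N)) * m) := by
    rw [← T.dp_mul_ψ, pow_succ, map_mul, map_mul]
    ring
  have h4 : T.al (ex (pderiv i (dp a (J \ S) ^ (N + 1)))) * m =
      T.al (ex ((N + 1 : ℕ) * pderiv i (dp a (J \ S)))) *
        (T.al (ex (dp a (J \ S) ^ N)) * m) := by
    have h5 : pderiv i (dp a (J \ S) ^ (N + 1)) =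
        (N + 1 : ℕ) * pderiv i (dp a (J \ S)) * dp a (J \ S) ^ N := by
      rw [pderiv_pow, Nat.add_sub_cancel]
      ring
    rw [h5, map_mul ex, map_mul T.al, mul_assoc]
  rw [h4] at h2
  have h5 := T.al_mul_mem_N hN (Psi a (J \ S) i)
  have h6 := T.al_mul_mem_N hN (ex ((N + 1 : ℕ) * pderiv i (dp a (J \ S))))
  rw [h1, mul_add, h3]
  refine add_mem ?_ h5
  have h7 := sub_mem h2 h6
  have aux : ∀ x y : M, x + y - x = y := fun x y => by ring
  rwa [aux] at h7

/-- The polynomials in `x` moving `b` into `T.N J`. -/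
noncomputable def ann (J : Finset ι) (b : MvPolynomial ι ℂ) : Ideal (MvPolynomial (Fin n) ℂ) where
  carrier := {f | T.al (ex f * es b) ∈ T.N J}
  add_mem' := fun {f g} hf hg => by
    simp only [Set.mem_ofPred_eq, map_add, add_mul] at *
    exact add_mem hf hg
  zero_mem' := by simp
  smul_mem' := fun c f hf => by
    simp only [Set.mem_ofPred_eq, smul_eq_mul, map_mul, mul_assoc] at *
    exact T.al_mul_mem_N hf _

theorem mem_ann {J : Finset ι} {b : MvPolynomial ι ℂ} {f : MvPolynomial (Fin n) ℂ} :
    f ∈ T.ann J b ↔ T.al (ex f * es b) ∈ T.N J := Iff.rfl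

theorem mem_radical_ann {J : Finset ι} (hJ : IsFlat a J)
    (ih : ∀ S, S ⊆ J → S ≠ J → IsFlat a S → T.al (es (bpol a S)) ∈ T.N S)
    {f : MvPolynomial (Fin n) ℂ} (hf : ∀ z ∈ flat a J, eval z f = 0) :
    f ∈ (T.ann J (bsub a J)).radical := by
  classical
  rw [← MvPolynomial.vanishingIdeal_zeroLocus_eq_radical (K := ℂ), mem_vanishingIdeal_iff]
  intro z hz
  rw [mem_zeroLocus_iff] at hz
  have hev : ∀ p : MvPolynomial (Fin n) ℂ, aeval z p = eval z p := fun p => rfl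
  rw [hev]
  simp_rw [hev] at hz
  refine hf z ?_
  by_contra hzJ
  set S := J.filter fun k => a k ⬝ᵥ z = 0 with hS
  have hSJ : S ⊆ J := Finset.filter_subset _ _
  have hne : S ≠ J := by
    intro h
    refine hzJ fun k hk => ?_
    rw [← h] at hk
    exact (Finset.mem_filter.mp hk).2
  obtain ⟨N, hN⟩ := T.exists_pow_mul_mem_N hSJ (ih S hSJ hne (hJ.filter z))
  obtain ⟨c, hc⟩ := bpol_dvd_bsub (a := a) hSJ hne
  have h1 : dp a (J \ S) ^ N ∈ T.ann J (bsub a J) := by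
    rw [mem_ann, hc, map_mul, map_mul, map_mul, mul_comm (T.al (es (bpol a S))), mul_left_comm]
    exact T.al_mul_mem_N hN _
  have h2 := hz _ h1
  rw [map_pow] at h2
  obtain ⟨k, hk, hk'⟩ := eval_dp_eq_zero.mp (not_not.mp fun h' => pow_ne_zero N h' h2)
  obtain ⟨h3, h4⟩ := Finset.mem_sdiff.mp hk
  exact h4 (Finset.mem_filter.mpr ⟨h3, hk'⟩)

theorem exists_comp_mem_ann {J : Finset ι} (hJ : IsFlat a J)
    (ih : ∀ S, S ⊆ J → S ≠ J → IsFlat a S → T.al (es (bpol a S)) ∈ T.N S)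
    {P : Matrix (Fin n) (Fin n) ℂ} (hP : ∀ v ∈ flat a J, P.mulVec v = 0) :
    ∃ N, ∀ d, N ≤ d → ∀ g : MvPolynomial (Fin n) ℂ, g.IsHomogeneous d →
      comp P g ∈ T.ann J (bsub a J) := by
  have h1 : idealOfVars (Fin n) ℂ ≤ ((T.ann J (bsub a J)).comap (comp P)).radical := by
    rw [idealOfVars, Ideal.span_le]
    rintro _ ⟨i, rfl⟩
    have h2 : comp P (X i) ∈ (T.ann J (bsub a J)).radical := by
      refine T.mem_radical_ann hJ ih fun z hz => ?_
      rw [eval_comp, hP z hz]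
      simp
    obtain ⟨N, hN⟩ := h2
    refine ⟨N, ?_⟩
    rw [Ideal.mem_comap, map_pow]
    exact hN
  obtain ⟨N, hN⟩ := Ideal.exists_pow_le_of_le_radical_of_fg h1 (idealOfVars_fg (Fin n) ℂ)
  refine ⟨N, fun d hd g hg => hN ?_⟩
  rw [mem_pow_idealOfVars_iff]
  intro x hx
  have := hg (mem_support_iff.mp hx)
  rw [Finsupp.degree_eq_weight_one]
  exact hd.trans (by rw [← this]; rfl)

/-- The action of the twisted Euler field of a projection. -/
theorem euler {P : Matrix (Fin n) (Fin n) ℂ} (hP : P * P = P) {J J₁ : Finset ι} (h : J₁ ⊆ J)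
    (h1 : ∀ k ∈ J₁, Matrix.vecMul (a k) P = a k)
    (h0 : ∀ k ∈ J, k ∉ J₁ → Matrix.vecMul (a k) P = 0)
    {g : MvPolynomial (Fin n) ℂ} {d : ℕ} (hg : g.IsHomogeneous d) (b : MvPolynomial ι ℂ) :
    T.al (ex (comp P g) * es ((∑ k ∈ J₁, X k + C (P.trace + d)) * b)) =
      ∑ j, T.nab J j (T.al (ex (comp P (X j * g)) * es b)) := by
  classical
  have hnab : ∀ j, T.nab J j (T.al (ex (comp P (X j * g)) * es b)) =
      T.al (ex (pderiv j (comp P (X j * g))) * es b) +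
      T.al (ex (comp P g) * es b) * (T.al (ex (comp P (X j))) * T.ψ J j) := by
    intro j
    have : T.nab J j (T.al (ex (comp P (X j * g)) * es b)) =
        T.nab J j (T.al (ex (comp P (X j * g)) * es b) * 1) := by rw [mul_one]
    rw [this, nab_al_mul, pderiv_mul, pderiv_ex, pderiv_es, mul_zero, add_zero, mul_one,
      nab_apply, Derivation.map_one_eq_zero, zero_add, mul_one]
    simp only [map_mul]
    ring
  simp_rw [hnab, Finset.sum_add_distrib, ← Finset.mul_sum]
  have hψ : ∑ j, T.al (ex (comp P (X j))) * T.ψ J j = T.al (es (∑ k ∈ J₁, X k)) := by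
    simp_rw [ψ, Finset.mul_sum]
    rw [Finset.sum_comm]
    have h2 : ∀ k, ∑ j, T.al (ex (comp P (X j))) * (T.al (C (a k j) * X (Sum.inr k)) * T.il k) =
        T.al (X (Sum.inr k)) * (T.il k * T.al (ex (lin (Matrix.vecMul (a k) P)))) := by
      intro k
      rw [← comp_lin, lin, map_sum, map_sum, map_sum, Finset.mul_sum, Finset.mul_sum]
      refine Finset.sum_congr rfl fun j _ => ?_
      rw [map_mul, map_mul, map_mul, map_mul, comp_C, ex_C]
      ring
    simp_rw [h2]
    rw [← Finset.sum_subset h, map_sum, map_sum]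
    · refine Finset.sum_congr rfl fun k hk => ?_
      rw [h1 k hk, T.il_mul, mul_one, es_X]
    · intro k hk hk'
      rw [h0 k hk hk']
      simp [lin_zero]
  have hd : ∑ j, pderiv j (comp P (X j * g)) = C (P.trace + d) * comp P g := by
    have h3 : ∀ j, pderiv j (comp P (X j * g)) = comp P g * C (P j j) +
        ∑ i, comp P (pderiv i g) * (C (P i j) * comp P (X j)) := by
      intro j
      rw [pderiv_comp]
      simp_rw [pderiv_mul, map_add, map_mul, add_mul, Finset.sum_add_distrib]
      refine congrArg₂ (· + ·) ?_ ?_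
      · rw [Finset.sum_eq_single j]
        · simp
        · intro i _ hi
          rw [pderiv_X_of_ne hi.symm]
          simp
        · simp
      · exact Finset.sum_congr rfl fun i _ => by ring
    rw [Finset.sum_congr rfl fun j _ => h3 j, Finset.sum_add_distrib, Finset.sum_comm]
    have h4 : ∀ i, ∑ j, C (P i j) * comp P (X j) = comp P (X i) := by
      intro i
      have : ∑ j, C (P i j) * comp P (X j) = comp P (lin (P i)) := by
        rw [lin, map_sum]
        exact Finset.sum_congr rfl fun j _ => by rw [map_mul, comp_C]
      rw [this, comp_lin, comp_X]
      congr 1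
      exact congrFun hP i
    simp_rw [← Finset.mul_sum, h4]
    have h5 := congrArg (comp P) hg.sum_X_mul_pderiv
    rw [map_sum] at h5
    have h6 : ∑ i, comp P (pderiv i g) * comp P (X i) = (d : ℂ) • comp P g := by
      rw [← map_smul, Nat.cast_smul_eq_nsmul, ← h5]
      exact Finset.sum_congr rfl fun i _ => by rw [map_mul, mul_comm]
    rw [h6, ← map_sum, smul_eq_C_mul, C_add, Matrix.trace]
    simp only [Matrix.diag_apply]
    ring
  rw [hψ, ← map_sum, ← Finset.sum_mul, ← map_sum, hd]
  rw [← map_mul, ← map_add]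
  refine congrArg T.al ?_
  rw [map_mul es, map_add es, es_C, map_mul ex, ex_C]
  ring

theorem euler_prod {P : Matrix (Fin n) (Fin n) ℂ} (hP : P * P = P) {J J₁ : Finset ι} (h : J₁ ⊆ J)
    (h1 : ∀ k ∈ J₁, Matrix.vecMul (a k) P = a k)
    (h0 : ∀ k ∈ J, k ∉ J₁ → Matrix.vecMul (a k) P = 0) (D : ℕ) (b : MvPolynomial ι ℂ)
    (hb : ∀ g : MvPolynomial (Fin n) ℂ, g.IsHomogeneous D → comp P g ∈ T.ann J b) :
    T.al (es ((∏ j ∈ Finset.range D, (∑ k ∈ J₁, X k + C (P.trace + j))) * b)) ∈ T.N J := by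
  induction D generalizing b with
  | zero =>
    have := hb 1 (isHomogeneous_one _ _)
    rw [mem_ann] at this
    simpa using this
  | succ D ih =>
    rw [Finset.prod_range_succ, mul_assoc]
    refine ih _ fun g hg => ?_
    rw [mem_ann, T.euler hP h h1 h0 hg]
    refine sum_mem fun j _ => T.nab_mem_N ?_ j
    have := hb (X j * g) (by rw [add_comm]; exact (isHomogeneous_X _ _).mul hg)
    rwa [mem_ann] at this

end Twist
end

section
variable {σ τ : Type}

theorem one_mem_low {w : σ → ℕ} : (1 : MvPolynomial σ ℂ) ∈ low ℂ w 1 :=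
  IsWeightedHomogeneous.mem_low (isWeightedHomogeneous_one ℂ w) zero_lt_one

theorem component_one {w : σ → ℕ} :
    weightedHomogeneousComponent w 0 (1 : MvPolynomial σ ℂ) = 1 :=
  (isWeightedHomogeneous_one ℂ w).weightedHomogeneousComponent_same

theorem prod_mem_low {w : σ → ℕ} {κ : Type*} (s : Finset κ) {f : κ → MvPolynomial σ ℂ}
    (hf : ∀ i ∈ s, f i ∈ low ℂ w 2) : ∏ i ∈ s, f i ∈ low ℂ w (s.card + 1) ∧
      weightedHomogeneousComponent w s.card (∏ i ∈ s, f i) =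
        ∏ i ∈ s, weightedHomogeneousComponent w 1 (f i) := by
  classical
  induction s using Finset.induction_on with
  | empty => simpa using ⟨one_mem_low, component_one⟩
  | insert i s hi ih =>
    obtain ⟨h1, h2⟩ := ih fun j hj => hf j (Finset.mem_insert_of_mem hj)
    have h3 := hf i (Finset.mem_insert_self i s)
    rw [Finset.prod_insert hi, Finset.prod_insert hi, Finset.card_insert_of_notMem hi,
      mul_comm (f i), component_mul h1 h3, h2]
    exact ⟨mul_mem_low h1 h3, mul_comm _ _⟩

theorem rename_mem_low {w : τ → ℕ} {v : σ → ℕ} {f : σ → τ} (hf : ∀ i, w (f i) = v i)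
    {p : MvPolynomial σ ℂ} {e : ℕ} (hp : p ∈ low ℂ v e) : rename f p ∈ low ℂ w e := by
  refine low_induction (w := v) (P := fun g => rename f g ∈ low ℂ w e)
    (by simp) (fun f g hf hg => by rw [map_add]; exact add_mem hf hg) (fun m c hm => ?_) hp
  exact IsWeightedHomogeneous.mem_low
    (isWeightedHomogeneous_rename_of_eq (isWeightedHomogeneous_monomial _ _ _ rfl) hf) hm

theorem component_rename {w : τ → ℕ} {v : σ → ℕ} {f : σ → τ} (hf : ∀ i, w (f i) = v i)
    {p : MvPolynomial σ ℂ} {e : ℕ} (hp : p ∈ low ℂ v (e + 1)) :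
    weightedHomogeneousComponent w e (rename f p) =
      rename f (weightedHomogeneousComponent v e p) := by
  have h : rename f p = rename f (weightedHomogeneousComponent v e p) +
      rename f (p - weightedHomogeneousComponent v e p) := by
    rw [← map_add, add_sub_cancel]
  rw [h, map_add, component_eq_zero_of_mem_low (rename_mem_low hf (sub_component_mem_low hp)) le_rfl,
    add_zero, (isWeightedHomogeneous_rename_of_eq
      (weightedHomogeneousComponent_isWeightedHomogeneous _ _) hf).weightedHomogeneousComponent_same]

/-- The polynomial has degree at most `e`, with leading form not vanishing at the given point. -/
def Good (z : σ → ℂ) (f : MvPolynomial σ ℂ) (e : ℕ) : Prop :=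
  f ∈ low ℂ (fun _ => 1) (e + 1) ∧ eval z (weightedHomogeneousComponent (fun _ => 1) e f) ≠ 0

theorem good_one (z : σ → ℂ) : Good z 1 0 := by
  refine ⟨one_mem_low, ?_⟩
  rw [component_one]
  simp

theorem Good.mul {z : σ → ℂ} {f g : MvPolynomial σ ℂ} {d e : ℕ} (hf : Good z f d)
    (hg : Good z g e) : Good z (f * g) (d + e) := by
  refine ⟨add_right_comm d e 1 ▸ mul_mem_low hf.1 hg.1, ?_⟩
  rw [component_mul hf.1 hg.1, map_mul]
  exact mul_ne_zero hf.2 hg.2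

theorem linear_add_C_mem_low {f : MvPolynomial σ ℂ} (hf : f.IsHomogeneous 1) (c : ℂ) :
    f + C c ∈ low ℂ (fun _ => 1) 2 ∧
      weightedHomogeneousComponent (fun _ => 1) 1 (f + C c) = f := by
  have hc : (C c : MvPolynomial σ ℂ) ∈ low ℂ (fun _ => 1) 1 :=
    IsWeightedHomogeneous.mem_low (isWeightedHomogeneous_C _ c) zero_lt_one
  have hf' : IsWeightedHomogeneous (fun _ => 1) f 1 := hf
  refine ⟨add_mem (IsWeightedHomogeneous.mem_low hf' one_lt_two) (low_mono one_le_two hc), ?_⟩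
  rw [map_add, hf'.weightedHomogeneousComponent_same,
    component_eq_zero_of_mem_low hc le_rfl, add_zero]

theorem det_good {m : ℕ} {z : σ → ℂ} {A : Matrix (Fin m) (Fin m) (MvPolynomial σ ℂ)}
    (hA : ∀ i j, A i j ∈ low ℂ (fun _ => 1) 2)
    (h : (Matrix.of fun i j =>
      eval z (weightedHomogeneousComponent (fun _ => 1) 1 (A i j))).det ≠ 0) : Good z A.det m := by
  classical
  have hp : ∀ π : Equiv.Perm (Fin m), _ := fun π =>
    prod_mem_low Finset.univ (f := fun i => A (π i) i) fun i _ => hA _ _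
  rw [Finset.card_univ, Fintype.card_fin] at hp
  refine ⟨?_, ?_⟩
  · rw [Matrix.det_apply]
    exact sum_mem fun π _ => by
      rcases Int.units_eq_one_or (Equiv.Perm.sign π) with h | h <;> rw [h]
      · simpa using (hp π).1
      · simpa using (hp π).1
  · rw [Matrix.det_apply] at h ⊢
    rw [map_sum, map_sum]
    convert h using 2 with π
    rcases Int.units_eq_one_or (Equiv.Perm.sign π) with h | h <;> rw [h]
    · simp [(hp π).2]
    · simp [(hp π).2]

end

section
variable {n : ℕ} {ι : Type} [Fintype ι] {a : ι → Fin n → ℂ} {M : Type} [CommRing M] [Algebra ℂ M]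

theorem Twist.exists_good_of_linear (T : Twist a M) {J : Finset ι} (V : Type) [AddCommGroup V]
    [Module ℂ V] [Module.Finite ℂ V] (φ : V →ₗ[ℂ] M) (a' : ι → ℂ)
    (h : ∀ v, ∃ (y : ι → V) (y' : V), ∑ k, a' k • y k = v ∧
      ∑ k, T.al (es (X k)) * φ (y k) + φ y' ∈ T.N J) :
    ∃ C e, Good a' C e ∧ ∀ v, T.al (es C) * φ v ∈ T.N J := by
  classical
  let B := Module.finBasis ℂ V
  choose y y' hy hN using fun i => h (B i)
  obtain ⟨A, hA⟩ : ∃ A : Matrix (Fin (Module.finrank ℂ V)) (Fin (Module.finrank ℂ V))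
      (MvPolynomial ι ℂ), ∀ i j, A i j = ∑ k, C (B.repr (y i k) j) * X k + C (B.repr (y' i) j) :=
    ⟨fun i j => _, fun _ _ => rfl⟩
  have hhom : ∀ i j, (∑ k, C (B.repr (y i k) j) * X k : MvPolynomial ι ℂ).IsHomogeneous 1 :=
    fun i j => IsHomogeneous.sum _ _ _ fun k _ => by
      simpa using (isHomogeneous_C ι _).mul (isHomogeneous_X ℂ k)
  have hlow := fun i j => linear_add_C_mem_low (hhom i j) (B.repr (y' i) j)
  have hφ : ∀ v, φ v = ∑ j, B.repr v j • φ (B j) := fun v => by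
    conv_lhs => rw [← B.sum_repr v, map_sum]
    simp_rw [map_smul]
  have hrow : ∀ i, ∑ j, T.al (es (A i j)) * φ (B j) ∈ T.N J := by
    intro i
    convert hN i using 1
    simp_rw [hA, hφ (y i _), hφ (y' i), Finset.mul_sum]
    rw [Finset.sum_comm, ← Finset.sum_add_distrib]
    refine Finset.sum_congr rfl fun j _ => ?_
    have hC : ∀ c : ℂ, T.al (es (C c)) = algebraMap ℂ M c := fun c =>
      AlgHom.commutes (T.al.comp es) c
    simp_rw [map_add, map_sum, map_mul, hC, add_mul, Finset.sum_mul, Algebra.smul_def]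
    refine congrArg₂ (· + ·) (Finset.sum_congr rfl fun k _ => ?_) rfl
    ring
  refine ⟨A.det, _, det_good (fun i j => hA i j ▸ (hlow i j).1) ?_, fun v => ?_⟩
  · have h1 : (Matrix.of fun i j =>
        eval a' (weightedHomogeneousComponent (fun _ => 1) 1 (A i j))) = 1 := by
      funext i j
      rw [Matrix.of_apply, hA, (hlow i j).2]
      have h2 := congrArg (fun v => B.repr v j) (hy i)
      simp only [map_sum, map_smul, Finsupp.coe_finsetSum, Finset.sum_apply, Finsupp.smul_apply,
        smul_eq_mul, Module.Basis.repr_self] at h2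
      simp only [map_sum, map_mul, eval_C, eval_X]
      rw [Matrix.one_apply, ← Finsupp.single_apply, ← h2]
      exact Finset.sum_congr rfl fun k _ => mul_comm _ _
    rw [h1, Matrix.det_one]
    exact one_ne_zero
  · rw [hφ, Finset.mul_sum]
    refine sum_mem fun j _ => ?_
    rw [mul_smul_comm]
    refine Submodule.smul_mem _ _ ?_
    have h3 : T.al (es A.det) * φ (B j) =
        ∑ i, T.al (es (A.adjugate j i)) * ∑ j', T.al (es (A i j')) * φ (B j') := by
      simp_rw [Finset.mul_sum, ← mul_assoc, ← map_mul]
      rw [Finset.sum_comm]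
      simp_rw [← Finset.sum_mul, ← map_sum]
      have h4 : ∀ j', ∑ i, A.adjugate j i * A i j' = if j = j' then A.det else 0 := fun j' => by
        have := congrFun (congrFun A.adjugate_mul j) j'
        rw [Matrix.mul_apply] at this
        rw [this, Matrix.smul_apply, Matrix.one_apply]
        simp
      simp_rw [h4]
      rw [Finset.sum_eq_single j]
      · simp
      · intro j' _ hj'
        rw [if_neg hj'.symm]
        simp
      · simp
    rw [h3]
    exact sum_mem fun i _ => T.al_mul_mem_N (hrow i) _

end

section
variable {n : ℕ} {ι : Type} [Fintype ι] {a : ι → Fin n → ℂ} {M : Type} [CommRing M] [Algebra ℂ M]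

theorem comp_pderiv_comp {P : Matrix (Fin n) (Fin n) ℂ} (hP : P * P = P)
    (f : MvPolynomial (Fin n) ℂ) (j : Fin n) :
    comp P (pderiv j (comp P f)) = pderiv j (comp P f) := by
  rw [pderiv_comp, map_sum]
  exact Finset.sum_congr rfl fun i _ => by rw [map_mul, comp_comp hP, comp_C]

theorem exists_components_of_mem_span {τ κ : Type} [Fintype κ] {g : κ → MvPolynomial τ ℂ} {e : κ → ℕ}
    (hg : ∀ i, (g i).IsHomogeneous (e i)) {f : MvPolynomial τ ℂ} {d : ℕ} (hf : f.IsHomogeneous d)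
    (h : f ∈ Ideal.span (Set.range g)) : ∃ c : κ → MvPolynomial τ ℂ,
      (∀ i, c i = 0 ∨ (c i).IsHomogeneous (d - e i) ∧ e i ≤ d) ∧ f = ∑ i, c i * g i := by
  rw [Ideal.span, Submodule.mem_span_range_iff_exists_fun] at h
  obtain ⟨c, hc⟩ := h
  have hc' := congrArg (weightedHomogeneousComponent (fun _ => 1) d) hc
  have hf' : IsWeightedHomogeneous (fun _ => 1) f d := hf
  rw [hf'.weightedHomogeneousComponent_same, map_sum] at hc'
  refine ⟨fun i => if e i ≤ d then weightedHomogeneousComponent (fun _ => 1) (d - e i) (c i) else 0,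
    fun i => ?_, ?_⟩
  · by_cases h : e i ≤ d
    · right
      simp only [if_pos h]
      exact ⟨weightedHomogeneousComponent_isWeightedHomogeneous _ _, h⟩
    · left
      simp only [if_neg h]
  · rw [← hc']
    refine Finset.sum_congr rfl fun i _ => ?_
    have hg' : IsWeightedHomogeneous (fun _ => 1) (g i) (e i) := hg i
    rw [smul_eq_mul, weightedHomogeneousComponent_mul_of_isWeightedHomogeneous _ _ hg' d]
    by_cases h : e i ≤ d
    · simp only [if_pos h]
    · simp only [if_neg h, zero_mul]

theorem nab_al (T : Twist a M) (J : Finset ι) (i : Fin n) (r : MvPolynomial (Fin n ⊕ ι) ℂ) :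
    T.nab J i (T.al r) = T.al (pderiv (Sum.inl i) r) + T.al r * T.ψ J i := by
  have : T.nab J i (T.al r) = T.nab J i (T.al r * 1) := by rw [mul_one]
  rw [this, T.nab_al_mul, Twist.nab_apply, Derivation.map_one_eq_zero, zero_add, mul_one, mul_one]

namespace Saito
variable {J : Finset ι} (B : Saito a J)

theorem sum_nab (T : Twist a M) (i : Fin n) (g : MvPolynomial (Fin n) ℂ) (b : MvPolynomial ι ℂ) :
    ∑ j, T.nab J j (T.al (ex (B.χ i j * g) * es b)) =
      ∑ k ∈ J, T.al (es (X k)) * T.al (ex (g * B.q i k) * es b) +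
        T.al (ex (∑ j, pderiv j (B.χ i j * g)) * es b) := by
  have h : ∀ j, T.nab J j (T.al (ex (B.χ i j * g) * es b)) =
      T.al (ex (pderiv j (B.χ i j * g)) * es b) +
        T.al (ex g * es b) * (T.al (ex (B.χ i j)) * T.ψ J j) := by
    intro j
    rw [nab_al, pderiv_mul, Twist.pderiv_ex, pderiv_es, mul_zero, add_zero, map_mul ex,
      map_mul T.al (ex (B.χ i j) * ex g), map_mul T.al (ex (B.χ i j)), map_mul T.al (ex g)]
    ring
  have hψ : ∑ j, T.al (ex (B.χ i j)) * T.ψ J j =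
      ∑ k ∈ J, T.al (es (X k)) * T.al (ex (B.q i k)) := by
    simp_rw [Twist.ψ, Finset.mul_sum]
    rw [Finset.sum_comm]
    refine Finset.sum_congr rfl fun k hk => ?_
    have h1 := congrArg T.al (congrArg ex (B.app_eq i k hk))
    rw [app, map_sum, map_sum, map_mul ex, map_mul T.al] at h1
    have h2 : ∑ j, T.al (ex (B.χ i j)) * (T.al (C (a k j) * X (Sum.inr k)) * T.il k) =
        T.al (X (Sum.inr k)) * T.il k * ∑ j, T.al (ex (C (a k j) * B.χ i j)) := by
      rw [Finset.mul_sum]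
      refine Finset.sum_congr rfl fun j _ => ?_
      rw [map_mul ex, ex_C, map_mul, map_mul]
      ring
    rw [h2, h1, es_X]
    linear_combination T.al (X (Sum.inr k)) * T.al (ex (B.q i k)) * T.il_mul k
  rw [Finset.sum_congr rfl fun j _ => h j, Finset.sum_add_distrib, ← Finset.mul_sum, hψ,
    Finset.mul_sum, ← map_sum, ← Finset.sum_mul, ← map_sum, add_comm]
  refine congrArg₂ (· + ·) (Finset.sum_congr rfl fun k _ => ?_) rfl
  rw [map_mul ex, map_mul, map_mul, map_mul]
  ring

theorem sum_mem_N (T : Twist a M) (ha : Reduced a) (i : Fin n) {d : ℕ} {b : MvPolynomial ι ℂ}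
    (hb : ∀ g : MvPolynomial (Fin n) ℂ, g.IsHomogeneous (d + 1) → comp B.π g ∈ T.ann J b)
    {g : MvPolynomial (Fin n) ℂ} (hχ : ∀ j, (B.χ i j * g).IsHomogeneous (d + 1)) :
    ∑ k ∈ J, T.al (es (X k)) * T.al (ex (comp B.π (g * B.q i k)) * es b) +
      T.al (ex (comp B.π (∑ j, pderiv j (comp B.π (B.χ i j * g)))) * es b) ∈ T.N J := by
  have h3 : ∀ j, comp B.π (B.χ i j * g) = B.χ i j * comp B.π g := fun j => by
    rw [map_mul, B.comp_χ]
  have h4 : comp B.π (∑ j, pderiv j (comp B.π (B.χ i j * g))) =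
      ∑ j, pderiv j (B.χ i j * comp B.π g) := by
    rw [map_sum]
    exact Finset.sum_congr rfl fun j _ => by rw [comp_pderiv_comp B.π_sq, h3]
  have h5 : ∑ k ∈ J, T.al (es (X k)) * T.al (ex (comp B.π (g * B.q i k)) * es b) =
      ∑ k ∈ J, T.al (es (X k)) * T.al (ex (comp B.π g * B.q i k) * es b) :=
    Finset.sum_congr rfl fun k hk => by rw [map_mul (comp B.π), B.comp_q ha i hk]
  rw [h4, h5, ← B.sum_nab T i (comp B.π g) b]
  refine sum_mem fun j _ => T.nab_mem_N ?_ j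
  rw [← h3]
  exact hb _ (hχ j)

theorem descent (T : Twist a M) (ha : Reduced a) (hirr : Irr a J) (hne : J.Nonempty)
    (hJ : IsFlat a J) {s : ι → ℂ} (hs : ∑ k ∈ J, s k = 0)
    (hs' : ∀ S : Finset ι, S ⊆ J → S ≠ J → S.Nonempty → IsFlat a S → ∑ k ∈ S, s k ≠ 0)
    {k₁ : ι} (hk₁ : s k₁ = 1) {d : ℕ} (hd : 2 * (J.card - (n - Module.finrank ℂ (flat a J))) < d)
    {b : MvPolynomial ι ℂ}
    (hb : ∀ g : MvPolynomial (Fin n) ℂ, g.IsHomogeneous (d + 1) → comp B.π g ∈ T.ann J b) :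
    ∃ C e, Good s C e ∧
      ∀ g : MvPolynomial (Fin n) ℂ, g.IsHomogeneous d → comp B.π g ∈ T.ann J (C * b) := by
  classical
  obtain ⟨ζ, hζ0, -, hζ⟩ := B.exists_coords ha
  have hspan := (B.sys_socle ha hirr hne hJ hζ hs hs' d).mpr hd
  let φ : homogeneousSubmodule (Fin n) ℂ d →ₗ[ℂ] M :=
    (LinearMap.mulLeft ℂ (T.al (es b))) ∘ₗ (T.al.comp (ex.comp (comp B.π))).toLinearMap ∘ₗ
      (homogeneousSubmodule (Fin n) ℂ d).subtype
  have hφ : ∀ g, φ g = T.al (ex (comp B.π g) * es b) := fun g => by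
    rw [map_mul, mul_comm]
    rfl
  have hfin : Module.Finite ℂ (homogeneousSubmodule (Fin n) ℂ d) := inferInstance
  obtain ⟨C', e, hC, h⟩ := T.exists_good_of_linear (J := J) (homogeneousSubmodule (Fin n) ℂ d) φ s (by
    rintro ⟨v, hv⟩
    let P : MvPolynomial (Fin n) ℂ → Prop := fun v =>
      ∃ (y : ι → homogeneousSubmodule (Fin n) ℂ d) (y' : homogeneousSubmodule (Fin n) ℂ d),
        ((∑ k, s k • y k : homogeneousSubmodule (Fin n) ℂ d) : MvPolynomial (Fin n) ℂ) = v ∧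
        ∑ k, T.al (es (X k)) * φ (y k) + φ y' ∈ T.N J
    suffices hP : P v by
      obtain ⟨y, y', h1, h2⟩ := hP
      exact ⟨y, y', Subtype.ext h1, h2⟩
    have h0 : P 0 := ⟨0, 0, by simp, by simp⟩
    have hadd : ∀ f g, P f → P g → P (f + g) := by
      rintro f g ⟨y, y', h1, h2⟩ ⟨z, z', h3, h4⟩
      refine ⟨y + z, y' + z', ?_, ?_⟩
      · simp only [Pi.add_apply, smul_add, Finset.sum_add_distrib]
        rw [Submodule.coe_add, h1, h3]
      · simp only [Pi.add_apply, map_add, mul_add, Finset.sum_add_distrib]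
        rw [add_add_add_comm]
        exact add_mem h2 h4
    have hann : ∀ f, f.IsHomogeneous d → comp B.π f ∈ T.ann J b → P f := by
      intro f hf hfN
      refine ⟨Pi.single k₁ ⟨f, hf⟩, 0, ?_, ?_⟩
      · rw [Finset.sum_eq_single k₁]
        · simp [hk₁]
        · intro k _ hk
          rw [Pi.single_eq_of_ne hk, smul_zero]
        · simp
      · rw [map_zero, add_zero]
        refine sum_mem fun k _ => T.al_mul_mem_N ?_ _
        by_cases hk : k = k₁
        · subst hk
          rw [Pi.single_eq_same, hφ]
          exact hfN
        · rw [Pi.single_eq_of_ne hk, map_zero]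
          exact zero_mem _
    obtain ⟨c, hc, hsum⟩ := exists_components_of_mem_span (g := B.sys ζ s)
      (e := fun i => if B.d i = 0 then 1 else if B.d i = 1 then J.card else B.d i - 1) (B.isHomogeneous_sys ha ζ s) hv (hspan hv)
    rw [hsum]
    refine Finset.sum_induction _ P hadd h0 fun i _ => ?_
    rcases hc i with hi | ⟨hi, hed⟩
    · rw [hi, zero_mul]
      exact h0
    have hhom := fun (f : MvPolynomial (Fin n) ℂ) e' (hf : f.IsHomogeneous e') => hi.mul hf
    by_cases hd0 : B.d i = 0
    · simp only [hd0, if_true] at hi hed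
      refine hann _ ?_ ?_
      · rw [sys, if_pos hd0]
        have := hi.mul (isHomogeneous_lin (ζ i))
        rwa [Nat.sub_add_cancel hed] at this
      · rw [sys, if_pos hd0, map_mul, comp_lin, hζ0, lin_zero, mul_zero]
        exact zero_mem _
    by_cases hd1 : B.d i = 1
    · simp only [hd1, if_true, one_ne_zero, if_false] at hi hed
      refine hann _ ?_ ?_
      · rw [sys, if_neg hd0, if_pos hd1]
        have := hi.mul (isHomogeneous_prod_lin a J)
        rwa [Nat.sub_add_cancel hed] at this
      · rw [sys, if_neg hd0, if_pos hd1, map_mul, B.comp_dp]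
        refine Ideal.mul_mem_left _ _ ?_
        rw [Twist.mem_ann, map_mul, mul_comm]
        exact T.al_mul_mem_N T.dp_mem_N _
    · simp only [hd0, hd1, if_false] at hi hed
      obtain ⟨g, hg⟩ : ∃ g, g = c i := ⟨_, rfl⟩
      rw [sys, if_neg hd0, if_neg hd1, ← hg]
      rw [← hg] at hi
      have hy : ∀ k, (if k ∈ J then g * B.q i k else 0) ∈ homogeneousSubmodule (Fin n) ℂ d := by
        intro k
        split_ifs with hk
        · have := hi.mul (B.isHomogeneous_q ha i hk)
          rwa [Nat.sub_add_cancel hed] at this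
        · exact zero_mem _
      have hχ : ∀ j, (B.χ i j * g).IsHomogeneous (d + 1) := by
        intro j
        have := (B.hom i j).mul hi
        convert this using 1
        omega
      have hy' : ∑ j, pderiv j (comp B.π (B.χ i j * g)) ∈ homogeneousSubmodule (Fin n) ℂ d := by
        refine sum_mem fun j _ => ?_
        exact (IsHomogeneous.comp (hχ j)).pderiv
      refine ⟨fun k => ⟨_, hy k⟩, ⟨_, hy'⟩, ?_, ?_⟩
      · rw [AddSubmonoidClass.coe_finsetSum]
        simp only [Submodule.coe_smul]
        rw [α, Finset.mul_sum, ← Finset.sum_subset (Finset.subset_univ J)]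
        · refine Finset.sum_congr rfl fun k hk => ?_
          rw [if_pos hk, smul_eq_C_mul]
          ring
        · intro k _ hk
          rw [if_neg hk, smul_zero]
      · have h1 := B.sum_mem_N T ha i hb hχ
        have h2 : ∑ k, T.al (es (X k)) * φ ⟨_, hy k⟩ =
            ∑ k ∈ J, T.al (es (X k)) * T.al (ex (comp B.π (g * B.q i k)) * es b) := by
          rw [← Finset.sum_subset (Finset.subset_univ J)]
          · refine Finset.sum_congr rfl fun k hk => ?_
            rw [hφ]
            simp only [if_pos hk]
          · intro k _ hk
            rw [hφ]
            simp only [if_neg hk]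
            rw [map_zero (comp B.π), map_zero ex, zero_mul, map_zero T.al, mul_zero]
        rw [h2, hφ]
        exact h1)
  refine ⟨C', e, hC, fun g hg => ?_⟩
  have h1 := h ⟨g, hg⟩
  rw [hφ] at h1
  rw [Twist.mem_ann]
  convert h1 using 1
  rw [← map_mul, map_mul es]
  refine congrArg T.al ?_
  ring

end Saito
end

section
variable {n : ℕ} {ι : Type} {a : ι → Fin n → ℂ} {M : Type} [CommRing M] [Algebra ℂ M]

theorem eval_component_es {θ : MvPolynomial ι ℂ} {e : ℕ} (hθ : θ ∈ low ℂ (fun _ => 1) (e + 1))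
    (z : Fin n ⊕ ι → ℂ) :
    (es θ : MvPolynomial (Fin n ⊕ ι) ℂ) ∈ low ℂ sWeight (e + 1) ∧
      eval z (weightedHomogeneousComponent sWeight e (es θ)) =
        eval (z ∘ Sum.inr) (weightedHomogeneousComponent (fun _ => 1) e θ) := by
  have hf : ∀ i : ι, (sWeight (Sum.inr i : Fin n ⊕ ι)) = (fun _ => 1) i := fun i => rfl
  refine ⟨rename_mem_low hf hθ, ?_⟩
  rw [es, component_rename hf hθ, eval_rename]

theorem prod_linear_mem_low (S : Finset ι) (N : ℕ) (c : ℕ → ℂ) :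
    (∏ j ∈ Finset.range N, (∑ k ∈ S, X k + C (c j)) : MvPolynomial ι ℂ) ∈ low ℂ (fun _ => 1) (N + 1) ∧
      weightedHomogeneousComponent (fun _ => 1) N
        (∏ j ∈ Finset.range N, (∑ k ∈ S, X k + C (c j)) : MvPolynomial ι ℂ) = (∑ k ∈ S, X k) ^ N := by
  have hl : (∑ k ∈ S, X k : MvPolynomial ι ℂ).IsHomogeneous 1 :=
    IsHomogeneous.sum _ _ _ fun k _ => isHomogeneous_X _ k
  have h := prod_mem_low (Finset.range N) (w := fun _ => 1)
    (f := fun j => (∑ k ∈ S, X k + C (c j) : MvPolynomial ι ℂ))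
    fun j _ => (linear_add_C_mem_low hl (c j)).1
  rw [Finset.card_range] at h
  refine ⟨h.1, h.2.trans ?_⟩
  rw [Finset.prod_congr rfl fun j _ => (linear_add_C_mem_low hl (c j)).2, Finset.prod_const,
    Finset.card_range]

theorem sum_eq_zero_of_prod_linear {S : Finset ι} {N : ℕ} {c : ℕ → ℂ} {z : Fin n ⊕ ι → ℂ}
    (h : ∀ e, (es (∏ j ∈ Finset.range N, (∑ k ∈ S, X k + C (c j))) : MvPolynomial (Fin n ⊕ ι) ℂ) ∈
        low ℂ sWeight (e + 1) →
      eval z (weightedHomogeneousComponent sWeight e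
        (es (∏ j ∈ Finset.range N, (∑ k ∈ S, X k + C (c j))))) = 0) :
    ∑ k ∈ S, z (Sum.inr k) = 0 := by
  obtain ⟨h1, h2⟩ := prod_linear_mem_low S N c
  obtain ⟨h3, h4⟩ := eval_component_es h1 z
  have h5 := h N h3
  rw [h4, h2, map_pow, map_sum] at h5
  have := eq_zero_of_pow_eq_zero h5
  simpa using this

namespace Twist
variable (T : Twist a M)

theorem exists_prod_mem_N {J : Finset ι} (hJ : IsFlat a J)
    (ih : ∀ S, S ⊆ J → S ≠ J → IsFlat a S → T.al (es (bpol a S)) ∈ T.N S)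
    {J₁ J₂ : Finset ι} (h₁ : J₁ ⊆ J) (h₂ : ∀ k ∈ J, k ∉ J₁ → k ∈ J₂)
    (hsup : flat a J₁ ⊔ flat a J₂ = ⊤) : ∃ (N : ℕ) (c : ℕ → ℂ),
      T.al (es (∏ j ∈ Finset.range N, (∑ k ∈ J₁, X k + C (c j)))) * T.al (es (bsub a J)) ∈ T.N J := by
  obtain ⟨P, hP, hker, h1, h0, -⟩ := exists_projection hsup
  obtain ⟨N, hN⟩ := T.exists_comp_mem_ann hJ ih (P := P) fun v hv =>
    (hker v).mpr fun k hk => hv k (h₁ hk)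
  refine ⟨N, fun j => P.trace + j, ?_⟩
  rw [← map_mul, ← map_mul]
  exact T.euler_prod hP h₁ h1 (fun k hk hk' => h0 k (h₂ k hk hk')) N _ (hN N le_rfl)

theorem al_mem_range (J : Finset ι) (r : MvPolynomial (Fin n ⊕ ι) ℂ) :
    T.al r ∈ LinearMap.range (T.L J 1) := ⟨emb r, by rw [T.L_emb, mul_one]⟩

variable [Fintype ι]

theorem length_toList_erase [DecidableEq ι] {k₀ k₁ : ι} (h : k₀ ≠ k₁) {β : Type} (f : ι → β) :
    (((Finset.univ.erase k₀).erase k₁).toList.map f).length + 2 ≤ Fintype.card ι := by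
  rw [List.length_map, Finset.length_toList, Finset.card_erase_of_mem
    (Finset.mem_erase.mpr ⟨h.symm, Finset.mem_univ _⟩), Finset.card_erase_of_mem (Finset.mem_univ _),
    Finset.card_univ]
  have : 1 < Fintype.card ι := Fintype.one_lt_card_iff.mpr ⟨_, _, h⟩
  omega

theorem bsub_mem_N_of_not_irr (ha : Reduced a) {J : Finset ι} (hJ : IsFlat a J) (B : Saito a J)
    (hn : ¬ Irr a J)
    (ih : ∀ S, S ⊆ J → S ≠ J → IsFlat a S → T.al (es (bpol a S)) ∈ T.N S) :
    T.al (es (bsub a J)) ∈ T.N J := by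
  classical
  obtain ⟨J₁, J₂, ⟨k₁, hk₁⟩, ⟨k₂, hk₂⟩, hdis, hmem, hsup⟩ := exists_split_of_not_irr ha hn
  have hne : k₁ ≠ k₂ := fun h => Finset.disjoint_left.mp hdis hk₁ (h ▸ hk₂)
  obtain ⟨N₁, c₁, h1⟩ := T.exists_prod_mem_N hJ ih (fun k hk => (hmem k).mpr (Or.inl hk))
    (fun k hk hk' => ((hmem k).mp hk).resolve_left hk') hsup
  obtain ⟨N₂, c₂, h2⟩ := T.exists_prod_mem_N hJ ih (fun k hk => (hmem k).mpr (Or.inr hk))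
    (fun k hk hk' => ((hmem k).mp hk).resolve_right hk') (by rw [sup_comm]; exact hsup)
  refine T.mem_N_of_ann ha B
    {es (∏ j ∈ Finset.range N₁, (∑ k ∈ J₁, X k + C (c₁ j))),
      es (∏ j ∈ Finset.range N₂, (∑ k ∈ J₂, X k + C (c₂ j)))}
    (((Finset.univ.erase k₁).erase k₂).toList.map fun k => Pi.single k 1)
    (length_toList_erase hne _) ?_ (T.al_mem_range J _) ?_
  · intro z _ hθ hu
    have h3 : ∑ k ∈ J₁, z (Sum.inl (Sum.inr k)) = 0 :=
      sum_eq_zero_of_prod_linear (hθ _ (Or.inl rfl))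
    have h4 : ∑ k ∈ J₂, z (Sum.inl (Sum.inr k)) = 0 := sum_eq_zero_of_prod_linear (hθ _ (Or.inr rfl))
    have h5 : ∀ k, k ≠ k₁ → k ≠ k₂ → z (Sum.inl (Sum.inr k)) = 0 := by
      intro k hk hk'
      have := hu (Pi.single k 1) (List.mem_map.mpr ⟨k, by simp [hk, hk'], rfl⟩)
      rwa [single_one_dotProduct] at this
    rw [Finset.sum_eq_single k₁ (fun k hk hk' => h5 k hk' fun h =>
      Finset.disjoint_left.mp hdis hk (h ▸ hk₂)) (fun h => absurd hk₁ h)] at h3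
    rw [Finset.sum_eq_single k₂ (fun k hk hk' => h5 k (fun h =>
      Finset.disjoint_left.mp hdis hk₁ (h ▸ hk)) hk') (fun h => absurd hk₂ h)] at h4
    intro k
    by_cases hk : k = k₁
    · rw [hk]
      exact h3
    by_cases hk' : k = k₂
    · rw [hk']
      exact h4
    exact h5 k hk hk'
  · rintro θ (rfl | rfl)
    · exact h1
    · exact h2

theorem fac_bsub_mem_N_of_card_le_one {J : Finset ι} (hne : J.Nonempty)
    (h1 : J.card ≤ 1) (B : Saito a J) : T.al (es (fac a J * bsub a J)) ∈ T.N J := by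
  obtain ⟨k, rfl⟩ := Finset.card_eq_one.mp (le_antisymm h1 hne.card_pos)
  have h2 : ∀ i, comp B.π (X i) ∈ T.ann {k} (bsub a {k}) := by
    intro i
    have h3 : B.π i ∈ Submodule.span ℂ (a '' (({k} : Finset ι) : Set ι)) :=
      mem_span_of_forall_flat fun v hv => by
        have := congrFun ((B.π_ker v).mpr hv) i
        exact this
    rw [Finset.coe_singleton, Set.image_singleton, Submodule.mem_span_singleton] at h3
    obtain ⟨c, hc⟩ := h3
    have h4 : comp B.π (X i) = C c * dp a {k} := by
      rw [comp_X, ← hc, lin_smul, dp, Finset.prod_singleton]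
    rw [h4]
    refine Ideal.mul_mem_left _ _ ?_
    rw [mem_ann, map_mul, mul_comm]
    exact T.al_mul_mem_N T.dp_mem_N _
  have h3 : idealOfVars (Fin n) ℂ ≤ (T.ann {k} (bsub a {k})).comap (comp B.π) := by
    rw [idealOfVars, Ideal.span_le]
    rintro _ ⟨i, rfl⟩
    exact h2 i
  have := T.euler_prod B.π_sq (subset_refl {k}) B.π_form (fun k' hk hk' => absurd hk hk')
    (2 * (({k} : Finset ι).card - (n - Module.finrank ℂ (flat a {k}))) + 1) (bsub a {k})
    fun g hg => h3 ?_
  · rw [B.π_trace] at this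
    exact this
  · rw [← pow_one (idealOfVars (Fin n) ℂ), mem_pow_idealOfVars_iff]
    intro x hx
    have := hg (mem_support_iff.mp hx)
    rw [Finsupp.degree_eq_weight_one]
    exact (Nat.le_add_left 1 _).trans (by rw [← this]; rfl)

theorem exists_good_mem_N (ha : Reduced a) {J : Finset ι} (hJ : IsFlat a J) (hne : J.Nonempty)
    (B : Saito a J) (hirr : Irr a J)
    (ih : ∀ S, S ⊆ J → S ≠ J → IsFlat a S → T.al (es (bpol a S)) ∈ T.N S)
    {s : ι → ℂ} (hs : ∑ k ∈ J, s k = 0)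
    (hs' : ∀ S : Finset ι, S ⊆ J → S ≠ J → S.Nonempty → IsFlat a S → ∑ k ∈ S, s k ≠ 0)
    {k₁ : ι} (hk₁ : s k₁ = 1) :
    ∃ C e, Good s C e ∧ T.al (es C) * T.al (es (fac a J * bsub a J)) ∈ T.N J := by
  obtain ⟨D, hD⟩ : ∃ D, D = 2 * (J.card - (n - Module.finrank ℂ (flat a J))) + 1 := ⟨_, rfl⟩
  have hstep : ∀ j, (∃ C e, Good s C e ∧ ∀ g : MvPolynomial (Fin n) ℂ, g.IsHomogeneous (D + j) →
      comp B.π g ∈ T.ann J (C * bsub a J)) → ∃ C e, Good s C e ∧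
      ∀ g : MvPolynomial (Fin n) ℂ, g.IsHomogeneous D → comp B.π g ∈ T.ann J (C * bsub a J) := by
    intro j
    induction j with
    | zero => exact id
    | succ j ihj =>
      rintro ⟨C, e, hC, h⟩
      obtain ⟨C', e', hC', h'⟩ := B.descent T ha hirr hne hJ hs hs' hk₁ (d := D + j) (by omega) h
      refine ihj ⟨C' * C, e' + e, hC'.mul hC, fun g hg => ?_⟩
      rw [mul_assoc]
      exact h' g hg
  obtain ⟨N, hN⟩ := T.exists_comp_mem_ann hJ ih (P := B.π) fun v hv => (B.π_ker v).mpr hv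
  obtain ⟨C, e, hC, h⟩ := hstep N ⟨1, 0, good_one s, fun g hg => by
    rw [one_mul]
    exact hN _ (Nat.le_add_left N D) g hg⟩
  refine ⟨C, e, hC, ?_⟩
  have := T.euler_prod B.π_sq (subset_refl J) B.π_form (fun k' hk hk' => absurd hk hk') D _ h
  rw [B.π_trace, hD] at this
  rw [← map_mul, ← map_mul]
  have h2 : C * (fac a J * bsub a J) = fac a J * (C * bsub a J) := by ring
  rw [h2]
  exact this

theorem fac_bsub_mem_N (ha : Reduced a) {J : Finset ι} (hJ : IsFlat a J) (h1 : 1 < J.card)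
    (B : Saito a J) (hirr : Irr a J)
    (ih : ∀ S, S ⊆ J → S ≠ J → IsFlat a S → T.al (es (bpol a S)) ∈ T.N S) :
    T.al (es (fac a J * bsub a J)) ∈ T.N J := by
  classical
  obtain ⟨k₀, hk₀, k₁, hk₁, hne⟩ := Finset.one_lt_card.mp h1
  have hJne : J.Nonempty := ⟨k₀, hk₀⟩
  obtain ⟨s, hsdef⟩ : ∃ s : ι → ℂ, s = fun k =>
    if k = k₀ then -((J.card : ℂ) - 1) else if k ∈ J then 1 else 0 := ⟨_, rfl⟩
  have hs0 : s k₀ = -((J.card : ℂ) - 1) := by rw [hsdef]; exact if_pos rfl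
  have hs1 : ∀ k ∈ J, k ≠ k₀ → s k = 1 := fun k hk hk' => by
    simp only [hsdef, if_neg hk', if_pos hk]
  have hs2 : ∀ k, k ∉ J → s k = 0 := fun k hk => by
    have : k ≠ k₀ := fun h => hk (h ▸ hk₀)
    simp only [hsdef, if_neg this, if_neg hk]
  have hsum : ∀ S ⊆ J, k₀ ∈ S → ∑ k ∈ S, s k = (S.card : ℂ) - J.card := by
    intro S hS hk
    rw [← Finset.add_sum_erase _ _ hk, hs0, Finset.sum_congr rfl fun k hk' =>
      hs1 k (hS (Finset.mem_of_mem_erase hk')) (Finset.ne_of_mem_erase hk'),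
      ← Finset.card_erase_add_one hk]
    simp
    ring
  have hs : ∑ k ∈ J, s k = 0 := by rw [hsum J subset_rfl hk₀, sub_self]
  obtain ⟨C', e, hC, h⟩ := T.exists_good_mem_N ha hJ hJne B hirr ih hs (fun S hS hSJ hSne _ => by
    by_cases hk : k₀ ∈ S
    · rw [hsum S hS hk, sub_ne_zero, Ne, Nat.cast_inj]
      exact fun h => hSJ (Finset.eq_of_subset_of_card_le hS h.ge)
    · rw [Finset.sum_congr rfl fun k hk' => hs1 k (hS hk') fun h => hk (h ▸ hk')]
      simpa using hSne.ne_empty) (hs1 k₁ hk₁ hne.symm)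
  obtain ⟨N, c, hN⟩ := T.exists_prod_mem_N hJ ih (J₁ := J) (J₂ := ∅) subset_rfl
    (fun k hk hk' => absurd hk hk') (by
      rw [eq_top_iff]
      exact le_sup_of_le_right fun v _ => by simp [mem_flat])
  refine T.mem_N_of_ann ha B
    {es (∏ j ∈ Finset.range N, (∑ k ∈ J, X k + C (c j))), es C'}
    (((Finset.univ.erase k₀).erase k₁).toList.map fun k =>
      if k ∈ J then Pi.single k 1 - Pi.single k₁ 1 else Pi.single k 1)
    (length_toList_erase hne _) ?_ (T.al_mem_range J _) ?_
  · intro z _ hθ hu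
    have h3 : ∑ k ∈ J, z (Sum.inl (Sum.inr k)) = 0 :=
      sum_eq_zero_of_prod_linear (hθ _ (Or.inl rfl))
    have h5 : ∀ k, k ≠ k₀ → k ≠ k₁ → z (Sum.inl (Sum.inr k)) =
        if k ∈ J then z (Sum.inl (Sum.inr k₁)) else 0 := by
      intro k hk hk'
      have := hu _ (List.mem_map.mpr ⟨k, by simp [hk, hk'], rfl⟩)
      split_ifs with hkJ
      · rw [if_pos hkJ, sub_dotProduct, single_one_dotProduct, single_one_dotProduct] at this
        exact sub_eq_zero.mp this
      · rwa [if_neg hkJ, single_one_dotProduct] at this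
    have h6 : ∀ k, k ≠ k₀ → z (Sum.inl (Sum.inr k)) = z (Sum.inl (Sum.inr k₁)) * s k := by
      intro k hk
      by_cases hk' : k = k₁
      · rw [hk', hs1 k₁ hk₁ hne.symm, mul_one]
      · rw [h5 k hk hk']
        split_ifs with hkJ
        · rw [hs1 k hkJ hk, mul_one]
        · rw [hs2 k hkJ, mul_zero]
    have h7 : z (Sum.inl (Sum.inr k₀)) = z (Sum.inl (Sum.inr k₁)) * s k₀ := by
      rw [← Finset.add_sum_erase _ _ hk₀] at h3 hs
      rw [Finset.sum_congr rfl fun k hk => h6 k (Finset.ne_of_mem_erase hk), ← Finset.mul_sum] at h3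
      linear_combination h3 - z (Sum.inl (Sum.inr k₁)) * hs
    have h8 : ∀ k, z (Sum.inl (Sum.inr k)) = z (Sum.inl (Sum.inr k₁)) * s k := fun k => by
      by_cases hk : k = k₀
      · rw [hk]
        exact h7
      · exact h6 k hk
    obtain ⟨h9, h10⟩ := eval_component_es hC.1 (z ∘ Sum.inl)
    have h11 := hθ _ (Or.inr rfl) e h9
    have h12 : eval ((z ∘ Sum.inl) ∘ Sum.inr) (weightedHomogeneousComponent (fun _ => 1) e C') =
        z (Sum.inl (Sum.inr k₁)) ^ e * eval s (weightedHomogeneousComponent (fun _ => 1) e C') := by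
      have := aeval_smul_pow (A := ℂ) (f := s) (r := z (Sum.inl (Sum.inr k₁)))
        (weightedHomogeneousComponent_isWeightedHomogeneous (w := fun _ => 1) e C')
      rw [← coe_aeval_eq_eval, ← coe_aeval_eq_eval, RingHom.coe_coe, RingHom.coe_coe, ← this]
      congr 1
      congr 1
      funext k
      rw [pow_one]
      exact h8 k
    rw [h10, h12] at h11
    have h13 := eq_zero_of_pow_eq_zero ((mul_eq_zero.mp h11).resolve_right hC.2)
    intro k
    rw [h8, h13, zero_mul]
  · rintro θ (rfl | rfl)
    · rw [map_mul es, map_mul T.al, mul_left_comm]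
      exact T.al_mul_mem_N hN _
    · exact h

theorem bpol_mem_N (ha : Reduced a) (hB : ∀ J, IsFlat a J → Nonempty (Saito a J)) {J : Finset ι}
    (hJ : IsFlat a J) : T.al (es (bpol a J)) ∈ T.N J := by
  induction J using Finset.strongInduction with
  | H J ih =>
    have ih' : ∀ S, S ⊆ J → S ≠ J → IsFlat a S → T.al (es (bpol a S)) ∈ T.N S :=
      fun S hS hne => ih S (hS.ssubset_of_ne hne)
    obtain ⟨B⟩ := hB J hJ
    by_cases hn : Irr a J
    · rcases J.eq_empty_or_nonempty with rfl | hne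
      · rw [← mul_one (T.al _)]
        refine T.al_mul_mem_N ?_ _
        simpa [dp] using T.dp_mem_N (J := ∅)
      · rw [bpol_of_irr ⟨hne, hJ, hn⟩]
        rcases le_or_gt J.card 1 with h1 | h1
        · exact T.fac_bsub_mem_N_of_card_le_one hne h1 B
        · exact T.fac_bsub_mem_N ha hJ h1 B hn ih'
    · rw [bpol_of_not_irr fun h => hn h.2.2]
      exact T.bsub_mem_N_of_not_irr ha hJ B hn ih'

end Twist
end

section
theorem mem_ofList_of_X_mul_mem {R : Type} [CommRing R] (fs : List (Polynomial R))
    (hreg : ∀ gs g, gs ++ [g] <+: fs → ∀ v : R,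
      Polynomial.eval 0 g * v ∈ (Ideal.ofList gs).map (Polynomial.evalRingHom (0 : R)) →
        v ∈ (Ideal.ofList gs).map (Polynomial.evalRingHom (0 : R))) {v : Polynomial R}
    (hv : Polynomial.X * v ∈ Ideal.ofList fs) : v ∈ Ideal.ofList fs := by
  induction fs using List.reverseRecOn generalizing v with
  | nil =>
    rw [Ideal.ofList_nil, Ideal.mem_bot] at hv ⊢
    rw [Polynomial.X_mul] at hv
    exact Polynomial.isRegular_X.right.mul_right_eq_zero_iff.mp hv
  | append_singleton fs f ih =>
    rw [Ideal.ofList_append, Ideal.ofList_singleton, Submodule.mem_sup] at hv ⊢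
    obtain ⟨y, hy, z, hz, hyz⟩ := hv
    obtain ⟨u, rfl⟩ := Ideal.mem_span_singleton.mp hz
    have h0 := congrArg (Polynomial.eval (0 : R)) hyz
    rw [Polynomial.eval_add, Polynomial.eval_mul, Polynomial.eval_mul, Polynomial.eval_X, zero_mul] at h0
    have hu : Polynomial.eval 0 u ∈ (Ideal.ofList fs).map (Polynomial.evalRingHom (0 : R)) := by
      refine hreg fs f (List.prefix_refl _) _ ?_
      rw [eq_neg_of_add_eq_zero_right h0]
      exact neg_mem (Ideal.mem_map_of_mem (Polynomial.evalRingHom (0 : R)) hy)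
    rw [Ideal.mem_map_iff_of_surjective _ (fun r => ⟨Polynomial.C r, by simp⟩)] at hu
    obtain ⟨r, hr, hru⟩ := hu
    obtain ⟨u', hu'⟩ : Polynomial.X ∣ u - r := by
      rw [Polynomial.X_dvd_iff, Polynomial.coeff_zero_eq_eval_zero, Polynomial.eval_sub, ← hru]
      simp
    have h1 := ih (fun gs g h => hreg gs g (h.trans (List.prefix_append _ _))) (v := v - f * u') (by
      have : Polynomial.X * (v - f * u') = y + f * r := by
        rw [mul_sub, ← hyz]
        linear_combination f * hu'
      rw [this]
      exact add_mem hy (Ideal.mul_mem_left _ _ hr))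
    exact ⟨_, h1, f * u', Ideal.mul_mem_right _ _ (Ideal.mem_span_singleton_self f),
      sub_add_cancel _ _⟩

theorem mem_ofList_of_X_pow_mul_mem {R : Type} [CommRing R] (fs : List (Polynomial R))
    (hreg : ∀ gs g, gs ++ [g] <+: fs → ∀ v : R,
      Polynomial.eval 0 g * v ∈ (Ideal.ofList gs).map (Polynomial.evalRingHom (0 : R)) →
        v ∈ (Ideal.ofList gs).map (Polynomial.evalRingHom (0 : R))) (k : ℕ) {v : Polynomial R}
    (hv : Polynomial.X ^ k * v ∈ Ideal.ofList fs) : v ∈ Ideal.ofList fs := by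
  induction k with
  | zero => simpa using hv
  | succ k ih =>
    rw [pow_succ', mul_assoc] at hv
    exact ih (mem_ofList_of_X_mul_mem fs hreg hv)

theorem homogeneousSubmodule_le_of_pow_mem {n : ℕ} {k : ℕ}
    {W : Submodule ℂ (MvPolynomial (Fin n) ℂ)} (h : ∀ u, lin u ^ k ∈ W) :
    homogeneousSubmodule (Fin n) ℂ k ≤ W := by
  classical
  suffices hm : ∀ m : Fin n → ℕ, ∑ i, m i = k →
      monomial (Finsupp.equivFunOnFinite.symm m) (1 : ℂ) ∈ W by
    intro f hf
    rw [f.as_sum]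
    refine sum_mem fun m hm' => ?_
    have h1 := hf (mem_support_iff.mp hm')
    have h2 := hm m (by
      rw [← h1, Finsupp.weight_apply, Finsupp.sum_fintype _ _ (by simp)]
      simp)
    have : monomial m (coeff m f) = coeff m f • monomial m (1 : ℂ) := by
      rw [smul_monomial, smul_eq_mul, mul_one]
    rw [this]
    refine W.smul_mem _ ?_
    convert h2
    ext i
    rfl
  intro m hmk
  by_contra hW
  obtain ⟨φ, hφ, hker⟩ := Submodule.exists_le_ker_of_notMem hW
  let c : (Fin n → ℕ) → ℂ := fun m =>
    Nat.multinomial Finset.univ m * φ (monomial (Finsupp.equivFunOnFinite.symm m) (1 : ℂ))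
  have hp : (∑ m ∈ Finset.univ.piAntidiag k, monomial (Finsupp.equivFunOnFinite.symm m) (c m) :
      MvPolynomial (Fin n) ℂ) = 0 := by
    refine MvPolynomial.funext fun u => ?_
    rw [map_zero, ← LinearMap.mem_ker.mp (hker (h u)), lin, Finset.sum_pow_eq_sum_piAntidiag,
      map_sum, map_sum]
    refine Finset.sum_congr rfl fun m _ => ?_
    have h1 : ∏ i, (C (u i) * X i : MvPolynomial (Fin n) ℂ) ^ m i =
        (∏ i, u i ^ m i) • monomial (Finsupp.equivFunOnFinite.symm m) (1 : ℂ) := by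
      simp_rw [mul_pow]
      rw [Finset.prod_mul_distrib, smul_eq_C_mul, monomial_eq, map_one, one_mul, map_prod,
        Finsupp.prod_fintype _ _ (by simp)]
      simp
    rw [h1, eval_monomial, Finsupp.prod_fintype _ _ (by simp)]
    have h2 : ((Nat.multinomial Finset.univ m : ℕ) : MvPolynomial (Fin n) ℂ) *
        (∏ i, u i ^ m i) • monomial (Finsupp.equivFunOnFinite.symm m) (1 : ℂ) =
        (((Nat.multinomial Finset.univ m : ℕ) : ℂ) * ∏ i, u i ^ m i) •
          monomial (Finsupp.equivFunOnFinite.symm m) (1 : ℂ) := by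
      rw [mul_smul, Nat.cast_smul_eq_nsmul, nsmul_eq_mul]
    rw [h2, map_smul, smul_eq_mul]
    simp only [c, Finsupp.equivFunOnFinite_symm_apply_apply]
    ring
  have h1 := congrArg (coeff (Finsupp.equivFunOnFinite.symm m)) hp
  rw [coeff_sum, Finset.sum_eq_single m] at h1
  · rw [coeff_monomial, if_pos rfl, coeff_zero] at h1
    refine (mul_eq_zero.mp h1).elim (fun h => ?_) hφ
    exact (Nat.multinomial_pos _ _).ne' (by exact_mod_cast h)
  · intro m' _ hne
    rw [coeff_monomial, if_neg fun h => hne (Finsupp.equivFunOnFinite.symm.injective h)]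
  · intro h
    exact absurd (Finset.mem_piAntidiag.mpr ⟨hmk, by simp⟩) h

end

section
variable {n : ℕ} {ι : Type}

theorem exists_eval_ne_zero [Finite ι] {p f : MvPolynomial ι ℂ} (hp : Prime p) (h : ¬ p ∣ f) :
    ∃ z, eval z p = 0 ∧ eval z f ≠ 0 := by
  by_contra! hz
  refine h ?_
  have h1 : f ∈ (Ideal.span {p}).radical := by
    rw [← vanishingIdeal_zeroLocus_eq_radical (K := ℂ), mem_vanishingIdeal_iff]
    intro z hz'
    exact hz z (mem_zeroLocus_iff.mp hz' p (Ideal.mem_span_singleton_self p))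
  have h2 : (Ideal.span {p}).IsPrime := (Ideal.span_singleton_prime hp.ne_zero).mpr hp
  rwa [h2.isRadical.radical, Ideal.mem_span_singleton] at h1

theorem isHomogeneous_sum_X (S : Finset ι) : (∑ k ∈ S, X k : MvPolynomial ι ℂ).IsHomogeneous 1 :=
  IsHomogeneous.sum _ _ _ fun k _ => isHomogeneous_X _ k

theorem sum_X_ne_zero {S : Finset ι} (h : S.Nonempty) : (∑ k ∈ S, X k : MvPolynomial ι ℂ) ≠ 0 := by
  intro h0
  have h1 := congrArg (eval fun _ => (1 : ℂ)) h0
  simp only [map_sum, eval_X, Finset.sum_const, nsmul_eq_mul, mul_one, map_zero,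
    Nat.cast_eq_zero, Finset.card_eq_zero] at h1
  exact h.ne_empty h1

theorem totalDegree_sum_X_add_C {S : Finset ι} (h : S.Nonempty) (c : ℂ) :
    (∑ k ∈ S, X k + C c : MvPolynomial ι ℂ).totalDegree = 1 := by
  have h1 := (isHomogeneous_sum_X S).totalDegree (sum_X_ne_zero h)
  rw [totalDegree_add_eq_left_of_totalDegree_lt (by rw [h1, totalDegree_C]; exact zero_lt_one), h1]

theorem prime_sum_X_add_C {S : Finset ι} (h : S.Nonempty) (c : ℂ) :
    Prime (∑ k ∈ S, X k + C c : MvPolynomial ι ℂ) := by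
  have h1 := totalDegree_sum_X_add_C h c
  refine (irreducible_of_totalDegree_eq_one h1 fun x hx => ?_).prime
  have h0 : (∑ k ∈ S, X k + C c : MvPolynomial ι ℂ) ≠ 0 := by
    intro h0
    rw [h0, totalDegree_zero] at h1
    exact zero_ne_one h1
  obtain ⟨m, hm⟩ := ne_zero_iff.mp h0
  exact isUnit_iff_ne_zero.mpr fun h => hm (by simpa [h] using hx m)

theorem prime_sum_X {S : Finset ι} (h : S.Nonempty) :
    Prime (∑ k ∈ S, X k : MvPolynomial ι ℂ) := by
  simpa using prime_sum_X_add_C h 0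

open Classical in
theorem exists_sum_eq_zero {S S' : Finset ι} (h : S ≠ S') (hS' : S'.Nonempty) :
    ∃ z : ι → ℂ, ∑ k ∈ S, z k = 0 ∧ ∑ k ∈ S', z k ≠ 0 := by
  by_cases hsub : S' ⊆ S
  · obtain ⟨k, hk, hk'⟩ : ∃ k ∈ S, k ∉ S' := by
      by_contra! hc
      exact h (Finset.Subset.antisymm hc hsub)
    obtain ⟨k', hk''⟩ := hS'
    refine ⟨Pi.single k' 1 - Pi.single k 1, ?_, ?_⟩
    · simp [Finset.sum_sub_distrib, hk, hsub hk'']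
    · simp [Finset.sum_sub_distrib, hk', hk'']
  · obtain ⟨k, hk, hk'⟩ := Finset.not_subset.mp hsub
    refine ⟨Pi.single k 1, ?_, ?_⟩
    · simp [hk']
    · simp [hk]

theorem not_sum_X_dvd {S S' : Finset ι} (h : S ≠ S') (hS' : S'.Nonempty) :
    ¬ (∑ k ∈ S, X k : MvPolynomial ι ℂ) ∣ ∑ k ∈ S', X k := by
  obtain ⟨z, hz, hz'⟩ := exists_sum_eq_zero h hS'
  rintro ⟨u, hu⟩
  have h1 := congrArg (eval z) hu
  simp only [map_sum, eval_X, map_mul] at h1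
  rw [hz, zero_mul] at h1
  exact hz' h1

theorem not_sum_X_add_C_dvd {S S' : Finset ι} {c c' : ℂ} (hS : S.Nonempty) (hS' : S'.Nonempty)
    (h : S ≠ S' ∨ c ≠ c') :
    ¬ (∑ k ∈ S, X k + C c : MvPolynomial ι ℂ) ∣ ∑ k ∈ S', X k + C c' := by
  classical
  obtain ⟨k, hk⟩ := hS
  rintro ⟨u, hu⟩
  have h1 : ∀ z : ι → ℂ, ∑ k ∈ S, z k + c = 0 → ∑ k ∈ S', z k + c' = 0 := by
    intro z hz
    have h1 := congrArg (eval z) hu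
    simp only [map_sum, eval_X, map_mul, map_add, eval_C] at h1
    rwa [hz, zero_mul] at h1
  by_cases hSS : S = S'
  · subst hSS
    have h2 := h1 (Pi.single k (-c)) (by simp [hk])
    have h3 : ∑ j ∈ S, Pi.single k (-c) j = -c := by simp [hk]
    rw [h3] at h2
    exact h.elim (fun h => h rfl) fun h => h (by linear_combination -h2)
  · obtain ⟨z, hz, hz'⟩ := exists_sum_eq_zero hSS hS'
    have h2 := h1 (Pi.single k (-c)) (by simp [hk])
    have h3 := h1 (Pi.single k (-c) + z) (by
      simp only [Pi.add_apply, Finset.sum_add_distrib, hz]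
      simp [hk])
    simp only [Pi.add_apply, Finset.sum_add_distrib] at h3
    exact hz' (by linear_combination h3 - h2)

end

section
variable {n : ℕ} {ι : Type} {a : ι → Fin n → ℂ} {M : Type} [CommRing M] [Algebra ℂ M]

/-- Translation of polynomials. -/
noncomputable def shift (x : Fin n → ℂ) : MvPolynomial (Fin n) ℂ →ₐ[ℂ] MvPolynomial (Fin n) ℂ :=
  aeval fun j => X j + C (x j)

theorem eval_shift (x z : Fin n → ℂ) (f : MvPolynomial (Fin n) ℂ) :
    eval z (shift x f) = eval (z + x) f := by
  have : ((eval z).comp (shift x).toRingHom : MvPolynomial (Fin n) ℂ →+* ℂ) = eval (z + x) := by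
    ext i <;> simp [shift]
  exact congrFun (congrArg DFunLike.coe this) f

theorem shift_eq_self {x : Fin n → ℂ} {T : Matrix (Fin n) (Fin n) ℂ} (hx : T.mulVec x = 0)
    {f : MvPolynomial (Fin n) ℂ} (hf : comp T f = f) : shift x f = f := by
  refine MvPolynomial.funext fun z => ?_
  rw [eval_shift, ← hf, eval_comp, eval_comp, Matrix.mulVec_add, hx, add_zero]

/-- A curve of symbols through a generic point of a flat. -/
noncomputable def curve (x : Fin n → ℂ) (s b : ι → ℂ) (w : Fin n → ℂ) :
    MvPolynomial (Symb n ι) ℂ →ₐ[ℂ] Polynomial (MvPolynomial (Fin n) ℂ) :=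
  aeval (Sum.elim (Sum.elim (fun j => Polynomial.C (X j + C (x j)))
    fun k => Polynomial.C (C (s k)) + Polynomial.X * Polynomial.C (C (b k) * lin w))
    fun j => Polynomial.X * Polynomial.C (C (w j)))

variable (x : Fin n → ℂ) (s b : ι → ℂ) (w : Fin n → ℂ)

theorem curve_ix (f : MvPolynomial (Fin n) ℂ) :
    curve x s b w (ix f) = Polynomial.C (shift x f) := by
  rw [curve, ix, aeval_rename]
  exact aeval_algebraMap_apply (B := Polynomial (MvPolynomial (Fin n) ℂ)) _ f

theorem curve_s (k : ι) : curve x s b w (X (Sum.inl (Sum.inr k))) =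
    Polynomial.C (C (s k)) + Polynomial.X * Polynomial.C (C (b k) * lin w) := by
  simp [curve]

theorem curve_ξ (j : Fin n) : curve x s b w (X (Sum.inr j)) =
    Polynomial.X * Polynomial.C (C (w j)) := by
  simp [curve]

theorem curve_sum {S : Finset ι} (hs : ∑ k ∈ S, s k = 0) (hb : ∑ k ∈ S, b k = 1) :
    curve x s b w (emb (es (∑ k ∈ S, X k))) = Polynomial.X * Polynomial.C (lin w) := by
  simp only [map_sum, es_X, emb_X, curve_s, Finset.sum_add_distrib]
  rw [← map_sum, ← map_sum, hs, ← Finset.mul_sum, ← map_sum, ← Finset.sum_mul, ← map_sum, hb]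
  simp

theorem eval_zero_curve (f : MvPolynomial ι ℂ) :
    Polynomial.eval 0 (curve x s b w (emb (es f))) = C (eval s f) := by
  have : ((Polynomial.evalRingHom (0 : MvPolynomial (Fin n) ℂ)).comp
      (((curve x s b w).comp (emb.comp es)).toRingHom) : MvPolynomial ι ℂ →+* _) =
      C.comp (eval s) := by
    ext i <;> simp [curve_s]
  exact congrFun (congrArg DFunLike.coe this) f

theorem app_eq_of_mem_span {J : Finset ι} {δ : Fin n → MvPolynomial (Fin n) ℂ} {c : ℂ}
    (h : ∀ k ∈ J, app (a k) δ = lin (a k) * C c)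
    (hw : w ∈ Submodule.span ℂ (a '' (J : Set ι))) : app w δ = lin w * C c := by
  induction hw using Submodule.span_induction with
  | mem u hu =>
    obtain ⟨k, hk, rfl⟩ := hu
    exact h k hk
  | zero => simp [app, lin]
  | add u v _ _ hu hv =>
    rw [lin_add, add_mul, ← hu, ← hv]
    simp [app, add_mul, Finset.sum_add_distrib]
  | smul r u _ hu =>
    rw [lin_smul, mul_assoc, ← hu]
    simp [app, Finset.mul_sum, mul_assoc]

namespace Saito
variable {S : Finset ι} (B : Saito a S)

theorem curve_t (ha : Reduced a) {x : Fin n → ℂ} (hx : x ∈ flat a S) (i : Fin n) :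
    curve x s b w (B.t i) = Polynomial.X * Polynomial.C (app w (B.χ i)) -
      (Polynomial.C (B.α i s) + Polynomial.X * Polynomial.C (lin w * B.α i b)) := by
  have hπ : B.π.mulVec x = 0 := (B.π_ker x).mpr hx
  rw [t, map_sub, map_sum, map_sum]
  refine congrArg₂ (· - ·) ?_ ?_
  · rw [app, map_sum, Finset.mul_sum]
    refine Finset.sum_congr rfl fun j _ => ?_
    rw [map_mul, curve_ix, curve_ξ, shift_eq_self hπ (B.comp_χ i j), map_mul]
    ring
  · rw [α, α, map_sum, Finset.mul_sum, map_sum, Finset.mul_sum, ← Finset.sum_add_distrib]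
    refine Finset.sum_congr rfl fun k hk => ?_
    rw [map_mul, curve_ix, curve_s, shift_eq_self hπ (B.comp_q ha i hk)]
    simp only [map_mul]
    ring

theorem α_of_d_eq_zero (ha : Reduced a) {i : Fin n} (h : B.d i = 0) : B.α i s = 0 :=
  Finset.sum_eq_zero fun k hk => by rw [B.q_eq_zero ha h hk, mul_zero]

theorem α_of_q_eq {i : Fin n} {c : ℂ} (h : ∀ k ∈ S, B.q i k = C c) :
    B.α i s = C ((∑ k ∈ S, s k) * c) := by
  rw [α, Finset.sum_mul, map_sum]
  exact Finset.sum_congr rfl fun k hk => by rw [h k hk, map_mul]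

/-- Lifts along the curve of the complete intersection at its origin. -/
noncomputable def lift (ζ : Fin n → Fin n → ℂ) (x : Fin n → ℂ) (s b : ι → ℂ) (w : Fin n → ℂ)
    (i : Fin n) : Polynomial (MvPolynomial (Fin n) ℂ) :=
  if B.d i = 0 then Polynomial.C (lin (ζ i)) else if B.d i = 1 then Polynomial.C (dp a S) else
    -curve x s b w (B.t i)

theorem eval_lift (ha : Reduced a) {x : Fin n → ℂ} (hx : x ∈ flat a S) (ζ : Fin n → Fin n → ℂ)
    (i : Fin n) : Polynomial.eval 0 (B.lift ζ x s b w i) = B.sys ζ s i := by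
  rw [lift, sys]
  split_ifs
  · simp
  · simp
  · rw [B.curve_t s b w ha hx]
    simp

theorem curve_mem (ha : Reduced a) (hirr : Irr a S) (hne : S.Nonempty) {x : Fin n → ℂ}
    (hx : x ∈ flat a S) (ζ : Fin n → Fin n → ℂ) {s b : ι → ℂ} {w : Fin n → ℂ}
    (hs : ∑ k ∈ S, s k = 0) (hb : ∑ k ∈ S, b k = 1)
    (hw : w ∈ Submodule.span ℂ (a '' (S : Set ι))) {g : MvPolynomial (Symb n ι) ℂ}
    (hg : g ∈ B.tF) : curve x s b w g ∈ Ideal.ofList (List.ofFn (B.lift ζ x s b w)) := by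
  obtain ⟨i₁, c, hc, hi₁, hq, hu⟩ := B.exists_degree_one ha hirr hne
  suffices h : B.tF ≤ (Ideal.ofList (List.ofFn (B.lift ζ x s b w))).comap (curve x s b w) from h hg
  have hmem : ∀ i, B.lift ζ x s b w i ∈ Ideal.ofList (List.ofFn (B.lift ζ x s b w)) := fun i =>
    Ideal.subset_span (by simp)
  rw [tF, Ideal.ofList, Ideal.span_le]
  intro f hf
  simp only [List.mem_append, Set.mem_ofPred_eq, List.mem_singleton] at hf
  rw [SetLike.mem_coe, Ideal.mem_comap]
  rcases hf with hf | rfl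
  · obtain ⟨i, rfl⟩ := (List.mem_ofFn' B.t f).mp hf
    by_cases h0 : B.d i = 0
    · have h1 := app_eq_of_mem_span (c := 0) w
        (fun k hk => by rw [B.app_eq i k hk, B.q_eq_zero ha h0 hk, C_0]) hw
      rw [B.curve_t s b w ha hx, h1, B.α_of_d_eq_zero _ ha h0, B.α_of_d_eq_zero _ ha h0]
      simp
    by_cases h1 : B.d i = 1
    · have h2 : ∀ k ∈ S, B.q i k = C c := hu i h1 ▸ hq
      have h3 := app_eq_of_mem_span (c := c) w (fun k hk => by rw [B.app_eq i k hk, h2 k hk]) hw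
      rw [B.curve_t s b w ha hx, h3, B.α_of_q_eq _ h2, B.α_of_q_eq _ h2, hs, hb]
      simp
    · have h2 := neg_mem (hmem i)
      rwa [lift, if_neg h0, if_neg h1, neg_neg] at h2
  · rw [curve_ix, shift_eq_self ((B.π_ker x).mpr hx) B.comp_dp]
    have h2 := hmem i₁
    rwa [lift, if_neg (by omega), if_pos hi₁] at h2

theorem sys_regular (ha : Reduced a) (hirr : Irr a S) (hne : S.Nonempty) (hJ : IsFlat a S)
    {ζ : Fin n → Fin n → ℂ} (hζ : ∀ x, (∀ i, B.d i = 0 → ζ i ⬝ᵥ x = 0) → B.π.mulVec x = x)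
    {s : ι → ℂ} (hs : ∑ k ∈ S, s k = 0)
    (hs' : ∀ S' : Finset ι, S' ⊆ S → S' ≠ S → S'.Nonempty → IsFlat a S' → ∑ k ∈ S', s k ≠ 0)
    {gs : List (MvPolynomial (Fin n) ℂ)} {g v : MvPolynomial (Fin n) ℂ}
    (hp : gs ++ [g] <+: List.ofFn (B.sys ζ s)) (hv : g * v ∈ Ideal.ofList gs) :
    v ∈ Ideal.ofList gs := by
  obtain ⟨hs₀, h⟩ := hp
  have hmem : ∀ f, f ∈ gs ∨ f = g ∨ f ∈ hs₀ ↔ ∃ i, B.sys ζ s i = f := fun f => by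
    have h1 : f ∈ gs ++ [g] ++ hs₀ ↔ f ∈ List.ofFn (B.sys ζ s) := by rw [h]
    simpa [List.mem_ofFn', or_assoc] using h1
  have h0 : ∀ f, f ∈ gs ∨ f = g ∨ f ∈ hs₀ → eval 0 f = 0 := fun f hf => by
    obtain ⟨i, rfl⟩ := (hmem f).mp hf
    have h1 := B.isHomogeneous_sys ha ζ s i
    rw [eval_zero]
    refine h1.coeff_eq_zero ?_
    have : S.card ≠ 0 := Finset.card_ne_zero.mpr hne
    simp only [map_zero]
    split_ifs <;> omega
  refine mem_ofList_of_mul_mem (w := fun _ => 1) (fun _ => one_ne_zero) gs hs₀ g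
    (fun f hf => ?_) (fun f hf => h0 f (Or.inl hf)) (h0 g (Or.inr (Or.inl rfl)))
    (fun f hf => h0 f (Or.inr (Or.inr hf))) (fun z h1 h2 h3 => ?_) ?_ v hv
  · obtain ⟨i, rfl⟩ := (hmem f).mp (Or.inl hf)
    exact ⟨_, B.isHomogeneous_sys ha ζ s i⟩
  · refine B.eq_zero_of_eval_sys ha hirr hne hJ hζ hs hs' fun i => ?_
    rcases (hmem _).mpr ⟨i, rfl⟩ with hi | hi | hi
    · exact h1 _ hi
    · rw [hi, h2]
    · exact h3 _ hi
  · have h1 := congrArg List.length h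
    simp only [List.length_append, List.length_singleton, List.length_ofFn] at h1
    rw [h1, Fintype.card_fin]

theorem le_of_pow_mul_mem_tF [Fintype ι] (ha : Reduced a) (hirr : Irr a S) (hne : S.Nonempty)
    (hJ : IsFlat a S) {Q : MvPolynomial (Fin n) ℂ} {k : ℕ} {c : MvPolynomial ι ℂ}
    (hQ : ∀ x ∈ flat a S, (∀ k, k ∉ S → a k ⬝ᵥ x ≠ 0) → eval x Q ≠ 0)
    (hc : ¬ (∑ k ∈ S, X k : MvPolynomial ι ℂ) ∣ c)
    (h : ix Q * emb (es ((∑ k ∈ S, X k) ^ k * c)) ∈ B.tF) :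
    2 * (S.card - (n - Module.finrank ℂ (flat a S))) < k := by
  classical
  obtain ⟨s, hs, hsc⟩ := exists_eval_ne_zero (prime_sum_X hne)
    (f := c * ∏ S' ∈ S.powerset.filter (fun S' => S' ≠ S ∧ S'.Nonempty), ∑ k ∈ S', X k) (by
      rw [(prime_sum_X hne).dvd_mul, (prime_sum_X hne).dvd_finsetProd_iff]
      rintro (h | ⟨S', hS', h⟩)
      · exact hc h
      · obtain ⟨-, h1, h2⟩ := Finset.mem_filter.mp hS'
        exact not_sum_X_dvd h1.symm h2 h)
  simp only [map_mul, map_prod, map_sum, eval_X, mul_ne_zero_iff, Finset.prod_ne_zero_iff,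
    Finset.mem_filter, Finset.mem_powerset] at hs hsc
  obtain ⟨k₀, hk₀⟩ := hne
  obtain ⟨b, hb⟩ : ∃ b : ι → ℂ, ∑ k ∈ S, b k = 1 := ⟨Pi.single k₀ 1, by simp [hk₀]⟩
  have hne : S.Nonempty := ⟨k₀, hk₀⟩
  obtain ⟨x, hx, hx'⟩ := exists_generic_point hJ
  obtain ⟨ζ, hζπ, -, hζ⟩ := B.exists_coords ha
  have hs' : ∀ S' : Finset ι, S' ⊆ S → S' ≠ S → S'.Nonempty → IsFlat a S' → ∑ k ∈ S', s k ≠ 0 :=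
    fun S' h1 h2 h3 _ => hsc.2 S' ⟨h1, h2, h3⟩
  set I := Ideal.span (Set.range (B.sys ζ s)) with hI
  have hIl : Ideal.ofList (List.ofFn (B.sys ζ s)) = I := by
    rw [hI, Ideal.ofList]
    congr 1
    ext f
    simp
  have key : ∀ w ∈ Submodule.span ℂ (a '' (S : Set ι)), lin w ^ k ∈ I := by
    intro w hw
    have hcomp : List.map (Polynomial.evalRingHom (0 : MvPolynomial (Fin n) ℂ))
        (List.ofFn (B.lift ζ x s b w)) = List.ofFn (B.sys ζ s) := by
      rw [List.map_ofFn]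
      congr 1
      exact funext fun i => B.eval_lift s b w ha hx ζ i
    have h1 := B.curve_mem ha hirr hne hx ζ hs hb hw h
    rw [map_mul (curve x s b w), curve_ix, map_mul es, map_mul emb, map_mul (curve x s b w),
      map_pow es, map_pow emb, map_pow (curve x s b w), curve_sum x s b w hs hb] at h1
    have hring : ∀ p q r t : Polynomial (MvPolynomial (Fin n) ℂ),
        p * ((q * r) ^ k * t) = q ^ k * (p * r ^ k * t) := fun p q r t => by ring
    rw [hring] at h1
    have h2 := mem_ofList_of_X_pow_mul_mem _ (fun gs g hp v hv => ?_) k h1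
    · have h3 := Ideal.mem_map_of_mem (Polynomial.evalRingHom (0 : MvPolynomial (Fin n) ℂ)) h2
      rw [Ideal.map_ofList, hcomp, hIl, Polynomial.coe_evalRingHom, Polynomial.eval_mul,
        Polynomial.eval_mul, eval_zero_curve, Polynomial.eval_pow, Polynomial.eval_C,
        Polynomial.eval_C, mul_comm, ← mul_assoc] at h3
      refine (hasComponents_span (w := fun _ => 1) (s := Set.range (B.sys ζ s)) ?_).mem_of_mul_mem
        _ (fun _ => one_ne_zero) ?_ h3
      · rintro _ ⟨i, rfl⟩
        exact ⟨_, B.isHomogeneous_sys ha ζ s i⟩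
      · rw [← constantCoeff_eq, ← eval_zero, map_mul, eval_C, eval_shift]
        refine mul_ne_zero hsc.1 ?_
        convert hQ x hx hx'
        exact zero_add x
    · rw [Ideal.map_ofList] at hv ⊢
      refine B.sys_regular ha hirr hne hJ hζ hs hs' ?_ hv
      have h3 := hp.map (Polynomial.evalRingHom (0 : MvPolynomial (Fin n) ℂ))
      rwa [hcomp, List.map_append] at h3
  refine (B.sys_socle ha hirr hne hJ hζ hs hs' k).mp (homogeneousSubmodule_le_of_pow_mem fun u => ?_)
  have h1 : u - Matrix.vecMul u B.π ∈ Submodule.span ℂ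
      (ζ '' ((Finset.univ.filter fun i => B.d i = 0 : Finset (Fin n)) : Set (Fin n))) := by
    refine mem_span_of_forall_flat fun v hv => ?_
    have h2 := hζ v fun i hi => hv i (by simpa using hi)
    rw [sub_dotProduct, ← Matrix.dotProduct_mulVec, h2, sub_self]
  have h2 : Matrix.vecMul u B.π ∈ Submodule.span ℂ (a '' (S : Set ι)) :=
    mem_span_of_forall_flat fun v hv => by
      rw [← Matrix.dotProduct_mulVec, (B.π_ker v).mpr hv, dotProduct_zero]
  have h3 : ∀ v ∈ Submodule.span ℂ
      (ζ '' ((Finset.univ.filter fun i => B.d i = 0 : Finset (Fin n)) : Set (Fin n))),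
      lin v ∈ I := by
    intro v hv
    induction hv using Submodule.span_induction with
    | mem v hv =>
      obtain ⟨i, hi, rfl⟩ := hv
      have hi' : B.d i = 0 := by simpa using hi
      have h4 : B.sys ζ s i ∈ I := Ideal.subset_span ⟨i, rfl⟩
      rwa [sys, if_pos hi'] at h4
    | zero => rw [lin_zero]; exact zero_mem _
    | add u v _ _ hu hv => rw [lin_add]; exact add_mem hu hv
    | smul r u _ hu => rw [lin_smul]; exact Ideal.mul_mem_left _ _ hu
  have h4 : lin u = lin (u - Matrix.vecMul u B.π) + lin (Matrix.vecMul u B.π) := by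
    rw [← lin_add, sub_add_cancel]
  have h5 : lin u ^ k - lin (Matrix.vecMul u B.π) ^ k ∈ I :=
    I.mem_of_dvd (sub_dvd_pow_sub_pow _ _ k) (by rw [h4, add_sub_cancel_right]; exact h3 _ h1)
  exact (Submodule.sub_mem_iff_left _ (key _ h2)).mp h5

end Saito
end

section
variable {n : ℕ} {ι : Type} {a : ι → Fin n → ℂ} {M : Type} [CommRing M] [Algebra ℂ M]

theorem exists_component_ne_zero {σ : Type} {w : σ → ℕ} {f : MvPolynomial σ ℂ} (hf : f ≠ 0) :
    ∃ e, f ∈ low ℂ w (e + 1) ∧ weightedHomogeneousComponent w e f ≠ 0 := by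
  classical
  have h := exists_mem_low (K := ℂ) (w := w) f
  have h1 := Nat.find_spec h
  obtain ⟨e, he⟩ : ∃ e, Nat.find h = e + 1 := by
    refine Nat.exists_eq_add_one_of_ne_zero fun h0 => hf ?_
    rw [h0] at h1
    exact mem_low_zero h1
  rw [he] at h1
  refine ⟨e, h1, fun h0 => Nat.find_min h (m := e) (by omega) ?_⟩
  have h2 := sub_component_mem_low h1
  rwa [h0, sub_zero] at h2

theorem aeval_component_eq {f : MvPolynomial ι ℂ} {g : ι → MvPolynomial ι ℂ} {e : ℕ}
    (hf : f ∈ low ℂ (fun _ => 1) (e + 1)) (hg : ∀ i, (g i).IsHomogeneous 1)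
    (h : aeval g f = f) : aeval g (weightedHomogeneousComponent (fun _ => 1) e f) =
      weightedHomogeneousComponent (fun _ => 1) e f := by
  set t := weightedHomogeneousComponent (fun _ => 1) e f with ht
  have h1 : aeval g (f - t) ∈ low ℂ (fun _ => 1) e := by
    refine low_induction (w := fun _ => 1) (P := fun p => aeval g p ∈ low ℂ (fun _ => 1) e)
      (by simp) (fun f g hf hg => by rw [map_add]; exact add_mem hf hg) (fun m c hm => ?_)
      (sub_component_mem_low hf)
    exact IsWeightedHomogeneous.mem_low
      (isWeightedHomogeneous_aeval (isWeightedHomogeneous_monomial _ _ _ rfl) hg) hm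
  have h2 : IsWeightedHomogeneous (fun _ => 1) (aeval g t) e :=
    isWeightedHomogeneous_aeval (weightedHomogeneousComponent_isWeightedHomogeneous _ _) hg
  have h3 : f = aeval g t + aeval g (f - t) := by rw [← map_add, add_sub_cancel, h]
  have h4 := congrArg (weightedHomogeneousComponent (fun _ => 1) e) h3
  rw [map_add, h2.weightedHomogeneousComponent_same,
    component_eq_zero_of_mem_low h1 le_rfl, add_zero] at h4
  exact h4.symm

theorem exists_reduction {S : Finset ι} (hS : S.Nonempty) (c : ℂ) {b : MvPolynomial ι ℂ}
    (hb : ¬ (∑ k ∈ S, X k + C c) ∣ b) : ∃ κ u e, κ = b - (∑ k ∈ S, X k + C c) * u ∧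
      κ ∈ low ℂ (fun _ => 1) (e + 1) ∧
      ¬ (∑ k ∈ S, X k) ∣ weightedHomogeneousComponent (fun _ => 1) e κ := by
  classical
  obtain ⟨k₀, hk₀⟩ := hS
  set h : MvPolynomial ι ℂ := ∑ k ∈ S, X k + C c with hh
  let E : MvPolynomial ι ℂ →ₐ[ℂ] MvPolynomial ι ℂ := aeval fun k => if k = k₀ then X k₀ - h else X k
  let g : ι → MvPolynomial ι ℂ := fun k => if k = k₀ then X k₀ - ∑ k ∈ S, X k else X k
  have hg : ∀ k, (g k).IsHomogeneous 1 := fun k => by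
    simp only [g]
    split_ifs
    · exact (isHomogeneous_X ℂ k₀).sub (isHomogeneous_sum_X S)
    · exact isHomogeneous_X ℂ k
  have hgS : aeval g (∑ k ∈ S, X k : MvPolynomial ι ℂ) = 0 := by
    have h1 : ∑ k ∈ S.erase k₀, g k = ∑ k ∈ S.erase k₀, X k :=
      Finset.sum_congr rfl fun k hk => if_neg (Finset.ne_of_mem_erase hk)
    rw [map_sum, Finset.sum_congr rfl fun k _ => aeval_X g k, ← Finset.add_sum_erase _ _ hk₀,
      h1, if_pos rfl, ← Finset.add_sum_erase S (fun k => (X k : MvPolynomial ι ℂ)) hk₀]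
    ring
  have hgE : ∀ f, aeval g (E f) = E f := by
    suffices H : (aeval g).comp E = E from fun f => congrFun (congrArg DFunLike.coe H) f
    ext1 k
    simp only [AlgHom.comp_apply, E, aeval_X]
    split_ifs with hk
    · rw [hh, map_sub, map_add, hgS, aeval_X, algHom_C]
      simp only [g, if_true, algebraMap_eq]
      ring
    · rw [aeval_X]
      simp only [g, if_neg hk]
  obtain ⟨u, hu⟩ : h ∣ b - E b := by
    rw [← Ideal.mem_span_singleton, ← Ideal.Quotient.eq]
    have H : (Ideal.Quotient.mkₐ ℂ (Ideal.span {h})) =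
        (Ideal.Quotient.mkₐ ℂ (Ideal.span {h})).comp E := by
      ext1 k
      simp only [AlgHom.comp_apply, E, aeval_X]
      split_ifs with hk
      · rw [hk, map_sub]
        have : Ideal.Quotient.mkₐ ℂ (Ideal.span {h}) h = 0 :=
          Ideal.Quotient.eq_zero_iff_mem.mpr (Ideal.mem_span_singleton_self h)
        rw [this, sub_zero]
      · rfl
    exact congrFun (congrArg DFunLike.coe H) b
  have hE : E b ≠ 0 := fun h0 => hb ⟨u, by rw [← hu, h0, sub_zero]⟩
  obtain ⟨e, he, he'⟩ := exists_component_ne_zero (w := fun _ => 1) hE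
  refine ⟨E b, u, e, by rw [← hu]; ring, he, ?_⟩
  rintro ⟨v, hv⟩
  have h1 := aeval_component_eq he hg (hgE b)
  rw [hv, map_mul, hgS, zero_mul, ← hv] at h1
  exact he' h1.symm

theorem exists_good_prod {κ : Type*} {z : ι → ℂ} (s : Finset κ) {f : κ → MvPolynomial ι ℂ}
    (h : ∀ i ∈ s, ∃ e, Good z (f i) e) : ∃ e, Good z (∏ i ∈ s, f i) e := by
  classical
  induction s using Finset.induction_on with
  | empty => exact ⟨0, by simpa using good_one z⟩
  | insert i s hi ih =>
    obtain ⟨d, hd⟩ := h i (Finset.mem_insert_self i s)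
    obtain ⟨e, he⟩ := ih fun j hj => h j (Finset.mem_insert_of_mem hj)
    rw [Finset.prod_insert hi]
    exact ⟨_, hd.mul he⟩

theorem good_fac {z : ι → ℂ} {S : Finset ι} (h : ∑ k ∈ S, z k ≠ 0) : ∃ e, Good z (fac a S) e := by
  obtain ⟨h1, h2⟩ := prod_linear_mem_low S (2 * (S.card - (n - Module.finrank ℂ (flat a S))) + 1)
    fun j => ((n - Module.finrank ℂ (flat a S) : ℕ) : ℂ) + j
  refine ⟨_, h1, ?_⟩
  rw [fac]
  simp only [lfac]
  rw [h2]
  simpa using h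

namespace Twist
variable [Fintype ι] (T : Twist a M)

theorem lt_of_component_eq (ha : Reduced a) {S : Finset ι} (hS : IsIrrFlat a S) (B : Saito a S)
    {b c : MvPolynomial ι ℂ} {e k : ℕ} (hb : T.al (es b) ∈ T.N Finset.univ)
    (hlow : b ∈ low ℂ (fun _ => 1) (e + 1))
    (hcomp : weightedHomogeneousComponent (fun _ => 1) e b = (∑ k ∈ S, X k) ^ k * c)
    (hc : ¬ (∑ k ∈ S, X k : MvPolynomial ι ℂ) ∣ c) :
    2 * (S.card - (n - Module.finrank ℂ (flat a S))) < k := by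
  classical
  obtain ⟨N, hN⟩ := T.exists_pow_mul_mem_N_of_subset (Finset.subset_univ S) hb
  set Q := dp a (Finset.univ \ S) with hQ
  have hr : ∀ i : ι, (sWeight (Sum.inr i : Fin n ⊕ ι)) = (fun _ => 1) i := fun i => rfl
  have h1 : (es b : MvPolynomial (Fin n ⊕ ι) ℂ) ∈ low ℂ sWeight (e + 1) := rename_mem_low hr hlow
  have h2 : ex (Q ^ N) * es b ∈ low ℂ sWeight (e + 1) :=
    add_comm 1 e ▸ mul_mem_low (ex_mem_low _) h1
  have h3 := T.component_mem_tF ha B (emb_mem_low h2) (by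
    rw [← mul_one (emb _), L_emb_mul, L_one, mul_one, map_mul T.al]
    exact hN)
  have h4 := component_mul (ex_mem_low (n := n) (ι := ι) (Q ^ N)) h1
  rw [zero_add] at h4
  rw [component_emb h2, h4, (isWeightedHomogeneous_ex (Q ^ N)).weightedHomogeneousComponent_same,
    map_mul emb, emb_ex, es, component_rename hr hlow, hcomp] at h3
  refine B.le_of_pow_mul_mem_tF ha hS.2.2 hS.1 hS.2.1 (fun x _ hx => ?_) hc h3
  rw [map_pow]
  refine pow_ne_zero _ fun h => ?_
  obtain ⟨k, hk, hk'⟩ := eval_dp_eq_zero.mp h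
  exact hx k (Finset.mem_sdiff.mp hk).2 hk'

theorem lfac_dvd (ha : Reduced a) (hB : ∀ J, IsFlat a J → Nonempty (Saito a J))
    {S : Finset ι} (hS : IsIrrFlat a S) {j : ℕ}
    (hj : j < 2 * (S.card - (n - Module.finrank ℂ (flat a S))) + 1)
    {b : MvPolynomial ι ℂ} (hb : T.al (es b) ∈ T.N Finset.univ) : lfac a S j ∣ b := by
  classical
  by_contra hnd
  obtain ⟨B⟩ := hB S hS.2.1
  have hbp := T.bpol_mem_N ha hB (J := Finset.univ) fun k _ => Finset.mem_univ k
  set D := 2 * (S.card - (n - Module.finrank ℂ (flat a S))) with hD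
  set F := (Finset.univ : Finset ι).powerset.filter (IsIrrFlat a) with hF
  have hSF : S ∈ F := Finset.mem_filter.mpr ⟨by simp, hS⟩
  set P := ∏ i ∈ (Finset.range (D + 1)).erase j, lfac a S i with hP
  set R := ∏ S' ∈ F.erase S, fac a S' with hR
  have hbpol : bpol a Finset.univ = lfac a S j * P * R := by
    rw [bpol, ← Finset.mul_prod_erase _ _ hSF, fac,
      ← Finset.mul_prod_erase _ _ (Finset.mem_range.mpr hj)]
  obtain ⟨κ, u, e, hκ, hlow, htop⟩ := exists_reduction hS.1 _ hnd
  obtain ⟨z, hz, hz'⟩ := exists_eval_ne_zero (prime_sum_X hS.1)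
    (f := weightedHomogeneousComponent (fun _ => 1) e κ * ∏ S' ∈ F.erase S, ∑ k ∈ S', X k) (by
      rw [(prime_sum_X hS.1).dvd_mul, (prime_sum_X hS.1).dvd_finsetProd_iff]
      rintro (h | ⟨S', hS', h⟩)
      · exact htop h
      · obtain ⟨h1, h2⟩ := Finset.mem_erase.mp hS'
        exact not_sum_X_dvd h1.symm (Finset.mem_filter.mp h2).2.1 h)
  rw [map_mul, map_prod, mul_ne_zero_iff, Finset.prod_ne_zero_iff] at hz'
  obtain ⟨e', he'⟩ := exists_good_prod (F.erase S) (z := z) (f := fac a) fun S' hS' =>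
    good_fac (by simpa using hz'.2 S' hS')
  have hg : Good z (κ * R) (e + e') := Good.mul ⟨hlow, hz'.1⟩ he'
  obtain ⟨hPl, hPt⟩ := prod_mem_low ((Finset.range (D + 1)).erase j) (w := fun _ => 1)
    (f := lfac a S) fun i _ => (linear_add_C_mem_low (isHomogeneous_sum_X S) _).1
  have hcard : ((Finset.range (D + 1)).erase j).card = D := by
    rw [Finset.card_erase_of_mem (Finset.mem_range.mpr hj), Finset.card_range, Nat.add_sub_cancel]
  have hlf : ∀ i, weightedHomogeneousComponent (fun _ => 1) 1 (lfac a S i) = ∑ k ∈ S, X k :=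
    fun i => (linear_add_C_mem_low (isHomogeneous_sum_X S) _).2
  rw [hcard, Finset.prod_congr rfl fun i _ => hlf i, Finset.prod_const, hcard] at hPt
  rw [hcard] at hPl
  have hmem : T.al (es (P * (κ * R))) ∈ T.N Finset.univ := by
    have h1 : P * (κ * R) = P * R * b - u * bpol a Finset.univ := by
      rw [hbpol, hκ]
      simp only [lfac]
      ring
    rw [h1, map_sub es, map_mul es, map_mul es u, map_sub T.al, map_mul T.al, map_mul T.al]
    exact sub_mem (T.al_mul_mem_N hb _) (T.al_mul_mem_N hbp _)
  refine (T.lt_of_component_eq ha hS B hmem (c := weightedHomogeneousComponent (fun _ => 1) (e + e') (κ * R)) (e := D + (e + e')) (k := D) ?_ ?_ ?_).ne rfl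
  · exact add_right_comm D (e + e') 1 ▸ mul_mem_low hPl hg.1
  · rw [component_mul hPl hg.1, hPt]
  · rintro ⟨v, hv⟩
    refine hg.2 ?_
    rw [hv, map_mul, hz, zero_mul]

theorem bpol_dvd (ha : Reduced a) (hB : ∀ J, IsFlat a J → Nonempty (Saito a J))
    {b : MvPolynomial ι ℂ} (hb : T.al (es b) ∈ T.N Finset.univ) : bpol a Finset.univ ∣ b := by
  classical
  have hrel : ∀ S S' : Finset ι, S.Nonempty → S'.Nonempty → ∀ j j' : ℕ, S ≠ S' ∨ j ≠ j' →
      IsRelPrime (lfac a S j) (lfac a S' j') := by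
    intro S S' hS hS' j j' h
    refine ((prime_sum_X_add_C hS _).irreducible.isRelPrime_iff_not_dvd).mpr ?_
    refine not_sum_X_add_C_dvd hS hS' ?_
    by_cases hSS : S = S'
    · subst hSS
      refine Or.inr fun hc => h.elim (fun h => h rfl) fun h => h ?_
      exact_mod_cast add_left_cancel hc
    · exact Or.inl hSS
  refine Finset.prod_dvd_of_isRelPrime ?_ fun S hS => ?_
  · intro S hS S' hS' hne
    refine IsRelPrime.prod_left fun j _ => IsRelPrime.prod_right fun j' _ => ?_
    exact hrel S S' (Finset.mem_filter.mp hS).2.1 (Finset.mem_filter.mp hS').2.1 j j' (Or.inl hne)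
  · obtain ⟨-, hS⟩ := Finset.mem_filter.mp hS
    refine Finset.prod_dvd_of_isRelPrime ?_ fun j hj => ?_
    · intro j _ j' _ hne
      exact hrel S S hS.1 hS.1 j j' (Or.inr hne)
    · exact T.lfac_dvd ha hB hS (Finset.mem_range.mp hj) hb

end Twist
end

section
variable {n : ℕ} {ι : Type} {l : ι → MvPolynomial (Fin n) ℂ}

variable (l) in
/-- The coefficient vectors of the linear forms. -/
noncomputable def coeffVec (k : ι) : Fin n → ℂ := fun i => coeff (Finsupp.single i 1) (l k)

theorem le_hyp_iff [Fintype ι] {Y : Submodule ℂ (Fin n → ℂ)} {k : ι} :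
    Y ≤ hyp l k ↔ ∀ v ∈ Y, coeffVec l k ⬝ᵥ v = 0 := by
  refine forall₂_congr fun v _ => ?_
  rw [hyp, LinearMap.mem_ker]
  simp [toLin, dotProduct, coeffVec]

theorem irredOn_iff [Fintype ι] {J : Finset ι} : IrredOn l J ↔ Irr (coeffVec l) J := by
  simp only [IrredOn, Irr, le_hyp_iff]

theorem iInf_hyp [Fintype ι] (I : Finset ι) : ⨅ i ∈ I, hyp l i = flat (coeffVec l) I := by
  refine le_antisymm (fun v hv k hk => ?_) (le_iInf₂ fun k hk => le_hyp_iff.mpr fun v hv => hv k hk)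
  exact le_hyp_iff.mp (iInf₂_le k hk) v hv

variable [Fintype ι]

theorem mem_JX {Y : Submodule ℂ (Fin n → ℂ)} {k : ι} :
    k ∈ JX l Y ↔ ∀ v ∈ Y, coeffVec l k ⬝ᵥ v = 0 := by
  classical
  rw [JX, Finset.mem_filter, le_hyp_iff]
  simp

theorem isFlat_JX (Y : Submodule ℂ (Fin n → ℂ)) : IsFlat (coeffVec l) (JX l Y) := fun _ hk =>
  mem_JX.mpr fun v hv => hk v fun _ hk' => mem_JX.mp hk' v hv

theorem flat_JX_flat (I : Finset ι) :
    flat (coeffVec l) (JX l (flat (coeffVec l) I)) = flat (coeffVec l) I :=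
  le_antisymm (fun _ hv k hk => hv k (mem_JX.mpr fun _ hw => hw k hk))
    fun v hv _ hk => mem_JX.mp hk v hv

theorem JX_flat {J : Finset ι} (hJ : IsFlat (coeffVec l) J) : JX l (flat (coeffVec l) J) = J :=
  Finset.ext fun k => ⟨fun hk => hJ k (mem_JX.mp hk), fun hk => mem_JX.mpr fun _ hv => hv k hk⟩

theorem mem_LA {Y : Submodule ℂ (Fin n → ℂ)} :
    Y ∈ LA l ↔ ∃ I : Finset ι, I.Nonempty ∧ flat (coeffVec l) I = Y := by
  simp [LA, iInf_hyp]

theorem bGen_eq_bpol : bGen l = bpol (coeffVec l) Finset.univ := by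
  classical
  rw [bGen, bpol]
  refine Finset.prod_bij' (fun Y _ => JX l Y) (fun S _ => flat (coeffVec l) S) ?_ ?_ ?_ ?_ ?_
  · intro Y hY
    obtain ⟨hY, hirr⟩ := Finset.mem_filter.mp hY
    obtain ⟨I, ⟨k, hk⟩, rfl⟩ := mem_LA.mp hY
    exact Finset.mem_filter.mpr ⟨by simp, ⟨k, mem_JX.mpr fun v hv => hv k hk⟩, isFlat_JX _,
      irredOn_iff.mp hirr⟩
  · intro S hS
    obtain ⟨-, hne, hS, hirr⟩ := Finset.mem_filter.mp hS
    refine Finset.mem_filter.mpr ⟨mem_LA.mpr ⟨S, hne, rfl⟩, ?_⟩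
    rwa [JX_flat hS, irredOn_iff]
  · intro Y hY
    obtain ⟨I, -, rfl⟩ := mem_LA.mp (Finset.mem_filter.mp hY).1
    exact flat_JX_flat I
  · exact fun S hS => JX_flat (Finset.mem_filter.mp hS).2.2.1
  · intro Y hY
    obtain ⟨I, -, rfl⟩ := mem_LA.mp (Finset.mem_filter.mp hY).1
    have h := flat_JX_flat (l := l) I
    generalize JX l (flat (coeffVec l) I) = J at h ⊢
    simp only [fac, lfac, rX]
    rw [h]

end

section
variable {A M : Type} [CommRing A] [Algebra ℂ A] [CommRing M] [Algebra ℂ M] [Algebra A M]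

theorem exists_unit_mul_eq (F : A) [IsLocalization.Away F M]
    (m : M) : ∃ g r : A, IsUnit (algebraMap A M g) ∧
    algebraMap A M g * m = algebraMap A M r := by
  obtain ⟨⟨r, g⟩, h⟩ := IsLocalization.surj (Submonoid.powers F) m
  exact ⟨g, r, IsLocalization.map_units M g, by rw [mul_comm]; exact h⟩

theorem leibniz_of_localization (F : A) [IsLocalization.Away F M]
    (E : M →ₗ[ℂ] M) (d : A → A)
    (h1 : E 1 = 0) (h : ∀ r m, E (algebraMap A M r * m) =
      algebraMap A M (d r) * m + algebraMap A M r * E m) (m m' : M) :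
    E (m * m') = m * E m' + m' * E m := by
  obtain ⟨g, r, hg, hr⟩ := exists_unit_mul_eq F m
  have hd : ∀ r, E (algebraMap A M r) = algebraMap A M (d r) := fun r => by
    have := h r 1
    rwa [h1, mul_zero, add_zero, mul_one, mul_one] at this
  refine hg.mul_left_cancel ?_
  have h2 := h g (m * m')
  rw [← mul_assoc, hr, h, ← hd, ← hr, h] at h2
  linear_combination -h2

theorem derivation_eq_zero_of_localization (F : A) [IsLocalization.Away F M]
    (d : Derivation ℂ M M)
    (h : ∀ r, d (algebraMap A M r) = 0) (m : M) : d m = 0 := by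
  obtain ⟨g, r, hg, hr⟩ := exists_unit_mul_eq F m
  have h1 := h r
  rw [← hr, d.leibniz, h, smul_zero, add_zero, smul_eq_mul] at h1
  exact (hg.mul_right_eq_zero).mp h1

end

section
variable {n : ℕ} {ι : Type} [Fintype ι] {l : ι → MvPolynomial (Fin n) ℂ}
  {D : Fin n → Module.End ℂ
      (Localization.Away (rename Sum.inl (∏ i, l i) : MvPolynomial (Fin n ⊕ ι) ℂ))}

theorem lin_coeffVec (hl : ∀ k, (l k).IsHomogeneous 1) (k : ι) : lin (coeffVec l k) = l k :=
  (eq_lin_of_isHomogeneous (hl k)).symm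

theorem IsTwisted.leibniz (hD : IsTwisted l D) (i : Fin n)
    (m m' : Localization.Away (rename Sum.inl (∏ i, l i) : MvPolynomial (Fin n ⊕ ι) ℂ)) :
    (D i - LinearMap.mulLeft ℂ (D i 1)) (m * m') =
      m * (D i - LinearMap.mulLeft ℂ (D i 1)) m' + m' * (D i - LinearMap.mulLeft ℂ (D i 1)) m := by
  refine leibniz_of_localization (rename Sum.inl (∏ i, l i) : MvPolynomial (Fin n ⊕ ι) ℂ) _
    (pderiv (Sum.inl i)) (by simp) (fun r m => ?_) m m'
  simp only [LinearMap.sub_apply, LinearMap.mulLeft_apply, hD.1]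
  ring

/-- The untwisted partial derivatives on the localization. -/
noncomputable def IsTwisted.der (hD : IsTwisted l D) (i : Fin n) : Derivation ℂ
    (Localization.Away (rename Sum.inl (∏ i, l i) : MvPolynomial (Fin n ⊕ ι) ℂ))
    (Localization.Away (rename Sum.inl (∏ i, l i) : MvPolynomial (Fin n ⊕ ι) ℂ)) :=
  Derivation.mk' (D i - LinearMap.mulLeft ℂ (D i 1)) (hD.leibniz i)

theorem IsTwisted.der_apply (hD : IsTwisted l D) (i : Fin n)
    (m : Localization.Away (rename Sum.inl (∏ i, l i) : MvPolynomial (Fin n ⊕ ι) ℂ)) :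
    hD.der i m = D i m - D i 1 * m := rfl

theorem IsTwisted.der_algebraMap (hD : IsTwisted l D) (i : Fin n)
    (r : MvPolynomial (Fin n ⊕ ι) ℂ) :
    hD.der i (algebraMap _ _ r) = algebraMap _ _ (pderiv (Sum.inl i) r) := by
  have h := hD.1 i r 1
  rw [mul_one, mul_one] at h
  rw [hD.der_apply, h]
  ring

theorem pderiv_comm {σ : Type} (i j : σ) (r : MvPolynomial σ ℂ) :
    pderiv i (pderiv j r) = pderiv j (pderiv i r) := by
  classical
  have h : ⁅pderiv (R := ℂ) i, pderiv (R := ℂ) j⁆ = 0 := by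
    refine derivation_ext fun k => ?_
    rw [Derivation.commutator_apply, pderiv_X, pderiv_X, Pi.single_apply, Pi.single_apply]
    split_ifs <;> simp
  rw [← sub_eq_zero, ← Derivation.commutator_apply, h, Derivation.zero_apply]

theorem IsTwisted.der_comm (hD : IsTwisted l D) (i j : Fin n)
    (m : Localization.Away (rename Sum.inl (∏ i, l i) : MvPolynomial (Fin n ⊕ ι) ℂ)) :
    hD.der i (hD.der j m) = hD.der j (hD.der i m) := by
  have h := derivation_eq_zero_of_localization
    (rename Sum.inl (∏ i, l i) : MvPolynomial (Fin n ⊕ ι) ℂ) ⁅hD.der i, hD.der j⁆ (fun r => by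
      rw [Derivation.commutator_apply, hD.der_algebraMap, hD.der_algebraMap, hD.der_algebraMap,
        hD.der_algebraMap, pderiv_comm, sub_self]) m
  rwa [Derivation.commutator_apply, sub_eq_zero] at h

theorem exists_twist (hl : ∀ k, (l k).IsHomogeneous 1) (hl0 : ∀ k, l k ≠ 0)
    (hD : IsTwisted l D) : ∃ T : Twist (coeffVec l)
      (Localization.Away (rename Sum.inl (∏ i, l i) : MvPolynomial (Fin n ⊕ ι) ℂ)),
    (∀ r, T.al r = algebraMap _ _ r) ∧ ∀ i, T.nab Finset.univ i = D i := by
  classical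
  have hF0 : (rename Sum.inl (∏ i, l i) : MvPolynomial (Fin n ⊕ ι) ℂ) ≠ 0 := by
    rw [Ne, map_eq_zero_iff _ (rename_injective _ Sum.inl_injective)]
    exact Finset.prod_ne_zero_iff.mpr fun k _ => hl0 k
  have hFu : IsUnit (algebraMap _ (Localization.Away
      (rename Sum.inl (∏ i, l i) : MvPolynomial (Fin n ⊕ ι) ℂ))
      (rename Sum.inl (∏ i, l i) : MvPolynomial (Fin n ⊕ ι) ℂ)) :=
    IsLocalization.Away.algebraMap_isUnit _
  have hu : ∀ k, ∃ u : Localization.Away (rename Sum.inl (∏ i, l i) : MvPolynomial (Fin n ⊕ ι) ℂ),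
      u * algebraMap _ (Localization.Away
      (rename Sum.inl (∏ i, l i) : MvPolynomial (Fin n ⊕ ι) ℂ)) (ex (lin (coeffVec l k))) = 1 := fun k => by
    rw [lin_coeffVec hl]
    refine (IsUnit.exists_left_inv (isUnit_of_dvd_unit (map_dvd _ ?_) hFu))
    exact map_dvd _ (Finset.dvd_prod_of_mem l (Finset.mem_univ k))
  choose u hu using hu
  let T : Twist (coeffVec l) (Localization.Away
      (rename Sum.inl (∏ i, l i) : MvPolynomial (Fin n ⊕ ι) ℂ)) :=
    { al := Algebra.algHom ℂ _ _
      δ := hD.der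
      δ_al := hD.der_algebraMap
      δ_comm := hD.der_comm
      inj := IsLocalization.injective _ (powers_le_nonZeroDivisors_of_noZeroDivisors hF0)
      il := u
      il_mul := hu }
  have hT : ∀ r, T.al r = algebraMap _ _ r := fun r => rfl
  refine ⟨T, hT, fun i => LinearMap.ext fun m => ?_⟩
  have hdp : T.al (ex (dp (coeffVec l) Finset.univ)) =
      algebraMap _ _ (rename Sum.inl (∏ i, l i) : MvPolynomial (Fin n ⊕ ι) ℂ) := by
    rw [hT, dp, Finset.prod_congr rfl fun k _ => lin_coeffVec hl k]
    rfl
  have hψ : T.ψ Finset.univ i = D i 1 := by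
    refine hFu.mul_left_cancel ?_
    rw [hD.2 i, ← hdp, T.dp_mul_ψ, hT, Psi]
    refine congrArg _ (Finset.sum_congr rfl fun k _ => ?_)
    have h : pderiv i (l k) = C (coeffVec l k i) := by
      rw [← pderiv_lin, lin_coeffVec hl]
    rw [dp, Finset.prod_congr rfl fun k _ => lin_coeffVec hl k, h]
    rfl
  rw [Twist.nab_apply, hψ]
  exact sub_add_cancel _ _

theorem mem_N_iff (hl : ∀ k, (l k).IsHomogeneous 1) (T : Twist (coeffVec l)
      (Localization.Away (rename Sum.inl (∏ i, l i) : MvPolynomial (Fin n ⊕ ι) ℂ)))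
    (hT : ∀ r, T.al r = algebraMap _ _ r) (hnab : ∀ i, T.nab Finset.univ i = D i)
    (m : Localization.Away (rename Sum.inl (∏ i, l i) : MvPolynomial (Fin n ⊕ ι) ℂ)) :
    m ∈ T.N Finset.univ ↔ ∃ P ∈ Wa l D, m =
      P (algebraMap _ _ (rename Sum.inl (∏ i, l i) : MvPolynomial (Fin n ⊕ ι) ℂ)) := by
  have hdp : T.al (ex (dp (coeffVec l) Finset.univ)) =
      algebraMap _ _ (rename Sum.inl (∏ i, l i) : MvPolynomial (Fin n ⊕ ι) ℂ) := by
    rw [hT, dp, Finset.prod_congr rfl fun k _ => lin_coeffVec hl k]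
    rfl
  rw [← hdp]
  constructor
  · have hs : ∀ s, LinearMap.mulLeft ℂ (T.al s) ∈ Wa l D := fun s => by
      induction s using MvPolynomial.induction_on with
      | C c =>
        have h : LinearMap.mulLeft ℂ (T.al (C c)) = algebraMap ℂ _ c := by
          refine LinearMap.ext fun m => ?_
          rw [algHom_C, LinearMap.mulLeft_apply, Module.algebraMap_end_apply, Algebra.smul_def]
        exact h ▸ Subalgebra.algebraMap_mem _ c
      | add f g hf hg =>
        have h : LinearMap.mulLeft ℂ (T.al (f + g)) =
            LinearMap.mulLeft ℂ (T.al f) + LinearMap.mulLeft ℂ (T.al g) :=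
          LinearMap.ext fun m => by simp [add_mul]
        exact h ▸ add_mem hf hg
      | mul_X f i hf =>
        rw [map_mul, LinearMap.mulLeft_mul]
        refine mul_mem hf (Algebra.subset_adjoin ?_)
        rcases i with i | i
        · exact Or.inl (Or.inl ⟨i, by rw [hT]⟩)
        · exact Or.inl (Or.inr ⟨i, by rw [hT]⟩)
    have hq : ∀ q, T.act Finset.univ q ∈ Wa l D := fun q => by
      induction q using MvPolynomial.induction_on with
      | C c => exact (algHom_C (T.act Finset.univ) c).symm ▸ Subalgebra.algebraMap_mem _ c
      | add f g hf hg => exact (map_add (T.act Finset.univ) f g).symm ▸ add_mem hf hg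
      | mul_X f i hf =>
        rw [map_mul, T.act_X, hnab]
        exact mul_mem hf (Algebra.subset_adjoin (Or.inr ⟨i, rfl⟩))
    rintro ⟨g, rfl⟩
    induction g using symb_induction with
    | h0 => exact ⟨0, zero_mem _, by rw [map_zero, LinearMap.zero_apply]⟩
    | hadd f g hf hg =>
      obtain ⟨P, hP, hf⟩ := hf
      obtain ⟨Q, hQ, hg⟩ := hg
      exact ⟨P + Q, add_mem hP hQ, by rw [map_add, hf, hg, LinearMap.add_apply]⟩
    | hm s b => exact ⟨_, mul_mem (hs s) (hq _), T.L_emb_mul_rename _ _ _ _⟩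
  · rintro ⟨P, hP, rfl⟩
    suffices H : ∀ P ∈ Wa l D, ∀ m ∈ T.N Finset.univ, P m ∈ T.N Finset.univ from
      H P hP _ (T.dp_mem_N)
    intro P hP
    induction hP using Algebra.adjoin_induction with
    | mem P hP =>
      intro m hm
      rcases hP with (⟨i, rfl⟩ | ⟨i, rfl⟩) | ⟨i, rfl⟩
      · simpa [hT] using T.al_mul_mem_N hm (X (Sum.inl i))
      · simpa [hT] using T.al_mul_mem_N hm (X (Sum.inr i))
      · simpa [hnab] using T.nab_mem_N hm i
    | algebraMap c => exact fun m hm => Submodule.smul_mem _ c hm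
    | add P Q _ _ hP hQ => exact fun m hm => add_mem (hP m hm) (hQ m hm)
    | mul P Q _ _ hP hQ => exact fun m hm => hP _ (hQ m hm)

theorem reduced_coeffVec (hl : ∀ k, (l k).IsHomogeneous 1) (hl0 : ∀ k, l k ≠ 0)
    (hprop : ∀ i j, i ≠ j → ∀ c : ℂ, l i ≠ c • l j) : Reduced (coeffVec l) where
  ne_zero k h := hl0 k (by rw [← lin_coeffVec hl, h, lin_zero])
  eq_of_smul i j c h := by
    by_contra hij
    refine hprop i j hij c ?_
    rw [← lin_coeffVec hl i, h, lin_smul, lin_coeffVec hl, smul_eq_C_mul]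

end

end Arrangement

open Arrangement in
/-- **Theorem (Statement 0).** If the central arrangement defined by the pairwise
non-proportional linear forms `l₁,…,l_p` is free, then its Bernstein ideal is the
principal ideal generated by
`b_A = ∏_{X ∈ L'(A)} ∏_{j=0}^{2(card J(X) − r(X))} ((∑_{i ∈ J(X)} sᵢ) + r(X) + j)`. -/
theorem bernstein_ideal_of_free_arrangement
    (n p : ℕ) (hp : 1 ≤ p) (l : Fin p → MvPolynomial (Fin n) ℂ)
    (hl0 : ∀ i, l i ≠ 0) (hlh : ∀ i, (l i).IsHomogeneous 1)
    (hprop : ∀ i j, i ≠ j → ∀ c : ℂ, l i ≠ c • l j)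
    (hfree : Module.Free (MvPolynomial (Fin n) ℂ) (DA l))
    (D : Fin n → Module.End ℂ
      (Localization.Away (rename Sum.inl (∏ i, l i) : MvPolynomial (Fin n ⊕ Fin p) ℂ)))
    (hD : IsTwisted l D) :
    Bideal l D = ↑(Ideal.span {bGen l}) := by
  have : Nonempty (Fin p) := ⟨⟨0, hp⟩⟩
  have ha := reduced_coeffVec hlh hl0 hprop
  have hB : ∀ J, IsFlat (coeffVec l) J → Nonempty (Saito (coeffVec l) J) := fun J hJ =>
    exists_saito ha (by rwa [funext (lin_coeffVec hlh)]) hJ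
  obtain ⟨T, hT, hnab⟩ := exists_twist hlh hl0 hD
  ext b
  rw [SetLike.mem_coe, Ideal.mem_span_singleton, bGen_eq_bpol]
  refine (mem_N_iff hlh T hT hnab _).symm.trans ?_
  rw [← hT]
  constructor
  · exact T.bpol_dvd ha hB
  · rintro ⟨c, rfl⟩
    have h := T.al_mul_mem_N (T.bpol_mem_N ha hB (J := Finset.univ) fun k _ => Finset.mem_univ k)
      (es c)
    rwa [← map_mul T.al, ← map_mul es, mul_comm] at h
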